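/- Let u,v ∈ S_n have separated descents at position k and let w ∈ S_n. A pipe puzzle π ∈ PP(u,v,w) satisfies wt(π)|_{y=t} ≠ 0 only if π has no empty tile on the main diagonal; any such π has each diagonal tile (position (i,i)) equal to an elbow ⌐ or a vertical pipe, and every tile strictly southwest of the diagonal equal to a vertical pipe. Consequently c_{u,v}^w(t,t) = Σ wt(π)|_{y_i→t_i}, summed over those π ∈ PP(u,v,w) having no empty tile on the diagonal (recovering the Knutson–Zinn-Justin separated-descent puzzle rule). -/

import Mathlib

open MvPolynomial

noncomputable section

namespace BPDPuzzle

/-- `x ⊖ y = (x - y)/(1 + β·y)`. -/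
def ominus {K : Type*} [Field K] (β a b : K) : K := (a - b) / (1 + β * b)

/-- A permutation of `ℕ` lying in `S_∞`, i.e. fixing all sufficiently large integers. -/
def FinPerm (w : Equiv.Perm ℕ) : Prop := ∃ N : ℕ, ∀ j, N ≤ j → w j = j

/-- A permutation of `ℕ` lying in `S_n` (0-based positions `0, …, n-1`). -/
def InSn (n : ℕ) (w : Equiv.Perm ℕ) : Prop := ∀ j, n ≤ j → w j = j

/-- Coxeter length: the number of inversions. -/
def len (w : Equiv.Perm ℕ) : ℕ := Set.ncard {p : ℕ × ℕ | p.1 < p.2 ∧ w p.2 < w p.1}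

/-- The simple transposition `s_i`, exchanging the (0-based) positions `i` and `i+1`. -/
def sTr (i : ℕ) : Equiv.Perm ℕ := Equiv.swap i (i + 1)

/-- `u` and `v` have separated descents at position `k`, i.e.
`maxdes(u) ≤ k ≤ mindes(v)` (in 0-based conventions: `u` has no descent at any
0-based position `≥ k` and `v` has no descent at any 0-based position `< k-1`). -/
def SepDesc (k : ℕ) (u v : Equiv.Perm ℕ) : Prop :=
  (∀ i, k ≤ i → u i ≤ u (i + 1)) ∧ (∀ i, i + 1 < k → v i ≤ v (i + 1))

/-- The longest element `n ⋯ 2 1` of `S_n`, extended by the identity. -/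
def revPerm (n : ℕ) : Equiv.Perm ℕ where
  toFun j := if j < n then n - 1 - j else j
  invFun j := if j < n then n - 1 - j else j
  left_inv j := by dsimp only; split_ifs <;> omega
  right_inv j := by dsimp only; split_ifs <;> omega

/-- Exchange the values of a valuation at the indices `i` and `i+1`. -/
def swapVal {K : Type*} (t : ℕ → K) (i : ℕ) : ℕ → K :=
  fun j => if j = i then t (i + 1) else if j = i + 1 then t i else t j

/-- The defining properties of the family of double Grothendieck polynomials
`𝔊_w(x, t)`, viewed as a family of polynomials in the `x`-variables depending on
a valuation `t` of the second set of variables:  the initial condition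
`𝔊_{n⋯21}(x,t) = ∏_{i+j≤n} (x_i ⊖ t_j)` together with the Demazure recursion
`π_i 𝔊_w = 𝔊_{w s_i}` whenever `w(i) > w(i+1)` (the latter written with the
denominator `x_i - x_{i+1}` cleared). -/
def GrothFamily {K : Type*} [Field K] (β : K)
    (G : (ℕ → K) → Equiv.Perm ℕ → MvPolynomial ℕ K) : Prop :=
  ∀ t : ℕ → K, (∀ j, 1 + β * t j ≠ 0) →
    (∀ n : ℕ, G t (revPerm n) =
      ∏ i ∈ Finset.range n, ∏ j ∈ Finset.range (n - 1 - i),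
        C ((1 + β * t j)⁻¹) * (X i - C (t j))) ∧
    (∀ (w : Equiv.Perm ℕ) (i : ℕ), w (i + 1) < w i →
      (X i - X (i + 1)) * G t (w * sTr i) =
        (1 + C β * X (i + 1)) * G t w
          - (1 + C β * X i) * rename ⇑(Equiv.swap i (i + 1)) (G t w))

/-- The defining property of the structure constants `c_{u,v}^w(t,y)`:
`𝔊_u(x,y) · 𝔊_v(x,t) = Σ_w c_{u,v}^w(t,y) · 𝔊_w(x,t)`, the (finitely supported)
sum ranging over the permutations `w ∈ S_∞`. -/
def StructConsts {K : Type*} [Field K] (β : K)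
    (G : (ℕ → K) → Equiv.Perm ℕ → MvPolynomial ℕ K)
    (c : (ℕ → K) → (ℕ → K) → Equiv.Perm ℕ → Equiv.Perm ℕ → Equiv.Perm ℕ → K) : Prop :=
  ∀ t y : ℕ → K, (∀ j, 1 + β * t j ≠ 0) → (∀ j, 1 + β * y j ≠ 0) →
    ∀ u v : Equiv.Perm ℕ, FinPerm u → FinPerm v →
      {w : Equiv.Perm ℕ | c t y u v w ≠ 0}.Finite ∧
      (∀ w, ¬ FinPerm w → c t y u v w = 0) ∧
      G y u * G t v = ∑ᶠ w : Equiv.Perm ℕ, C (c t y u v w) * G t w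

/-! ### The lattice model / pipe puzzles -/

/-- A state of the `n × n` lattice model: labels in `{0, …, n}` on all horizontal
and vertical (half-)edges.  `sst.1 i j` is the `j`-th horizontal (half-)edge of row
`i` (`j = 0` being the left boundary and `j = n` the right boundary), and
`sst.2 i j` is the `i`-th vertical (half-)edge of column `j` (`i = 0` the top
boundary, `i = n` the bottom boundary). -/
abbrev GridState (n : ℕ) : Type :=
  (Fin n → Fin (n + 1) → Fin (n + 1)) × (Fin (n + 1) → Fin n → Fin (n + 1))

/-- The label on the north edge of the tile in row `i`, column `j`. -/
def labN {n : ℕ} (sst : GridState n) (i j : Fin n) : ℕ := (sst.2 i.castSucc j : ℕ)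
/-- The label on the east edge of the tile in row `i`, column `j`. -/
def labE {n : ℕ} (sst : GridState n) (i j : Fin n) : ℕ := (sst.1 i j.succ : ℕ)
/-- The label on the west edge of the tile in row `i`, column `j`. -/
def labW {n : ℕ} (sst : GridState n) (i j : Fin n) : ℕ := (sst.1 i j.castSucc : ℕ)
/-- The label on the south edge of the tile in row `i`, column `j`. -/
def labS {n : ℕ} (sst : GridState n) (i j : Fin n) : ℕ := (sst.2 i.succ j : ℕ)

/-- Boundary label `κ_u` on the right side (0-based row `i`, 1-based pipe labels). -/
def kappaLab (k : ℕ) (u : Equiv.Perm ℕ) (i : ℕ) : ℕ :=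
  if u⁻¹ i < k then u⁻¹ i + 1 else 0

/-- Boundary label `θ_v` on the top side (0-based column `j`, 1-based pipe labels). -/
def thetaLab (k : ℕ) (v : Equiv.Perm ℕ) (j : ℕ) : ℕ :=
  if k ≤ v⁻¹ j then v⁻¹ j + 1 else 0

/-- Boundary label `η_w` on the bottom side (0-based column `j`, 1-based pipe labels). -/
def etaLab (w : Equiv.Perm ℕ) (j : ℕ) : ℕ := w⁻¹ j + 1

/-- The boundary condition for pipe puzzles for `(u, v, w)`: left edges all `0`,
right edges `κ_u`, top edges `θ_v`, bottom edges `η_w`. -/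
def BoundaryCond (n k : ℕ) (u v w : Equiv.Perm ℕ) (sst : GridState n) : Prop :=
  (∀ i : Fin n, (sst.1 i 0 : ℕ) = 0) ∧
  (∀ i : Fin n, (sst.1 i (Fin.last n) : ℕ) = kappaLab k u (i : ℕ)) ∧
  (∀ j : Fin n, (sst.2 0 j : ℕ) = thetaLab k v (j : ℕ)) ∧
  (∀ j : Fin n, (sst.2 (Fin.last n) j : ℕ) = etaLab w (j : ℕ))

/-- The admissible local configurations (tiles) of a pipe puzzle, in terms of the
four edge labels `N, E, W, S` around a tile:  the empty tile, the vertical pipe,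
the horizontal pipe, the crossing (with the horizontal pipe carrying the smaller
label), the two elbows `⌟` and `⌐` (labels `≤ k` coming from the right side,
labels `> k` from the top side), and the bumping tiles (with the stated label
restrictions). -/
def LAdm (k N E W S : ℕ) : Prop :=
  (N = 0 ∧ E = 0 ∧ W = 0 ∧ S = 0) ∨
  (E = 0 ∧ W = 0 ∧ 0 < N ∧ N = S) ∨
  (N = 0 ∧ S = 0 ∧ 0 < E ∧ E = W) ∨
  (0 < E ∧ E = W ∧ E < N ∧ N = S) ∨
  (E = 0 ∧ S = 0 ∧ 0 < N ∧ N = W ∧ N ≤ k) ∨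
  (E = 0 ∧ S = 0 ∧ N = W ∧ k < N) ∨
  (N = 0 ∧ W = 0 ∧ 0 < E ∧ E = S ∧ E ≤ k) ∨
  (N = 0 ∧ W = 0 ∧ E = S ∧ k < E) ∨
  (0 < E ∧ E = S ∧ E < N ∧ N = W ∧ N ≤ k) ∨
  (k < E ∧ E = S ∧ E < N ∧ N = W) ∨
  (0 < N ∧ N = W ∧ N ≤ k ∧ E = S ∧ k < E)

/-- The admissible local configurations of a Schubert pipe puzzle (no bumping
tiles; crossings have the horizontal pipe carrying the smaller label). -/
def LAdm0 (N E W S : ℕ) : Prop :=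
  (N = 0 ∧ E = 0 ∧ W = 0 ∧ S = 0) ∨
  (E = 0 ∧ W = 0 ∧ 0 < N ∧ N = S) ∨
  (N = 0 ∧ S = 0 ∧ 0 < E ∧ E = W) ∨
  (0 < E ∧ E = W ∧ E < N ∧ N = S) ∨
  (E = 0 ∧ S = 0 ∧ 0 < N ∧ N = W) ∨
  (N = 0 ∧ W = 0 ∧ 0 < E ∧ E = S)

/-- The vertex weight `L(x; N, E, W, S)` of the lattice model (equivalently, the
weight of the corresponding pipe-puzzle tile), with spectral parameter `x`. -/
def Lwt {K : Type*} [Field K] (β : K) (k : ℕ) (x : K) (N E W S : ℕ) : K :=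
  if N = 0 ∧ E = 0 ∧ W = 0 ∧ S = 0 then x
  else if E = 0 ∧ W = 0 ∧ 0 < N ∧ N = S then 1
  else if N = 0 ∧ S = 0 ∧ 0 < E ∧ E = W then 1
  else if 0 < E ∧ E = W ∧ E < N ∧ N = S then 1
  else if E = 0 ∧ S = 0 ∧ 0 < N ∧ N = W ∧ N ≤ k then 1 + β * x
  else if E = 0 ∧ S = 0 ∧ N = W ∧ k < N then 1
  else if N = 0 ∧ W = 0 ∧ 0 < E ∧ E = S ∧ E ≤ k then 1
  else if N = 0 ∧ W = 0 ∧ E = S ∧ k < E then 1 + β * x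
  else if 0 < E ∧ E = S ∧ E < N ∧ N = W ∧ N ≤ k then β
  else if k < E ∧ E = S ∧ E < N ∧ N = W then β
  else if 0 < N ∧ N = W ∧ N ≤ k ∧ E = S ∧ k < E then β * (1 + β * x)
  else 0

/-- The set of pipe puzzles for `(u, v, w)` (with separated-descent parameter `k`),
encoded as admissible states of the lattice model. -/
def PP (n k : ℕ) (u v w : Equiv.Perm ℕ) : Set (GridState n) :=
  {sst | BoundaryCond n k u v w sst ∧
    ∀ i j : Fin n, LAdm k (labN sst i j) (labE sst i j) (labW sst i j) (labS sst i j)}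

/-- The set of Schubert pipe puzzles for `(u, v, w)`. -/
def PP0 (n k : ℕ) (u v w : Equiv.Perm ℕ) : Set (GridState n) :=
  {sst | BoundaryCond n k u v w sst ∧
    ∀ i j : Fin n, LAdm0 (labN sst i j) (labE sst i j) (labW sst i j) (labS sst i j)}

/-- The weight `wt(π)` of a pipe puzzle: the product over all tiles, the tile in
row `i` and column `j` having spectral parameter `t_j ⊖ y_i`. -/
def stateWt {K : Type*} [Field K] (β : K) (k : ℕ) (t y : ℕ → K) {n : ℕ}
    (sst : GridState n) : K :=
  ∏ i : Fin n, ∏ j : Fin n,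
    Lwt β k (ominus β (t (j : ℕ)) (y (i : ℕ)))
      (labN sst i j) (labE sst i j) (labW sst i j) (labS sst i j)

/-- The Schubert weight `wt₀(π)`: the product of `t_j - y_i` over the positions
`(i, j)` of the empty tiles. -/
def stateWt0 {K : Type*} [Field K] (t y : ℕ → K) {n : ℕ} (sst : GridState n) : K :=
  ∏ i : Fin n, ∏ j : Fin n,
    if labN sst i j = 0 ∧ labE sst i j = 0 ∧ labW sst i j = 0 ∧ labS sst i j = 0
    then t (j : ℕ) - y (i : ℕ) else 1

/-- The ordered product `f a * f (a+1) * ⋯ * f (a+n-1)`. -/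
def chain {A : Type*} [Monoid A] (f : ℕ → A) : ℕ → ℕ → A
  | _, 0 => 1
  | a, n + 1 => f a * chain f (a + 1) n

section Chain

variable {A : Type*} [Monoid A] (f g : ℕ → A)

@[simp] theorem chain_zero (a : ℕ) : chain f a 0 = 1 := rfl

theorem chain_succ (a n : ℕ) : chain f a (n + 1) = f a * chain f (a + 1) n := rfl

theorem chain_add (a m n : ℕ) : chain f a (m + n) = chain f a m * chain f (a + m) n := by
  induction m generalizing a with
  | zero => simp
  | succ m ih =>
    rw [show m + 1 + n = m + n + 1 by omega, chain_succ, chain_succ, ih, mul_assoc,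
      show a + (m + 1) = a + 1 + m by omega]

theorem chain_succ_last (a n : ℕ) : chain f a (n + 1) = chain f a n * f (a + n) := by
  rw [chain_add, chain_succ, chain_zero, mul_one]

theorem chain_commute {y : A} (a n : ℕ) (h : ∀ j, a ≤ j → j < a + n → f j * y = y * f j) :
    chain f a n * y = y * chain f a n := by
  induction n generalizing a with
  | zero => simp
  | succ n ih =>
    rw [chain_succ, mul_assoc, ih (a + 1) (fun j h1 h2 => h j (by omega) (by omega)),
      ← mul_assoc, h a le_rfl (by omega), mul_assoc]

/-- A braid-type exchange relation moves a generator through a longer chain, raising its index. -/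
theorem chain_mul_shift
    (loc : ∀ i, f i * f (i + 1) * g i = g (i + 1) * f i * f (i + 1))
    (far : ∀ i j, i + 2 ≤ j ∨ j + 2 ≤ i → f j * g i = g i * f j)
    (a n i : ℕ) (h1 : a ≤ i) (h2 : i + 1 < a + n) :
    chain f a n * g i = g (i + 1) * chain f a n := by
  obtain ⟨d, rfl⟩ := Nat.exists_eq_add_of_le h1
  obtain ⟨e, rfl⟩ : ∃ e, n = d + (2 + e) := ⟨n - d - 2, by omega⟩
  rw [chain_add f a d, chain_add f (a + d) 2 e]
  have e1 : chain f (a + d + 2) e * g (a + d) = g (a + d) * chain f (a + d + 2) e :=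
    chain_commute f _ _ fun j hj _ => far _ _ (by omega)
  have e2 : chain f a d * g (a + d + 1) = g (a + d + 1) * chain f a d :=
    chain_commute f _ _ fun j hj hj' => far _ _ (by omega)
  have e3 : chain f (a + d) 2 = f (a + d) * f (a + d + 1) := by simp [chain]
  rw [e3, mul_assoc, mul_assoc, e1, ← mul_assoc (f _ * f _), loc, ← mul_assoc (chain f a d),
    ← mul_assoc (chain f a d), ← mul_assoc (chain f a d), e2]
  simp only [mul_assoc]

theorem chain_mul_chain_shift
    (loc : ∀ i, f i * f (i + 1) * g i = g (i + 1) * f i * f (i + 1))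
    (far : ∀ i j, i + 2 ≤ j ∨ j + 2 ≤ i → f j * g i = g i * f j)
    (a n b m : ℕ) (h1 : a ≤ b) (h2 : b + m + 1 ≤ a + n) :
    chain f a n * chain g b m = chain g (b + 1) m * chain f a n := by
  induction m generalizing b with
  | zero => simp
  | succ m ih =>
    rw [chain_succ, chain_succ, ← mul_assoc, chain_mul_shift f g loc far a n b h1 (by omega),
      mul_assoc, ih (b + 1) (by omega) (by omega), mul_assoc]

end Chain

/-- The relations satisfied by the isobaric divided differences `p i` and by the
multiplication operators `X i` by `x_i ⊖ y`. -/
structure DemazureRel {K A : Type*} [CommRing K] [Ring A] [Algebra K A] (β : K)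
    (p X : ℕ → A) : Prop where
  sq : ∀ i, p i * p i = β • p i
  braid : ∀ i, p i * p (i + 1) * p i = p (i + 1) * p i * p (i + 1)
  comm : ∀ i j, i + 2 ≤ j → p i * p j = p j * p i
  pX : ∀ i, p i * X i = X (i + 1) * p i + 1 + β • X i
  pX' : ∀ i, p i * X (i + 1) = X i * p i - 1 - β • X i
  pXc : ∀ i j, j ≠ i → j ≠ i + 1 → p i * X j = X j * p i
  XX : ∀ i j, X i * X j = X j * X i

namespace DemazureRel

variable {K A : Type*} [CommRing K] [Ring A] [Algebra K A] {β : K} {p X : ℕ → A}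

/-- The operator `π_i`. -/
def opR (β : K) (p : ℕ → A) (i : ℕ) : A := p i - β • 1

/-- The operator `π_i (x_i ⊖ y)`. -/
def opQ (p X : ℕ → A) (i : ℕ) : A := 1 + X (i + 1) * p i

/-- The operator `(1 + β (x_i ⊖ y)) π_i + β`. -/
def opZ (β : K) (p X : ℕ → A) (i : ℕ) : A := (1 + β • X i) * opR β p i + β • 1

variable (H : DemazureRel β p X)
include H

theorem comm' {i j : ℕ} (h : i + 2 ≤ j ∨ j + 2 ≤ i) : p i * p j = p j * p i := by
  rcases h with h | h
  · exact H.comm i j h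
  · exact (H.comm j i h).symm

theorem p_assoc_sq (i : ℕ) (a : A) : p i * (p i * a) = β • (p i * a) := by
  rw [← mul_assoc, H.sq, smul_mul_assoc]

theorem opR_mul_p (i : ℕ) : opR β p i * p i = 0 := by
  simp [opR, sub_mul, H.sq]

theorem p_mul_opR (i : ℕ) : p i * opR β p i = 0 := by
  simp [opR, mul_sub, H.sq]

theorem opR_mul_X (i : ℕ) : opR β p i * X i = opQ p X i := by
  simp only [opR, opQ, sub_mul, H.pX, smul_mul_assoc, one_mul]
  abel

theorem p_mul_one_add (i : ℕ) : p i * (1 + β • X (i + 1)) = (1 + β • X i) * opR β p i := by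
  simp only [opR, mul_add, mul_one, mul_smul_comm, H.pX', mul_sub, add_mul, one_mul,
    smul_mul_assoc]
  module

theorem opR_mul_one_add (i : ℕ) : opR β p i * (1 + β • X i) = (1 + β • X (i + 1)) * p i := by
  simp only [opR, mul_add, mul_one, mul_smul_comm, H.pX, sub_mul, add_mul, one_mul,
    smul_mul_assoc]
  module

theorem opR_braid (i : ℕ) :
    opR β p i * opR β p (i + 1) * opR β p i
      = opR β p (i + 1) * opR β p i * opR β p (i + 1) := by
  simp only [opR, mul_sub, sub_mul, H.braid, H.sq, smul_mul_assoc, mul_smul_comm, one_mul, mul_one]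
  module

theorem opR_loc_p (i : ℕ) :
    opR β p i * opR β p (i + 1) * p i = p (i + 1) * opR β p i * opR β p (i + 1) := by
  have h := H.opR_braid i
  have e : ∀ j, p j = opR β p j + β • 1 := fun j => by simp [opR]
  rw [e i, e (i + 1)]
  simp only [mul_add, add_mul, h, smul_mul_assoc, mul_smul_comm, one_mul, mul_one]

theorem p_loc_q (i : ℕ) :
    p i * p (i + 1) * opQ p X i = opQ p X (i + 1) * p i * p (i + 1) := by
  have h1 : p i * p (i + 1) * X (i + 1) * p i
      = X (i + 2) * (p (i + 1) * p i * p (i + 1)) := by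
    have a1 : p i * X (i + 2) = X (i + 2) * p i := H.pXc _ _ (by omega) (by omega)
    rw [mul_assoc (p i) (p (i + 1)), H.pX (i + 1)]
    simp only [mul_add, add_mul, mul_smul_comm, smul_mul_assoc, mul_one, H.pX', sub_mul, one_mul,
      H.sq, mul_assoc]
    rw [← mul_assoc (p i) (X _), a1]
    have b := H.braid i
    simp only [mul_assoc] at b ⊢
    rw [b]
    module
  simp only [opQ, mul_add, add_mul, mul_one, one_mul]
  rw [← mul_assoc, h1]
  simp only [mul_assoc]

theorem opR_loc_q (i : ℕ) :
    opR β p i * opR β p (i + 1) * opQ p X i = opQ p X (i + 1) * opR β p i * opR β p (i + 1) := by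
  have hq : ∀ j, opQ p X j = opR β p j * X j := fun j => (H.opR_mul_X j).symm
  have c : opR β p (i + 1) * X i = X i * opR β p (i + 1) := by
    simp [opR, sub_mul, mul_sub, H.pXc (i + 1) i (by omega) (by omega)]
  have h2 : opR β p i * X i = X (i + 1) * opR β p i + (1 + β • X (i + 1)) := by
    simp only [opR, sub_mul, mul_sub, H.pX, smul_mul_assoc, mul_smul_comm, one_mul, mul_one]
    module
  have h3 : opR β p (i + 1) * ((1 + β • X (i + 1)) * opR β p (i + 1)) = 0 := by
    rw [← mul_assoc, H.opR_mul_one_add, mul_assoc, H.p_mul_opR, mul_zero]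
  calc opR β p i * opR β p (i + 1) * opQ p X i
      = (opR β p i * opR β p (i + 1) * opR β p i) * X i := by rw [hq, mul_assoc, mul_assoc, mul_assoc]
    _ = opR β p (i + 1) * (opR β p i * X i) * opR β p (i + 1) := by
        rw [H.opR_braid, mul_assoc, c]; simp only [mul_assoc]
    _ = opR β p (i + 1) * X (i + 1) * opR β p i * opR β p (i + 1) := by
        rw [h2, mul_add, add_mul, mul_assoc _ (1 + _), h3, add_zero]; simp only [mul_assoc]
    _ = _ := by rw [hq]

theorem opQ_far_p {i j : ℕ} (h : i + 2 ≤ j ∨ j + 2 ≤ i) :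
    p j * opQ p X i = opQ p X i * p j := by
  simp only [opQ, mul_add, add_mul, mul_one, one_mul]
  rw [← mul_assoc, H.pXc j (i + 1) (by omega) (by omega), mul_assoc, H.comm' (i := j) (by omega),
    mul_assoc]

omit H in
theorem opR_commute {a : A} {j : ℕ} (h : p j * a = a * p j) :
    opR β p j * a = a * opR β p j := by
  simp [opR, sub_mul, mul_sub, h]

theorem opR_loc_z (i : ℕ) :
    opR β p i * p (i + 1) * opZ β p X i = opZ β p X (i + 1) * opR β p i * p (i + 1) := by
  have c : p (i + 1) * (1 + β • X i) = (1 + β • X i) * p (i + 1) := by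
    simp [mul_add, add_mul, H.pXc (i + 1) i (by omega) (by omega)]
  have h1 : p i * p (i + 1) * opR β p i = opR β p (i + 1) * p i * p (i + 1) := by
    simp only [opR, mul_sub, sub_mul, H.braid, mul_smul_comm, smul_mul_assoc, mul_one, one_mul]
  have h2 : opR β p (i + 1) * p i * p (i + 1) = opR β p (i + 1) * opR β p i * p (i + 1) := by
    have e : p i = opR β p i + β • 1 := by simp [opR]
    conv_lhs => rw [e]
    simp only [mul_add, add_mul, mul_smul_comm, smul_mul_assoc, mul_one, H.opR_mul_p, smul_zero,
      add_zero]
  calc opR β p i * p (i + 1) * opZ β p X i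
      = opR β p i * (p (i + 1) * (1 + β • X i)) * opR β p i + β • (opR β p i * p (i + 1)) := by
        rw [opZ, mul_add, mul_smul_comm, mul_one]; simp only [mul_assoc]
    _ = (1 + β • X (i + 1)) * (p i * p (i + 1) * opR β p i) + β • (opR β p i * p (i + 1)) := by
        rw [c, ← mul_assoc, H.opR_mul_one_add]; simp only [mul_assoc]
    _ = _ := by
        rw [h1, h2]; simp only [opZ, add_mul, mul_assoc, smul_mul_assoc, one_mul]

end DemazureRel

section ChainCommute

variable {A : Type*} [Monoid A] {f g : ℕ → A}

theorem mul_eq_assoc {a b c d : A} (h : a * b = c * d) (x : A) :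
    a * (b * x) = c * (d * x) := by
  rw [← mul_assoc, h, mul_assoc]

theorem commute_chain_left {y : A} {a n : ℕ} (h : ∀ j, a ≤ j → j < a + n → Commute (f j) y) :
    Commute (chain f a n) y :=
  chain_commute f a n fun j h1 h2 => h j h1 h2

theorem commute_chain_right {y : A} {a n : ℕ} (h : ∀ j, a ≤ j → j < a + n → Commute y (f j)) :
    Commute y (chain f a n) :=
  (commute_chain_left fun j h1 h2 => (h j h1 h2).symm).symm

theorem commute_chain_chain {a n b m : ℕ}
    (h : ∀ i j, a ≤ i → i < a + n → b ≤ j → j < b + m → Commute (f i) (g j)) :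
    Commute (chain f a n) (chain g b m) :=
  commute_chain_left fun i h1 h2 => commute_chain_right fun j h3 h4 => h i j h1 h2 h3 h4

theorem chain_succ_mul (a n : ℕ) (x : A) :
    chain f a (n + 1) * x = f a * (chain f (a + 1) n * x) := by
  rw [chain_succ, mul_assoc]

theorem chain_add_mul (a m n : ℕ) (x : A) :
    chain f a (m + n) * x = chain f a m * (chain f (a + m) n * x) := by
  rw [chain_add, mul_assoc]

theorem chain_succ_last_mul (a n : ℕ) (x : A) :
    chain f a (n + 1) * x = chain f a n * (f (a + n) * x) := by
  rw [chain_succ_last, mul_assoc]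

end ChainCommute

namespace DemazureRel

variable {K A : Type*} [CommRing K] [Ring A] [Algebra K A] {β : K} {p X : ℕ → A}

/-- `g` is annihilated by `p j` for `lo ≤ j < hi`. -/
def Killed (p : ℕ → A) (lo hi : ℕ) (g : A) : Prop := ∀ j, lo ≤ j → j < hi → p j * g = 0

theorem Killed.mono {lo hi lo' hi' : ℕ} {g : A} (h : Killed p lo hi g) (h1 : lo ≤ lo')
    (h2 : hi' ≤ hi) : Killed p lo' hi' g :=
  fun j h3 h4 => h j (h1.trans h3) (h4.trans_le h2)

theorem Killed.mul_left {lo hi : ℕ} {g a : A} (h : Killed p lo hi g)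
    (hc : ∀ j, lo ≤ j → j < hi → Commute (p j) a) : Killed p lo hi (a * g) := fun j h1 h2 => by
  rw [(hc j h1 h2).left_comm, h j h1 h2, mul_zero]

theorem commute_opR_left {a : A} {j : ℕ} (h : Commute (p j) a) : Commute (opR β p j) a :=
  h.sub_left ((Commute.one_left a).smul_left β)

theorem commute_opR_right {a : A} {j : ℕ} (h : Commute a (p j)) : Commute a (opR β p j) :=
  (commute_opR_left h.symm).symm

theorem commute_one_add_right {a b : A} (h : Commute a b) : Commute a (1 + β • b) :=
  (Commute.one_right a).add_right (h.smul_right β)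

theorem commute_one_add_left {a b : A} (h : Commute b a) : Commute (1 + β • b) a :=
  (commute_one_add_right h.symm).symm

variable (H : DemazureRel β p X)
include H

theorem commute_p_p {i j : ℕ} (h : i + 2 ≤ j ∨ j + 2 ≤ i) : Commute (p i) (p j) := H.comm' h

theorem commute_p_X {i j : ℕ} (h : j < i ∨ i + 2 ≤ j) : Commute (p i) (X j) :=
  H.pXc i j (by omega) (by omega)

theorem commute_X_X (i j : ℕ) : Commute (X i) (X j) := H.XX i j

theorem commute_p_q {i j : ℕ} (h : i + 2 ≤ j ∨ j + 2 ≤ i) : Commute (p i) (opQ p X j) :=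
  H.opQ_far_p h.symm

theorem commute_p_z {i j : ℕ} (h : i + 2 ≤ j ∨ j + 2 ≤ i) : Commute (p i) (opZ β p X j) :=
  ((commute_one_add_right (H.commute_p_X (by omega))).mul_right
    (commute_opR_right (H.commute_p_p (by omega)))).add_right ((Commute.one_right _).smul_right β)

theorem opR_mul_X_eq (a : ℕ) :
    opR β p a * X a = X (a + 1) * opR β p a + (1 + β • X (a + 1)) := by
  simp only [opR, sub_mul, mul_sub, H.pX, smul_mul_assoc, mul_smul_comm, one_mul, mul_one]
  module

omit H in
theorem opQ_mul (a : ℕ) (x : A) : opQ p X a * x = x + X (a + 1) * (p a * x) := by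
  rw [opQ, add_mul, one_mul, mul_assoc]

omit H in
theorem opQ_mul_of_killed {a : ℕ} {g : A} (h : p a * g = 0) : opQ p X a * g = g := by
  rw [opQ, add_mul, mul_assoc, h, mul_zero, add_zero, one_mul]

omit H in
theorem chain_opQ_mul_of_killed {a n : ℕ} {g : A} (h : Killed p a (a + n) g) :
    chain (opQ p X) a n * g = g := by
  induction n generalizing a with
  | zero => simp
  | succ n ih =>
    rw [chain_succ_mul, ih (h.mono (by omega) (by omega)),
      opQ_mul_of_killed (h a le_rfl (by omega))]

/-- `π_a X_a g = g` along a chain, for `g` annihilated by the `p j`. -/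
theorem chain_R_chain_X_of_killed {a n : ℕ} {g : A} (h : Killed p a (a + n) g) :
    chain (opR β p) a n * (chain X a n * g) = g := by
  induction n generalizing a with
  | zero => simp
  | succ n ih =>
    have c : Commute (chain (opR β p) (a + 1) n) (X a) :=
      commute_chain_left fun j h1 h2 => commute_opR_left (H.commute_p_X (by omega))
    rw [chain_succ_mul, chain_succ_mul, c.left_comm, ih (h.mono (by omega) (by omega)),
      ← mul_assoc, H.opR_mul_X, opQ_mul_of_killed (h a le_rfl (by omega))]

theorem p_chain_Q {a n : ℕ} {g : A} (h : Killed p a (a + n) g) :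
    p a * (chain (opQ p X) (a + 1) n * g) = chain X (a + 2) n * (chain p a (n + 1) * g) := by
  induction n generalizing a with
  | zero => simp [chain]
  | succ n ih =>
    have c1 : Commute (p a) (chain (opQ p X) (a + 1 + 1) n) :=
      commute_chain_right fun j h1 h2 => H.commute_p_q (by omega)
    have c2 : Commute (p a) (chain X (a + 1 + 2) n) :=
      commute_chain_right fun j h1 h2 => H.commute_p_X (by omega)
    have c3 : Commute (p a) (X (a + 1 + 1)) := H.commute_p_X (by omega)
    rw [chain_succ_mul, opQ, add_mul, one_mul, mul_add, c1.left_comm, h a le_rfl (by omega),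
      mul_zero, zero_add, mul_assoc, ih (h.mono (by omega) (by omega)), c3.left_comm,
      c2.left_comm, chain_succ_mul (f := X), chain_succ_mul (f := p) a]

theorem p_chain_Q_one_add {a n : ℕ} {g : A} (h : Killed p a (a + n) g) :
    p a * (chain (opQ p X) (a + 1) n * ((1 + β • X (a + n + 1)) * g))
      = (1 + β • X a) * (chain X (a + 2) n * (chain (opR β p) a (n + 1) * g)) := by
  induction n generalizing a with
  | zero =>
    simp only [chain_zero, one_mul, chain_succ, mul_one, add_zero]
    rw [mul_eq_assoc (H.p_mul_one_add a)]
  | succ n ih =>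
    have c1 : Commute (p a) (chain (opQ p X) (a + 1 + 1) n) :=
      commute_chain_right fun j h1 h2 => H.commute_p_q (by omega)
    have c0 : Commute (p a) (1 + β • X (a + (n + 1) + 1)) :=
      commute_one_add_right (H.commute_p_X (by omega))
    have c2 : Commute (opR β p a) (chain X (a + 1 + 2) n) :=
      commute_chain_right fun j h1 h2 => commute_opR_left (H.commute_p_X (by omega))
    have c3 : Commute (p a) (X (a + 1 + 1)) := H.commute_p_X (by omega)
    have c4 : Commute (1 + β • X a) (X (a + 1 + 1)) :=
      commute_one_add_left (H.commute_X_X _ _)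
    have i1 := ih (a := a + 1) (h.mono (by omega) (by omega))
    rw [show a + 1 + n + 1 = a + (n + 1) + 1 by omega] at i1
    rw [chain_succ_mul, opQ, add_mul, one_mul, mul_add, c1.left_comm, c0.left_comm,
      h a le_rfl (by omega), mul_zero, mul_zero, zero_add, mul_assoc, i1, c3.left_comm,
      mul_eq_assoc (H.p_mul_one_add a), c2.left_comm, chain_succ_mul (f := X),
      chain_succ_mul (f := opR β p) a, c4.left_comm]

theorem chain_p_chain_X {a n : ℕ} {g : A} (h : Killed p a (a + n) g) :
    chain p a (n + 1) * (chain X a (n + 1) * g)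
      = chain X (a + 1) (n + 1) * (chain p a (n + 1) * g)
        + (1 + β • X a) * (chain (opQ p X) (a + 1) n * g) := by
  induction n generalizing a with
  | zero =>
    simp only [chain_zero, chain_succ, mul_one, one_mul]
    rw [← mul_assoc, H.pX, ← mul_assoc]
    simp only [add_mul]
    abel
  | succ n ih =>
    have c1 : Commute (chain p (a + 1) (n + 1)) (X a) :=
      commute_chain_left fun j h1 h2 => H.commute_p_X (by omega)
    have c2 : Commute (p a) (chain X (a + 1 + 1) (n + 1)) :=
      commute_chain_right fun j h1 h2 => H.commute_p_X (by omega)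
    have c3 : Commute (p a) (chain (opQ p X) (a + 1 + 1) n) :=
      commute_chain_right fun j h1 h2 => H.commute_p_q (by omega)
    have e1 : p a * X a = X (a + 1) * p a + (1 + β • X a) := by rw [H.pX]; abel
    have e2 : p a * (X a * (1 + β • X (a + 1)))
        = (X (a + 1) + β • (X a * X (a + 1))) * p a + (1 + β • X a) := by
      have : p a * (X a * X (a + 1)) = X a * X (a + 1) * p a := by
        rw [← mul_assoc, e1, add_mul, mul_assoc, H.pX', H.XX a]
        simp only [mul_sub, mul_smul_comm, mul_one, add_mul, one_mul, smul_mul_assoc, H.XX a,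
          mul_assoc]
        abel
      rw [mul_add, mul_one, mul_add, e1, mul_smul_comm, mul_smul_comm, this, add_mul,
        smul_mul_assoc]
      abel
    have e3 : p a * (X a * ((1 + β • X (a + 1)) * (chain (opQ p X) (a + 1 + 1) n * g)))
        = (1 + β • X a) * (chain (opQ p X) (a + 1 + 1) n * g) := by
      rw [← mul_assoc (X a), ← mul_assoc (p a), e2, add_mul, mul_assoc _ (p a), c3.left_comm,
        h a le_rfl (by omega), mul_zero, mul_zero, zero_add]
    rw [chain_succ_mul, chain_succ_mul (f := X) a, c1.left_comm, ih (h.mono (by omega) (by omega)),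
      mul_add, mul_add, e3, ← mul_assoc (p a) (X a), e1, add_mul, mul_assoc (X (a + 1)),
      c2.left_comm, chain_succ_mul (f := X) (a + 1) (n + 1), chain_succ_mul (f := p) a (n + 1),
      chain_succ_mul (f := opQ p X) (a + 1), opQ_mul,
      H.p_chain_Q (h.mono (by omega) (by omega)), mul_add]
    simp only [chain_succ_mul (f := X) (a + 1 + 1) n]
    abel

theorem chain_R_chain_X {a n : ℕ} {g : A} (h : Killed p a (a + n) g) :
    chain (opR β p) a (n + 1) * (chain X a (n + 1) * g)
      = chain X (a + 1) (n + 1) * (chain (opR β p) a (n + 1) * g)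
        + chain (opQ p X) (a + 1) n * ((1 + β • X (a + n + 1)) * g) := by
  induction n generalizing a with
  | zero =>
    simp only [chain_zero, chain_succ, mul_one, one_mul, add_zero]
    rw [← mul_assoc, H.opR_mul_X_eq, ← mul_assoc, add_mul]
  | succ n ih =>
    have c1 : Commute (chain (opR β p) (a + 1) (n + 1)) (X a) :=
      commute_chain_left fun j h1 h2 => commute_opR_left (H.commute_p_X (by omega))
    have c2 : Commute (opR β p a) (chain X (a + 1 + 1) (n + 1)) :=
      commute_chain_right fun j h1 h2 => commute_opR_left (H.commute_p_X (by omega))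
    have c3 : Commute (p a) (chain (opQ p X) (a + 1 + 1) n) :=
      commute_chain_right fun j h1 h2 => H.commute_p_q (by omega)
    have c0 : Commute (p a) (1 + β • X (a + (n + 1) + 1)) :=
      commute_one_add_right (H.commute_p_X (by omega))
    have c4 : Commute (1 + β • X (a + 1)) (X (a + 1 + 1)) :=
      commute_one_add_left (H.commute_X_X _ _)
    have i1 := ih (a := a + 1) (h.mono (by omega) (by omega))
    have i2 := H.p_chain_Q_one_add (a := a + 1) (n := n) (g := g) (h.mono (by omega) (by omega))
    rw [show a + 1 + n + 1 = a + (n + 1) + 1 by omega] at i1 i2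
    have e3 : opQ p X a * (chain (opQ p X) (a + 1 + 1) n * ((1 + β • X (a + (n + 1) + 1)) * g))
        = chain (opQ p X) (a + 1 + 1) n * ((1 + β • X (a + (n + 1) + 1)) * g) := by
      apply opQ_mul_of_killed
      rw [c3.left_comm, c0.left_comm, h a le_rfl (by omega), mul_zero, mul_zero]
    rw [chain_succ_mul, chain_succ_mul (f := X) a, c1.left_comm, i1,
      mul_add, mul_add, ← mul_assoc (opR β p a) (X a), ← mul_assoc (opR β p a) (X a),
      H.opR_mul_X, e3, ← H.opR_mul_X, H.opR_mul_X_eq, add_mul, mul_assoc (X (a + 1)),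
      c2.left_comm, chain_succ_mul (f := X) (a + 1) (n + 1),
      chain_succ_mul (f := opR β p) a (n + 1),
      chain_succ_mul (f := opQ p X) (a + 1), opQ_mul,
      i2]
    simp only [chain_succ_mul (f := X) (a + 1 + 1) n]
    rw [c4.left_comm]
    abel

theorem chain_Q_X {a n : ℕ} {g : A} (h : Killed p a (a + n) g) :
    chain (opQ p X) a n * (X (a + n) * g) = (-β) ^ n • (chain X a (n + 1) * g) := by
  induction n generalizing a with
  | zero => simp [chain]
  | succ n ih =>
    have i1 := ih (a := a + 1) (h.mono (by omega) (by omega))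
    rw [show a + 1 + n = a + (n + 1) by omega] at i1
    have c2 : Commute (p a) (chain X (a + 1 + 1) n) :=
      commute_chain_right fun j h1 h2 => H.commute_p_X (by omega)
    have e1 : p a * (chain X (a + 1) (n + 1) * g)
        = -((1 + β • X a) * (chain X (a + 1 + 1) n * g)) := by
      rw [chain_succ_mul, ← mul_assoc, H.pX', sub_mul, sub_mul, mul_assoc, c2.left_comm,
        h a le_rfl (by omega), mul_zero, mul_zero, add_mul]
      abel
    rw [chain_succ_mul, i1, mul_smul_comm, opQ, add_mul, one_mul, mul_assoc, e1,
      chain_succ_mul (f := X) a, chain_succ_mul (f := X) (a + 1), mul_neg, add_mul, one_mul,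
      mul_add, smul_mul_assoc, mul_smul_comm, (H.commute_X_X (a + 1) a).left_comm, pow_succ]
    module

omit H in
theorem chain_opR_of_killed {a n : ℕ} {g : A} (h : Killed p a (a + n) g) :
    chain (opR β p) a n * g = (-β) ^ n • g := by
  induction n generalizing a with
  | zero => simp
  | succ n ih =>
    rw [chain_succ_mul, ih (h.mono (by omega) (by omega)), mul_smul_comm, opR, sub_mul,
      h a le_rfl (by omega), smul_mul_assoc, one_mul, pow_succ]
    module

theorem chain_p_absorb {a m m' : ℕ} (h : m ≤ m') (g : A) :
    chain p a (m + 1) * (chain p a (m' + 1) * g)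
      = β • (chain p (a + 1) m * (chain p a (m' + 1) * g)) := by
  have loc : ∀ i, p i * p (i + 1) * p i = p (i + 1) * p i * p (i + 1) := H.braid
  have sh : chain p a (m' + 1) * chain p a m = chain p (a + 1) m * chain p a (m' + 1) :=
    chain_mul_chain_shift p p loc (fun _ _ h => H.comm' h.symm) a (m' + 1) a m le_rfl (by omega)
  rw [chain_succ_mul (f := p) a m, ← mul_eq_assoc sh, chain_succ_mul, H.p_assoc_sq]

omit H in
theorem opR_chain_p_shift (H : DemazureRel β p X) {a m m' : ℕ} (h : m ≤ m') (g : A) :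
    opR β p a * (chain p (a + 1) m * (chain p a (m' + 1) * g)) = 0 := by
  have sh : chain p a (m' + 1) * chain p a m = chain p (a + 1) m * chain p a (m' + 1) :=
    chain_mul_chain_shift p p H.braid (fun _ _ h => H.comm' h.symm) a (m' + 1) a m le_rfl
      (by omega)
  rw [← mul_eq_assoc sh, chain_succ_mul, ← mul_assoc, H.opR_mul_p, zero_mul]

theorem chain_p_shift_p {a n b m : ℕ} (h1 : a ≤ b) (h2 : b + m + 1 ≤ a + n) :
    chain p a n * chain p b m = chain p (b + 1) m * chain p a n :=
  chain_mul_chain_shift p p H.braid (fun _ _ h => H.comm' h.symm) a n b m h1 h2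

theorem chain_p_shift_q {a n b m : ℕ} (h1 : a ≤ b) (h2 : b + m + 1 ≤ a + n) :
    chain p a n * chain (opQ p X) b m = chain (opQ p X) (b + 1) m * chain p a n :=
  chain_mul_chain_shift p _ H.p_loc_q (fun _ _ h => H.opQ_far_p h) a n b m h1 h2

theorem chain_R_shift_q {a n b m : ℕ} (h1 : a ≤ b) (h2 : b + m + 1 ≤ a + n) :
    chain (opR β p) a n * chain (opQ p X) b m
      = chain (opQ p X) (b + 1) m * chain (opR β p) a n :=
  chain_mul_chain_shift _ _ H.opR_loc_q (fun _ _ h => opR_commute (H.opQ_far_p h)) a n b m h1 h2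

theorem chain_p_one_add (a n : ℕ) :
    chain p a n * (1 + β • X (a + n)) = (1 + β • X a) * chain (opR β p) a n := by
  induction n generalizing a with
  | zero => simp
  | succ n ih =>
    rw [chain_succ, mul_assoc, show a + (n + 1) = a + 1 + n by omega, ih, ← mul_assoc,
      H.p_mul_one_add, mul_assoc, chain_succ]

theorem chain_p_one_add_mid (n m : ℕ) (g : A) :
    chain p 0 (n + 1 + m) * ((1 + β • X n) * g)
      = (1 + β • X (n + 1)) * (chain p 0 (n + 1 + m) * g)
        + β • ((1 + β • X 0) * (chain (opR β p) 0 n * (chain p (n + 1) m * g))) := by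
  have c1 : Commute (chain p (0 + (n + 1)) m) (1 + β • X n) :=
    commute_chain_left fun j h1 h2 => commute_one_add_right (H.commute_p_X (by omega))
  have c2 : Commute (chain p 0 n) (1 + β • X (n + 1)) :=
    commute_chain_left fun j h1 h2 => commute_one_add_right (H.commute_p_X (by omega))
  have e1 : p n * (1 + β • X n) = (1 + β • X (n + 1)) * p n + β • (1 + β • X n) := by
    simp only [mul_add, mul_one, mul_smul_comm, H.pX, add_mul, one_mul, smul_mul_assoc]
    module
  have e2 := H.chain_p_one_add 0 n
  rw [zero_add] at e2
  rw [chain_add_mul, c1.left_comm, chain_succ_last_mul, zero_add, ← mul_assoc (p n), e1, add_mul,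
    mul_add, mul_assoc, c2.left_comm, smul_mul_assoc, mul_smul_comm, mul_eq_assoc e2,
    chain_add_mul, chain_succ_last_mul, zero_add, zero_add]

end DemazureRel

open DemazureRel

/-- `E` lowers all indices by one, and evaluates `X 0` to the scalar `s`. -/
structure ShiftRel {K A : Type*} [CommRing K] [Ring A] [Algebra K A] (p X : ℕ → A) (E : A)
    (s : K) : Prop where
  Ep : ∀ i, E * p (i + 1) = p i * E
  EX : ∀ i, E * X (i + 1) = X i * E
  EX0 : E * X 0 = s • E

theorem chain_shift {A : Type*} [Monoid A] {f : ℕ → A} {E : A}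
    (h : ∀ i, E * f (i + 1) = f i * E) (a n : ℕ) :
    E * chain f (a + 1) n = chain f a n * E := by
  induction n generalizing a with
  | zero => simp
  | succ n ih => rw [chain_succ, chain_succ, ← mul_assoc, h, mul_assoc, ih, mul_assoc]

theorem chain_zero_last_mul {A : Type*} [Monoid A] {f : ℕ → A} (n : ℕ) (x : A) :
    chain f 0 (n + 1) * x = chain f 0 n * (f n * x) := by
  rw [chain_succ_last_mul, Nat.zero_add]

theorem opZ_mul {K A : Type*} [CommRing K] [Ring A] [Algebra K A] {β : K} {p X : ℕ → A} (a : ℕ)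
    (x : A) : opZ β p X a * x = (1 + β • X a) * (opR β p a * x) + β • x := by
  rw [opZ, add_mul, smul_mul_assoc, one_mul, mul_assoc]

namespace ShiftRel

variable {K A : Type*} [CommRing K] [Ring A] [Algebra K A] {β s : K} {p X : ℕ → A} {E : A}

section

variable (hE : ShiftRel p X E s)
include hE

theorem Er (i : ℕ) : E * opR β p (i + 1) = opR β p i * E := by
  simp [opR, mul_sub, sub_mul, hE.Ep]

theorem E1 (i : ℕ) : E * (1 + β • X (i + 1)) = (1 + β • X i) * E := by
  simp [mul_add, add_mul, hE.EX]

theorem Eq (i : ℕ) : E * opQ p X (i + 1) = opQ p X i * E := by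
  simp only [opQ, mul_add, add_mul, mul_one, one_mul]
  rw [← mul_assoc, hE.EX, mul_assoc, hE.Ep, mul_assoc]

theorem Ez (i : ℕ) : E * opZ β p X (i + 1) = opZ β p X i * E := by
  simp only [opZ, mul_add (a := E), add_mul (c := E), mul_smul_comm, smul_mul_assoc, mul_one,
    one_mul]
  rw [← mul_assoc, hE.E1, mul_assoc, hE.Er, mul_assoc]

theorem E_chain_p (a n : ℕ) : E * chain p (a + 1) n = chain p a n * E := chain_shift hE.Ep a n

theorem E_chain_X (a n : ℕ) : E * chain X (a + 1) n = chain X a n * E := chain_shift hE.EX a n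

theorem E_chain_q (a n : ℕ) : E * chain (opQ p X) (a + 1) n = chain (opQ p X) a n * E :=
  chain_shift hE.Eq a n

theorem E_one_add (x : A) : E * ((1 + β • X 0) * x) = (1 + β * s) • (E * x) := by
  rw [← mul_assoc, mul_add, mul_one, mul_smul_comm, hE.EX0, add_mul, smul_mul_assoc,
    smul_mul_assoc]
  module

theorem E_chain_X_zero (n : ℕ) (g : A) :
    E * (chain X 0 (n + 1) * g) = s • (chain X 0 n * (E * g)) := by
  rw [chain_succ_mul, ← mul_assoc, hE.EX0, smul_mul_assoc, mul_eq_assoc (hE.E_chain_X 0 n)]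

end

variable (H : DemazureRel β p X) (hE : ShiftRel p X E s)
include H hE

theorem top_zero {n : ℕ} (m : ℕ) {g : A} (hg : Killed p 0 n g) :
    E * (chain p 0 (n + 1 + m) * (chain X 0 (n + 1) * g))
      = chain X 0 (n + 1) * (E * (chain p 0 (n + 1 + m) * g))
        + (1 + β * s) • (chain (opQ p X) 0 n * (chain p n m * (E * g))) := by
  have c1 : Commute (chain p (0 + (n + 1)) m) (chain X 0 (n + 1)) :=
    commute_chain_chain fun i j _ _ _ _ => H.commute_p_X (by omega)
  have hk : Killed p 0 (0 + n) (chain p (0 + (n + 1)) m * g) :=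
    (hg.mono le_rfl (by omega)).mul_left fun j _ _ => commute_chain_right fun i _ _ =>
      H.commute_p_p (by omega)
  rw [chain_add_mul (f := p), c1.left_comm, H.chain_p_chain_X hk, mul_add, hE.E_one_add,
    mul_eq_assoc (hE.E_chain_X 0 _), mul_eq_assoc (hE.E_chain_q 0 _), ← chain_add_mul,
    Nat.zero_add, mul_eq_assoc (hE.E_chain_p _ _)]

theorem right_zero {n : ℕ} (m : ℕ) {g : A} (hg : Killed p 0 n g) :
    E * (chain (opR β p) 0 (n + 1) * (chain p (n + 1) m * (chain X 0 (n + 1) * g)))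
      = chain X 0 (n + 1) * (E * (chain (opR β p) 0 (n + 1) * (chain p (n + 1) m * g)))
        + chain (opQ p X) 0 n * ((1 + β • X n) * (chain p n m * (E * g))) := by
  have c1 : Commute (chain p (n + 1) m) (chain X 0 (n + 1)) :=
    commute_chain_chain fun i j _ _ _ _ => H.commute_p_X (by omega)
  have hk : Killed p 0 (0 + n) (chain p (n + 1) m * g) :=
    (hg.mono le_rfl (by omega)).mul_left fun j _ _ => commute_chain_right fun i _ _ =>
      H.commute_p_p (by omega)
  rw [c1.left_comm, H.chain_R_chain_X hk, mul_add,
    mul_eq_assoc (hE.E_chain_X 0 _), mul_eq_assoc (hE.E_chain_q 0 _), Nat.zero_add,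
    mul_eq_assoc (hE.E1 _), mul_eq_assoc (hE.E_chain_p _ _)]

theorem right_zero_enter {n : ℕ} (m : ℕ) {g : A} (hg : Killed p 0 (n + 1) g) :
    E * (chain (opR β p) 0 (n + 1) * (chain p (n + 1) (m + 1) * (chain X 0 (n + 1) * g)))
      = chain X 0 (n + 1) * (E * (chain (opR β p) 0 (n + 2) * (chain p (n + 2) m * g)))
        + chain (opQ p X) 0 n * (opZ β p X n * (chain p (n + 1) m * (E * g))) := by
  have c1 : Commute (chain p (n + 1) (m + 1)) (chain X 0 (n + 1)) :=
    commute_chain_chain fun i j _ _ _ _ => H.commute_p_X (by omega)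
  have hk : Killed p 0 (0 + n) (chain p (n + 1) (m + 1) * g) :=
    (hg.mono le_rfl (by omega)).mul_left fun j _ _ => commute_chain_right fun i _ _ =>
      H.commute_p_p (by omega)
  have hk' : Killed p 0 (0 + (n + 1)) (chain p (n + 2) m * g) :=
    (hg.mono le_rfl (by omega)).mul_left fun j _ _ => commute_chain_right fun i _ _ =>
      H.commute_p_p (by omega)
  have e1 : p (n + 1) = opR β p (n + 1) + β • 1 := by simp [opR]
  have e2 : (1 + β • X (n + 1)) * p (n + 1) = opZ β p X (n + 1) + (β * β) • X (n + 1) := by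
    conv_lhs => rw [e1]
    simp only [opZ, mul_add, mul_smul_comm, mul_one, add_mul, one_mul, smul_mul_assoc]
    module
  have e3 := H.chain_Q_X (a := 1) (n := n) (hk'.mono (by omega) (by omega))
  rw [Nat.add_comm 1 n] at e3
  have e4 := chain_opR_of_killed (β := β) hk'
  have key : chain X 1 (n + 1) * (chain (opR β p) 0 (n + 1) * (chain p (n + 1) (m + 1) * g))
        + chain (opQ p X) 1 n * ((1 + β • X (n + 1)) * (chain p (n + 1) (m + 1) * g))
      = chain X 1 (n + 1) * (chain (opR β p) 0 (n + 2) * (chain p (n + 2) m * g))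
        + chain (opQ p X) 1 n * (opZ β p X (n + 1) * (chain p (n + 2) m * g)) := by
    rw [chain_succ_mul (f := p) (n + 1) m, ← mul_assoc (1 + _), e2, add_mul, mul_add,
      smul_mul_assoc, mul_smul_comm, e3, e1, add_mul, smul_mul_assoc, one_mul, mul_add,
      mul_smul_comm, e4, chain_zero_last_mul (n + 1), mul_add, mul_smul_comm,
      mul_smul_comm, pow_succ]
    module
  rw [c1.left_comm, H.chain_R_chain_X hk, Nat.zero_add, Nat.zero_add, key, mul_add,
    mul_eq_assoc (hE.E_chain_X 0 _), mul_eq_assoc (hE.E_chain_q 0 _),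
    mul_eq_assoc (hE.Ez _), mul_eq_assoc (hE.E_chain_p (n + 1) _)]

theorem zero_top {n : ℕ} (m : ℕ) {g : A} (hg : Killed p 0 n g) :
    E * (chain (opQ p X) 0 (n + 1) * (chain p (n + 1) m * g))
      = chain (opQ p X) 0 n * (chain p n m * (E * g))
        + chain X 0 (n + 1) * (E * (chain p 0 (n + 1 + m) * g)) := by
  have hk : Killed p 0 (0 + n) (chain p (n + 1) m * g) :=
    (hg.mono le_rfl (by omega)).mul_left fun j _ _ => commute_chain_right fun i _ _ =>
      H.commute_p_p (by omega)
  rw [chain_succ_mul (f := opQ p X), opQ_mul, H.p_chain_Q hk, mul_add,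
    mul_eq_assoc (hE.E_chain_q 0 _), mul_eq_assoc (hE.E_chain_p _ _),
    ← chain_succ_mul (f := X) (0 + 1) n, mul_eq_assoc (hE.E_chain_X 0 _),
    chain_add_mul (f := p) 0 (n + 1), Nat.zero_add]

theorem zero_right {n : ℕ} (m : ℕ) {g : A} (hg : Killed p 0 n g) :
    E * (chain (opQ p X) 0 (n + 1) * ((1 + β • X (n + 1)) * (chain p (n + 1) m * g)))
      = chain (opQ p X) 0 n * ((1 + β • X n) * (chain p n m * (E * g)))
        + (1 + β * s) •
          (chain X 0 (n + 1) * (E * (chain (opR β p) 0 (n + 1) * (chain p (n + 1) m * g)))) := by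
  have hk : Killed p 0 (0 + n) (chain p (n + 1) m * g) :=
    (hg.mono le_rfl (by omega)).mul_left fun j _ _ => commute_chain_right fun i _ _ =>
      H.commute_p_p (by omega)
  have e := H.p_chain_Q_one_add hk
  simp only [Nat.zero_add] at e
  have c : Commute (X (0 + 1)) (1 + β • X 0) := commute_one_add_right (H.commute_X_X _ _)
  rw [chain_succ_mul (f := opQ p X), opQ_mul, Nat.zero_add, e, mul_add, ← Nat.zero_add 1,
    mul_eq_assoc (hE.E_chain_q 0 _), Nat.zero_add,
    mul_eq_assoc (hE.E1 _), mul_eq_assoc (hE.E_chain_p _ _), ← Nat.zero_add 1, c.left_comm,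
    hE.E_one_add,
    ← chain_succ_mul (f := X) (0 + 1) n, mul_eq_assoc (hE.E_chain_X 0 _)]

theorem zero_right_enter {n : ℕ} (m : ℕ) {g : A} (hg : Killed p 0 (n + 1) g) :
    E * (chain (opQ p X) 0 (n + 1) * (opZ β p X (n + 1) * (chain p (n + 2) m * g)))
      = chain (opQ p X) 0 n * (opZ β p X n * (chain p (n + 1) m * (E * g)))
        + (1 + β * s) •
          (chain X 0 (n + 1) * (E * (chain (opR β p) 0 (n + 2) * (chain p (n + 2) m * g)))) := by
  have hk : Killed p 0 (n + 1) (chain p (n + 2) m * g) :=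
    (hg.mono le_rfl (by omega)).mul_left fun j _ _ => commute_chain_right fun i _ _ =>
      H.commute_p_p (by omega)
  have hk' : Killed p 0 (0 + n) (opR β p (n + 1) * (chain p (n + 2) m * g)) :=
    (hk.mono le_rfl (by omega)).mul_left fun j _ _ =>
      commute_opR_right (H.commute_p_p (by omega))
  have e := H.p_chain_Q_one_add hk'
  have e2 := H.p_chain_Q (a := 0) (n := n) (hk.mono le_rfl (by omega))
  rw [chain_succ_last_mul, hk (0 + n) (Nat.zero_le _) (by omega), mul_zero, mul_zero] at e2
  simp only [Nat.zero_add] at e e2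
  have key : p 0 * (chain (opQ p X) 1 n * (opZ β p X (n + 1) * (chain p (n + 2) m * g)))
      = (1 + β • X 0) * (chain X 2 n * (chain (opR β p) 0 (n + 2) * (chain p (n + 2) m * g))) := by
    rw [opZ_mul, mul_add, mul_add, mul_smul_comm, mul_smul_comm, e2, smul_zero, add_zero, e,
      chain_zero_last_mul (n + 1)]
  have c : Commute (X (0 + 1)) (1 + β • X 0) := commute_one_add_right (H.commute_X_X _ _)
  rw [chain_succ_mul (f := opQ p X), opQ_mul, Nat.zero_add, key, mul_add, ← Nat.zero_add 1,
    mul_eq_assoc (hE.E_chain_q 0 _), Nat.zero_add,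
    mul_eq_assoc (hE.Ez _), mul_eq_assoc (hE.E_chain_p (n + 1) _), ← Nat.zero_add 1, c.left_comm,
    hE.E_one_add, Nat.zero_add,
    ← chain_succ_mul (f := X) 1 n, mul_eq_assoc (hE.E_chain_X 0 _)]

/-- Moving `E · p[0, N)` past `chain q 0 n`. -/
theorem E_chain_p_q {n N : ℕ} (h : n + 1 ≤ N) (x : A) :
    E * (chain p 0 N * (chain (opQ p X) 0 n * x))
      = chain (opQ p X) 0 n * (E * (chain p 0 N * x)) := by
  rw [mul_eq_assoc (H.chain_p_shift_q (Nat.zero_le 0) (by omega)),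
    mul_eq_assoc (hE.E_chain_q 0 _)]

theorem E_chain_R_q {n : ℕ} (x : A) :
    E * (chain (opR β p) 0 (n + 1) * (chain (opQ p X) 0 n * x))
      = chain (opQ p X) 0 n * (E * (chain (opR β p) 0 (n + 1) * x)) := by
  rw [mul_eq_assoc (H.chain_R_shift_q (Nat.zero_le 0) (by omega)),
    mul_eq_assoc (hE.E_chain_q 0 _)]

omit hE E s in
theorem commute_chain_p_q {n N m : ℕ} (h : n + 1 ≤ N) :
    Commute (chain p N m) (chain (opQ p X) 0 n) :=
  commute_chain_chain fun i j _ _ _ _ => H.commute_p_q (by omega)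

theorem top_top_lt {n e r : ℕ} (h : e < r) (g : A) :
    E * (chain p 0 (n + 1 + e) * (chain (opQ p X) 0 n * (chain p n r * g)))
      = β • (chain (opQ p X) 0 n * (chain p n e * (E * (chain p 0 (n + r) * g)))) := by
  obtain ⟨r, rfl⟩ : ∃ r', r = r' + 1 := ⟨r - 1, by omega⟩
  have c : Commute (chain p 0 n) (chain p (n + 1) e) :=
    commute_chain_chain fun i j _ _ _ _ => H.commute_p_p (by omega)
  rw [hE.E_chain_p_q H (by omega), show n + 1 + e = n + (e + 1) by omega, chain_add_mul 0 n (e + 1),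
    Nat.zero_add, H.chain_p_absorb (by omega), mul_smul_comm, mul_smul_comm, mul_smul_comm,
    c.left_comm, mul_eq_assoc (hE.E_chain_p _ _), chain_add_mul 0 n (r + 1), Nat.zero_add]

theorem top_top_gt {n e r : ℕ} (h : r ≤ e) (g : A) :
    E * (chain p 0 (n + 1 + e) * (chain (opQ p X) 0 n * (chain p n r * g)))
      = chain (opQ p X) 0 n * (chain p n r * (E * (chain p 0 (n + 1 + e) * g))) := by
  rw [hE.E_chain_p_q H (by omega), mul_eq_assoc (H.chain_p_shift_p (Nat.zero_le n) (by omega)),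
    mul_eq_assoc (hE.E_chain_p _ _)]

theorem right_right {n e : ℕ} (x : A) :
    E * (chain (opR β p) 0 (n + 1) * (chain p (n + 1) e *
        (chain (opQ p X) 0 n * ((1 + β • X n) * x))))
      = chain (opQ p X) 0 n * ((1 + β • X n) *
          (E * (chain (opR β p) 0 n * (chain p n (e + 1) * x)))) := by
  have c1 : Commute (chain p (n + 1) e) (1 + β • X n) :=
    commute_chain_left fun i _ _ => commute_one_add_right (H.commute_p_X (by omega))
  have c2 : Commute (chain (opR β p) 0 n) (1 + β • X (n + 1)) :=
    commute_chain_left fun i _ _ => commute_one_add_right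
      (commute_opR_left (H.commute_p_X (by omega)))
  rw [(commute_chain_p_q H le_rfl).left_comm, hE.E_chain_R_q H, c1.left_comm,
    chain_zero_last_mul n, mul_eq_assoc (H.opR_mul_one_add n), c2.left_comm,
    mul_eq_assoc (hE.E1 _), ← chain_succ_mul]

theorem right_right_lt {n e r : ℕ} (h : e < r) (g : A) :
    E * (chain (opR β p) 0 (n + 1) * (chain p (n + 1) e *
        (chain (opQ p X) 0 n * ((1 + β • X n) * (chain p n r * g)))))
      = β • (chain (opQ p X) 0 n * ((1 + β • X n) * (chain p n e *
          (E * (chain (opR β p) 0 n * (chain p n r * g)))))) := by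
  obtain ⟨r, rfl⟩ : ∃ r', r = r' + 1 := ⟨r - 1, by omega⟩
  have c : Commute (chain (opR β p) 0 n) (chain p (n + 1) e) :=
    commute_chain_chain fun i j _ _ _ _ => commute_opR_left (H.commute_p_p (by omega))
  rw [hE.right_right H, H.chain_p_absorb (by omega), mul_smul_comm, mul_smul_comm, mul_smul_comm,
    mul_smul_comm, c.left_comm, mul_eq_assoc (hE.E_chain_p _ _)]

theorem right_right_gt {n e r : ℕ} (h : r ≤ e) (g : A) :
    E * (chain (opR β p) 0 (n + 1) * (chain p (n + 1) e *
        (chain (opQ p X) 0 n * ((1 + β • X n) * (chain p n r * g)))))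
      = chain (opQ p X) 0 n * ((1 + β • X n) * (chain p n r *
          (E * (chain (opR β p) 0 n * (chain p n (e + 1) * g))))) := by
  have c : Commute (chain (opR β p) 0 n) (chain p (n + 1) r) :=
    commute_chain_chain fun i j _ _ _ _ => commute_opR_left (H.commute_p_p (by omega))
  rw [hE.right_right H, mul_eq_assoc (H.chain_p_shift_p le_rfl (by omega)), c.left_comm,
    mul_eq_assoc (hE.E_chain_p _ _)]

theorem right_right_enter {n e : ℕ} (x : A) :
    E * (chain (opR β p) 0 (n + 1) * (chain p (n + 1) (e + 1) *
        (chain (opQ p X) 0 n * (opZ β p X n * x))))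
      = chain (opQ p X) 0 n * (opZ β p X n *
          (E * (chain (opR β p) 0 (n + 1) * (chain p (n + 1) (e + 1) * x)))) := by
  have c1 : Commute (chain p (n + 1 + 1) e) (opZ β p X n) :=
    commute_chain_left fun i _ _ => H.commute_p_z (by omega)
  have c2 : Commute (chain (opR β p) 0 n) (opZ β p X (n + 1)) :=
    commute_chain_left fun i _ _ => commute_opR_left (H.commute_p_z (by omega))
  have e1 := H.opR_loc_z n
  rw [mul_assoc, mul_assoc] at e1
  have e2 : ∀ y, opR β p n * (p (n + 1) * (opZ β p X n * y))
      = opZ β p X (n + 1) * (opR β p n * (p (n + 1) * y)) := fun y => by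
    rw [← mul_assoc (p _), ← mul_assoc (opR β p n), e1]; simp only [mul_assoc]
  rw [(commute_chain_p_q H le_rfl).left_comm, hE.E_chain_R_q H, chain_succ_mul (n + 1) e,
    c1.left_comm, chain_zero_last_mul n, e2, c2.left_comm,
    mul_eq_assoc (hE.Ez _), chain_succ_mul (n + 1) e, chain_zero_last_mul n]

theorem right_right_enter_lt {n e r : ℕ} (h : e < r) (g : A) :
    E * (chain (opR β p) 0 (n + 1) * (chain p (n + 1) (e + 1) *
        (chain (opQ p X) 0 n * (opZ β p X n * (chain p (n + 1) r * g)))))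
      = β • (chain (opQ p X) 0 n * (opZ β p X n * (chain p (n + 1) e *
          (E * (chain (opR β p) 0 (n + 1) * (chain p (n + 1) r * g)))))) := by
  obtain ⟨r, rfl⟩ : ∃ r', r = r' + 1 := ⟨r - 1, by omega⟩
  have c : Commute (chain (opR β p) 0 (n + 1)) (chain p (n + 1 + 1) e) :=
    commute_chain_chain fun i j _ _ _ _ => commute_opR_left (H.commute_p_p (by omega))
  rw [hE.right_right_enter H, H.chain_p_absorb (by omega), mul_smul_comm, mul_smul_comm,
    mul_smul_comm, mul_smul_comm, c.left_comm, mul_eq_assoc (hE.E_chain_p _ _)]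

theorem right_right_enter_gt {n e r : ℕ} (h : r ≤ e) (g : A) :
    E * (chain (opR β p) 0 (n + 1) * (chain p (n + 1) (e + 1) *
        (chain (opQ p X) 0 n * (opZ β p X n * (chain p (n + 1) r * g)))))
      = chain (opQ p X) 0 n * (opZ β p X n * (chain p (n + 1) r *
          (E * (chain (opR β p) 0 (n + 1) * (chain p (n + 1) (e + 1) * g))))) := by
  have c : Commute (chain (opR β p) 0 (n + 1)) (chain p (n + 1 + 1) r) :=
    commute_chain_chain fun i j _ _ _ _ => commute_opR_left (H.commute_p_p (by omega))
  rw [hE.right_right_enter H, mul_eq_assoc (H.chain_p_shift_p le_rfl (by omega)), c.left_comm,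
    mul_eq_assoc (hE.E_chain_p _ _)]

theorem top_right {n e r : ℕ} (h : r ≤ e) (g : A) :
    E * (chain p 0 (n + 1 + e) * (chain (opQ p X) 0 n * ((1 + β • X n) * (chain p n r * g))))
      = chain (opQ p X) 0 n * ((1 + β • X n) * (chain p n r *
          (E * (chain p 0 (n + 1 + e) * g))))
        + (β * (1 + β * s)) • (chain (opQ p X) 0 n * (chain p n e *
          (E * (chain (opR β p) 0 n * (chain p n r * g))))) := by
  have c : Commute (chain (opR β p) 0 n) (chain p (n + 1) e) :=
    commute_chain_chain fun i j _ _ _ _ => commute_opR_left (H.commute_p_p (by omega))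
  rw [hE.E_chain_p_q H (by omega), H.chain_p_one_add_mid, mul_add, mul_add,
    mul_eq_assoc (hE.E1 _), mul_eq_assoc (H.chain_p_shift_p (Nat.zero_le n) (by omega)),
    mul_eq_assoc (hE.E_chain_p _ _), mul_smul_comm, hE.E_one_add, c.left_comm,
    mul_eq_assoc (hE.E_chain_p _ _), smul_smul, mul_smul_comm]

theorem top_right_enter {n e r : ℕ} (h : r ≤ e) (g : A) :
    E * (chain p 0 (n + 1 + (e + 1)) *
        (chain (opQ p X) 0 n * (opZ β p X n * (chain p (n + 1) r * g))))
      = chain (opQ p X) 0 n * (opZ β p X n * (chain p (n + 1) r *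
          (E * (chain p 0 (n + 1 + (e + 1)) * g))))
        + (β * (1 + β * s)) • (chain (opQ p X) 0 n * (chain p n (e + 1) *
          (E * (chain (opR β p) 0 (n + 1) * (chain p (n + 1) r * g))))) := by
  have c : Commute (chain (opR β p) 0 n) (chain p (n + 1) (e + 1)) :=
    commute_chain_chain fun i j _ _ _ _ => commute_opR_left (H.commute_p_p (by omega))
  have sh : chain p 0 (n + 1 + (e + 1)) * opR β p n
      = opR β p (n + 1) * chain p 0 (n + 1 + (e + 1)) :=
    chain_mul_shift p (opR β p)
      (fun i => by
        simp only [opR, mul_sub, sub_mul, H.braid, mul_smul_comm, smul_mul_assoc, mul_one, one_mul])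
      (fun i j h => (commute_opR_right (H.commute_p_p (by omega))).eq) 0 _ n (by omega) (by omega)
  have key : ∀ x, chain p 0 (n + 1 + (e + 1)) * (opZ β p X n * x)
      = opZ β p X (n + 1) * (chain p 0 (n + 1 + (e + 1)) * x)
        + β • ((1 + β • X 0) * (chain p (n + 1) (e + 1) * (chain (opR β p) 0 (n + 1) * x))) := by
    intro x
    rw [opZ_mul, opZ_mul, mul_add, H.chain_p_one_add_mid, mul_eq_assoc sh, mul_smul_comm,
      c.left_comm, chain_zero_last_mul n]
    abel
  rw [hE.E_chain_p_q H (by omega), key, mul_add, mul_add,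
    mul_eq_assoc (hE.Ez _), mul_eq_assoc (H.chain_p_shift_p (Nat.zero_le (n + 1)) (by omega)),
    mul_eq_assoc (hE.E_chain_p _ _), mul_smul_comm, hE.E_one_add,
    mul_eq_assoc (hE.E_chain_p _ _), smul_smul, mul_smul_comm]

omit hE E s in
theorem right_top {n e r : ℕ} (h : e < r) (g : A) :
    chain (opR β p) 0 (n + 1) * (chain p (n + 1) e * (chain (opQ p X) 0 n * (chain p n r * g)))
      = 0 := by
  obtain ⟨r, rfl⟩ : ∃ r', r = r' + 1 := ⟨r - 1, by omega⟩
  rw [(commute_chain_p_q H le_rfl).left_comm,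
    mul_eq_assoc (H.chain_R_shift_q (Nat.zero_le 0) (by omega)), chain_zero_last_mul n, opR_chain_p_shift H (by omega), mul_zero, mul_zero]

omit hE E s in
theorem enter_right {n r : ℕ} {g : A} (hg : Killed p 0 n g) :
    chain (opR β p) 0 (n + 1) * (chain (opQ p X) 0 n * (opZ β p X n * (chain p (n + 1) r * g)))
      = β • (chain (opR β p) 0 (n + 1) * (chain p (n + 1) r * g)) := by
  have e1 : opR β p n * opZ β p X n = β • opR β p n := by
    rw [opZ, mul_add, ← mul_assoc, H.opR_mul_one_add, mul_assoc, H.p_mul_opR, mul_zero, zero_add,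
      mul_smul_comm, mul_one]
  have hk : Killed p 0 (0 + n) (chain p (n + 1) r * g) :=
    (hg.mono le_rfl (by omega)).mul_left fun j _ _ => commute_chain_right fun i _ _ =>
      H.commute_p_p (by omega)
  rw [mul_eq_assoc (H.chain_R_shift_q (Nat.zero_le 0) (by omega)), chain_zero_last_mul n, ← mul_assoc (opR β p n), e1, smul_mul_assoc, mul_smul_comm, mul_smul_comm]
  congr 1
  have e2 := mul_eq_assoc (H.chain_R_shift_q (a := 0) (n := n + 1) (b := 0) (m := n)
    (Nat.zero_le 0) (by omega)) (chain p (n + 1) r * g)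
  rw [chain_zero_last_mul, chain_zero_last_mul] at e2
  rw [← e2, chain_opQ_mul_of_killed hk, chain_zero_last_mul n]

end ShiftRel

open DemazureRel

/-- The number of elements of `R` smaller than `e`. -/
def below (R : Finset ℕ) (e : ℕ) : ℕ := (R.filter (· < e)).card

theorem below_lt {R : Finset ℕ} {e r : ℕ} (he : e ∈ R) (h : e < r) : below R e < below R r := by
  apply Finset.card_lt_card
  rw [Finset.ssubset_iff_of_subset]
  · exact ⟨e, by simp [he, h], by simp⟩
  · intro x; simp only [Finset.mem_filter]; rintro ⟨h1, h2⟩; exact ⟨h1, by omega⟩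

theorem below_mono {R : Finset ℕ} {e r : ℕ} (h : r ≤ e) : below R r ≤ below R e := by
  apply Finset.card_le_card
  intro x; simp only [Finset.mem_filter]; rintro ⟨h1, h2⟩; exact ⟨h1, by omega⟩

theorem below_insert_of_lt {R : Finset ℕ} {e r : ℕ} (hr : r ∉ R) (h : r < e) :
    below (insert r R) e = below R e + 1 := by
  rw [below, Finset.filter_insert, if_pos h, Finset.card_insert_of_notMem (by simp [hr]), below]

theorem below_insert_of_le {R : Finset ℕ} {e r : ℕ} (h : e ≤ r) :
    below (insert r R) e = below R e := by
  rw [below, Finset.filter_insert, if_neg (by omega), below]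

theorem below_erase_of_lt {R : Finset ℕ} {e r : ℕ} (he : e ∈ R) (h : e < r) :
    below (R.erase e) r + 1 = below R r := by
  conv_rhs => rw [← Finset.insert_erase he]
  rw [below_insert_of_lt (by simp) h]

theorem below_erase_of_le {R : Finset ℕ} {e r : ℕ} (h : r ≤ e) :
    below (R.erase e) r = below R r := by
  by_cases he : e ∈ R
  · conv_rhs => rw [← Finset.insert_erase he]
    rw [below_insert_of_le h]
  · rw [Finset.erase_eq_of_notMem he]

theorem below_eq_zero {R : Finset ℕ} {a : ℕ} (h : ∀ x ∈ R, a ≤ x) : below R a = 0 := by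
  rw [below, Finset.card_eq_zero, Finset.filter_eq_empty_iff]
  intro x hx
  have := h x hx
  omega

section Weights

variable {K : Type*} [Field K] (β : K) (k : ℕ) (x : K)

/-- Weight of a tile whose west label continues to the north and whose east label continues to
the south. -/
def keepWt (W S : ℕ) : K := Lwt β k x W S W S

/-- Weight of a tile whose west label continues to the east and whose north label continues to
the south. -/
def swapWt (W S : ℕ) : K := if W = S then 0 else Lwt β k x S W W S

theorem keepWt_zero_zero : keepWt β k x 0 0 = x := by simp [keepWt, Lwt]

theorem keepWt_zero_right {e : ℕ} (h0 : e ≠ 0) (h : e ≤ k) : keepWt β k x 0 e = 1 := by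
  have : 0 < e := by omega
  simp [keepWt, Lwt, h, h0, this]

theorem keepWt_zero_top {e : ℕ} (h : k < e) : keepWt β k x 0 e = 1 + β * x := by
  have : 0 < e := by omega
  have : e ≠ 0 := by omega
  simp [keepWt, Lwt, h, Nat.not_le.2 h, this]

theorem keepWt_right_zero {r : ℕ} (h0 : r ≠ 0) (h : r ≤ k) : keepWt β k x r 0 = 1 + β * x := by
  have : 0 < r := by omega
  simp [keepWt, Lwt, h, h0, this]

theorem keepWt_top_zero {r : ℕ} (h : k < r) : keepWt β k x r 0 = 1 := by
  have : 0 < r := by omega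
  have : r ≠ 0 := by omega
  simp [keepWt, Lwt, h, Nat.not_le.2 h, this]

theorem keepWt_eq_zero {r e : ℕ} (hr : r ≠ 0) (he : e ≠ 0) (h : r ≤ e) (h' : k < r ∨ e ≤ k) :
    keepWt β k x r e = 0 := by
  unfold keepWt Lwt
  repeat' rw [if_neg (by omega)]

theorem keepWt_top_right {r e : ℕ} (hr : k < r) (he : e ≠ 0) (h : e ≤ k) :
    keepWt β k x r e = 0 := by
  unfold keepWt Lwt
  repeat' rw [if_neg (by omega)]

theorem keepWt_eq_beta {r e : ℕ} (he : e ≠ 0) (h : e < r) (h' : k < e ∨ r ≤ k) :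
    keepWt β k x r e = β := by
  unfold keepWt Lwt
  iterate 8 rw [if_neg (by omega)]
  split_ifs with h1 h2 h3
  · rfl
  · rfl
  · omega
  · omega

theorem keepWt_right_top {r e : ℕ} (hr : r ≠ 0) (h : r ≤ k) (h' : k < e) :
    keepWt β k x r e = β * (1 + β * x) := by
  unfold keepWt Lwt
  iterate 10 rw [if_neg (by omega)]
  rw [if_pos (by omega)]

theorem swapWt_self (r : ℕ) : swapWt β k x r r = 0 := if_pos rfl

theorem swapWt_zero_left {e : ℕ} (h : e ≠ 0) : swapWt β k x 0 e = 1 := by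
  have : 0 < e := by omega
  simp [swapWt, Lwt, h, Ne.symm h, this]

theorem swapWt_zero_right {r : ℕ} (h : r ≠ 0) : swapWt β k x r 0 = 1 := by
  have : 0 < r := by omega
  simp [swapWt, Lwt, h, this]

theorem swapWt_of_lt {r e : ℕ} (h0 : r ≠ 0) (h : r < e) : swapWt β k x r e = 1 := by
  unfold swapWt Lwt
  rw [if_neg (by omega), if_neg (by omega), if_neg (by omega), if_neg (by omega), if_pos (by omega)]

theorem swapWt_of_gt {r e : ℕ} (h0 : e ≠ 0) (h : e < r) : swapWt β k x r e = 0 := by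
  unfold swapWt Lwt
  repeat' rw [if_neg (by omega)]

end Weights

section Operators

variable {K A : Type*} [Field K] [Ring A] [Algebra K A] (β : K) (k : ℕ) (p X : ℕ → A)

/-- The operator removing the label `e` from a window with visible labels `R` and `h` zeros. -/
def opB (E : A) (R : Finset ℕ) (h e : ℕ) : A :=
  if e = 0 then E
  else if e ≤ k then E * (chain (opR β p) 0 h * chain p h (below R e))
  else E * chain p 0 (h + below R e)

/-- The operator of a row without a pipe entering from the right, with west label `W`. -/
def opM (R : Finset ℕ) (h W : ℕ) : A :=
  if W = 0 then chain X 0 h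
  else match h with
    | 0 => 0
    | n + 1 =>
      if W ≤ k then chain (opQ p X) 0 n * ((1 + β • X n) * chain p n (below R W))
      else chain (opQ p X) 0 n * chain p n (below R W)

/-- The operator of a row with the pipe `a` entering from the right, with west label `W`. -/
def opN (a : ℕ) (R : Finset ℕ) (h W : ℕ) : A :=
  if W = 0 then chain X 0 h
  else if W = a then 1
  else match h with
    | 0 => if W ≤ k then β • chain p 0 (below R W - 1) else 0
    | n + 1 =>
      if W ≤ k then chain (opQ p X) 0 n * (opZ β p X n * chain p (n + 1) (below R W - 1))
      else chain (opQ p X) 0 n * chain p n (below R W)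

/-- The operator of a row with right label `κ` and west label `W`. -/
def opRow (κ : ℕ) (R : Finset ℕ) (h W : ℕ) : A :=
  if κ = 0 then opM β k p X R h W else opN β k p X κ R h W

end Operators

/-- Visible labels of the north window of a row. -/
def ctxR (κ : ℕ) (R : Finset ℕ) (W : ℕ) : Finset ℕ :=
  ((if W = 0 then R else insert W R)).erase κ

/-- Number of zeros of the north window of a row. -/
def ctxH (κ h W : ℕ) : ℕ := (if W = 0 then h + 1 else h) - (if κ = 0 then 1 else 0)

/-- The label `e` is available in the context `(R, h)`. -/
def Avail (R : Finset ℕ) (h e : ℕ) : Prop := if e = 0 then 0 < h else e ∈ R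

instance (R : Finset ℕ) (h e : ℕ) : Decidable (Avail R h e) := by unfold Avail; infer_instance

/-- Number of zeros left after removing the label `e`. -/
def hid (h e : ℕ) : ℕ := if e = 0 then h - 1 else h

/-- Compatibility of a row with right label `κ` and west label `W` with a south window. -/
structure RowOK (k κ : ℕ) (R : Finset ℕ) (W : ℕ) : Prop where
  zero : 0 ∉ R
  west : W ∉ R
  le : κ ≤ k
  mem : κ ≠ 0 → W ≠ κ → κ ∈ R
  small : κ ≠ 0 → ∀ x ∈ R, κ ≤ x
  small' : κ ≠ 0 → W ≠ 0 → κ ≤ W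

open DemazureRel

section OperatorValues

variable {K A : Type*} [Field K] [Ring A] [Algebra K A] {β : K} {k : ℕ} {p X : ℕ → A} {E : A}
  {R : Finset ℕ} {h e a : ℕ}

theorem opB_zero : opB β k p E R h 0 = E := if_pos rfl

theorem opB_right (h0 : e ≠ 0) (hk : e ≤ k) (g : A) :
    opB β k p E R h e * g = E * (chain (opR β p) 0 h * (chain p h (below R e) * g)) := by
  simp only [opB, h0, hk, if_true, if_false, mul_assoc]

theorem opB_top (hk : k < e) (g : A) :
    opB β k p E R h e * g = E * (chain p 0 (h + below R e) * g) := by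
  have h0 : e ≠ 0 := by omega
  simp only [opB, h0, Nat.not_le.2 hk, if_false, mul_assoc]

theorem opM_zero : opM β k p X R h 0 = chain X 0 h := if_pos rfl

theorem opM_zeros (h0 : e ≠ 0) : opM β k p X R 0 e = 0 := by simp [opM, h0]

theorem opM_right (h0 : e ≠ 0) (hk : e ≤ k) (g : A) :
    opM β k p X R (h + 1) e * g
      = chain (opQ p X) 0 h * ((1 + β • X h) * (chain p h (below R e) * g)) := by
  simp only [opM, h0, hk, if_true, if_false, mul_assoc]

theorem opM_top (hk : k < e) (g : A) :
    opM β k p X R (h + 1) e * g = chain (opQ p X) 0 h * (chain p h (below R e) * g) := by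
  have h0 : e ≠ 0 := by omega
  simp only [opM, h0, Nat.not_le.2 hk, if_false, mul_assoc]

theorem opN_zero : opN β k p X a R h 0 = chain X 0 h := if_pos rfl

theorem opN_self (h0 : a ≠ 0) : opN β k p X a R h a = 1 := by simp [opN, h0]

theorem opN_zeros_right (h0 : e ≠ 0) (ha : e ≠ a) (hk : e ≤ k) (g : A) :
    opN β k p X a R 0 e * g = β • (chain p 0 (below R e - 1) * g) := by
  simp [opN, h0, ha, hk]

theorem opN_zeros_top (ha : e ≠ a) (hk : k < e) : opN β k p X a R 0 e = 0 := by
  have h0 : e ≠ 0 := by omega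
  simp [opN, h0, ha, hk]

theorem opN_right (h0 : e ≠ 0) (ha : e ≠ a) (hk : e ≤ k) (g : A) :
    opN β k p X a R (h + 1) e * g
      = chain (opQ p X) 0 h * (opZ β p X h * (chain p (h + 1) (below R e - 1) * g)) := by
  simp only [opN, h0, ha, hk, if_true, if_false, mul_assoc]

theorem opN_top (ha : e ≠ a) (hk : k < e) (g : A) :
    opN β k p X a R (h + 1) e * g = chain (opQ p X) 0 h * (chain p h (below R e) * g) := by
  have h0 : e ≠ 0 := by omega
  simp only [opN, h0, ha, Nat.not_le.2 hk, if_false, mul_assoc]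

end OperatorValues

section TileRelation

variable {K A : Type*} [Field K] [Ring A] [Algebra K A] {β s : K} {k : ℕ} {p X : ℕ → A} {E : A}
  {R : Finset ℕ} {h W S : ℕ} {g : A}

theorem tile_relation_zero (H : DemazureRel β p X) (hE : ShiftRel p X E s)
    (hS : Avail R h S) (hg : Killed p 0 (h - 1) g) :
    opB β k p E R h S * (opM β k p X R h 0 * g)
      = swapWt β k s 0 S • (opM β k p X (R.erase S) (hid h S) 0 * (opB β k p E R h S * g))
        + (if 0 < h then keepWt β k s 0 S •
            (opM β k p X (R.erase S) (hid h S) S * (opB β k p E R h 0 * g)) else 0) := by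
  rcases Nat.eq_zero_or_pos S with rfl | hS0
  · obtain ⟨n, rfl⟩ : ∃ n, h = n + 1 := ⟨h - 1, by simp [Avail] at hS; omega⟩
    simp only [opM_zero, opB_zero, swapWt_self, zero_smul, zero_add, hid, if_true,
      Nat.add_sub_cancel, keepWt_zero_zero, Nat.succ_pos]
    exact hE.E_chain_X_zero n g
  · have hS0' : S ≠ 0 := by omega
    rw [swapWt_zero_left _ _ _ hS0', one_smul]
    rcases h with _ | n
    · simp [opM_zero, hid, hS0', chain]
    · simp only [opM_zero, hid, hS0', if_false, opB_zero, Nat.succ_pos, if_true]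
      by_cases hk : S ≤ k
      · rw [keepWt_zero_right _ _ _ hS0' hk, one_smul]
        simp only [opB_right hS0' hk, opM_right hS0' hk, below_erase_of_le le_rfl]
        exact hE.right_zero H _ hg
      · rw [Nat.not_le] at hk
        rw [keepWt_zero_top _ _ _ hk]
        simp only [opB_top hk, opM_top hk, below_erase_of_le le_rfl]
        exact hE.top_zero H _ hg

theorem tile_relation_pipe (H : DemazureRel β p X) (hE : ShiftRel p X E s) (h0 : 0 ∉ R)
    (hW0 : W ≠ 0) (hW : W ∉ R) (hS : Avail R h S) (hg : Killed p 0 (h - 1 - 1) g) :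
    opB β k p E R h S * (opM β k p X R h W * g)
      = (if Avail (insert W R) (h - 1) S then swapWt β k s W S •
          (opM β k p X (R.erase S) (hid h S) W * (opB β k p E (insert W R) (h - 1) S * g)) else 0)
        + keepWt β k s W S •
            (opM β k p X (R.erase S) (hid h S) S * (opB β k p E (insert W R) (h - 1) W * g)) := by
  have hb : below (insert W R) W = below R W := below_insert_of_le le_rfl
  rcases Nat.eq_zero_or_pos S with rfl | hS0
  · obtain ⟨n, rfl⟩ : ∃ n, h = n + 1 := ⟨h - 1, by simp [Avail] at hS; omega⟩
    simp only [opM_zero, opB_zero, hid, if_true, Nat.add_sub_cancel, Finset.erase_eq_of_notMem h0,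
      swapWt_zero_right _ _ _ hW0, one_smul, Avail]
    rcases n with _ | n
    · simp only [lt_irrefl, if_false, zero_add]
      by_cases hk : W ≤ k
      · simp only [opM_right hW0 hk, opB_right hW0 hk, keepWt_right_zero _ _ _ hW0 hk, hb,
          chain_zero, one_mul]
        exact hE.E_one_add _
      · rw [Nat.not_le] at hk
        simp only [opM_top hk, opB_top hk, keepWt_top_zero _ _ _ hk, hb,
          chain_zero, one_mul, one_smul, zero_add]
    · simp only [Nat.succ_pos, if_true]
      by_cases hk : W ≤ k
      · simp only [opM_right hW0 hk, opB_right hW0 hk, keepWt_right_zero _ _ _ hW0 hk, hb]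
        exact hE.zero_right H _ hg
      · rw [Nat.not_le] at hk
        simp only [opM_top hk, opB_top hk, keepWt_top_zero _ _ _ hk, hb, one_smul]
        exact hE.zero_top H _ hg
  · have hS0' : S ≠ 0 := by omega
    have hSR : S ∈ R := by simpa [Avail, hS0'] using hS
    have hWS : W ≠ S := fun hh => hW (hh ▸ hSR)
    have hav : Avail (insert W R) (h - 1) S := by simp [Avail, hS0', hSR]
    rw [if_pos hav]
    rcases h with _ | n
    · simp [opM_zeros hW0, opM_zeros hS0', hid, hS0']
    · simp only [hid, hS0', if_false, Nat.add_sub_cancel]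
      rcases lt_or_gt_of_ne hWS with hlt | hlt
      · have h1 : below (insert W R) S = below R S + 1 := below_insert_of_lt hW hlt
        have h2 : below (R.erase S) W = below R W := below_erase_of_le hlt.le
        have h3 : below R W ≤ below R S := below_mono hlt.le
        rw [swapWt_of_lt _ _ _ hW0 hlt, one_smul]
        by_cases hk : S ≤ k
        · have hk' : W ≤ k := by omega
          rw [keepWt_eq_zero _ _ _ hW0 hS0' hlt.le (Or.inr hk), zero_smul, add_zero]
          simp only [opB_right hS0' hk, opM_right hW0 hk', h1, h2]
          exact hE.right_right_gt H h3 g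
        · rw [Nat.not_le] at hk
          by_cases hk' : W ≤ k
          · rw [keepWt_right_top _ _ _ hW0 hk' hk]
            simp only [opB_top hk, opM_right hW0 hk', opB_right hW0 hk', opM_top hk, h1, h2, hb,
              below_erase_of_le (le_refl S)]
            rw [hE.top_right H h3 g]
            simp only [show n + (below R S + 1) = n + 1 + below R S by omega]
          · rw [Nat.not_le] at hk'
            rw [keepWt_eq_zero _ _ _ hW0 hS0' hlt.le (Or.inl hk'), zero_smul, add_zero]
            simp only [opB_top hk, opM_top hk', h1, h2]
            rw [hE.top_top_gt H h3 g]
            simp only [show n + (below R S + 1) = n + 1 + below R S by omega]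
      · have h3 : below R S < below R W := below_lt hSR hlt
        rw [swapWt_of_gt _ _ _ hS0' hlt, zero_smul, zero_add]
        by_cases hk' : W ≤ k
        · have hk : S ≤ k := by omega
          rw [keepWt_eq_beta _ _ _ hS0' hlt (Or.inr hk')]
          simp only [opB_right hS0' hk, opM_right hW0 hk', opB_right hW0 hk', opM_right hS0' hk, hb,
            below_erase_of_le (le_refl S)]
          exact hE.right_right_lt H h3 g
        · rw [Nat.not_le] at hk'
          by_cases hk : S ≤ k
          · rw [keepWt_top_right _ _ _ hk' hS0' hk, zero_smul]
            simp only [opB_right hS0' hk, opM_top hk']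
            rw [ShiftRel.right_top H h3, mul_zero]
          · rw [Nat.not_le] at hk
            rw [keepWt_eq_beta _ _ _ hS0' hlt (Or.inl hk)]
            simp only [opB_top hk, opM_top hk', opB_top hk', opM_top hk, hb,
              below_erase_of_le (le_refl S)]
            exact hE.top_top_lt H h3 g

theorem tile_relation_enter_zero {a : ℕ} (H : DemazureRel β p X) (hE : ShiftRel p X E s)
    (hak : a ≤ k) (haR : a ∈ R) (hmin : ∀ x ∈ R, a ≤ x)
    (hS : Avail R h S) (hg : Killed p 0 h g) :
    opB β k p E R h S * (opN β k p X a R h 0 * g)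
      = (if Avail (R.erase a) (h + 1) S then swapWt β k s 0 S • (opN β k p X a (R.erase S) (hid h S) 0
          * (opB β k p E (R.erase a) (h + 1) S * g)) else 0)
        + keepWt β k s 0 S •
            (opN β k p X a (R.erase S) (hid h S) S * (opB β k p E (R.erase a) (h + 1) 0 * g)) := by
  rcases Nat.eq_zero_or_pos S with rfl | hS0
  · obtain ⟨n, rfl⟩ : ∃ n, h = n + 1 := ⟨h - 1, by simp [Avail] at hS; omega⟩
    simp only [opN_zero, opB_zero, swapWt_self, zero_smul, ite_self, zero_add, hid, if_true,
      Nat.add_sub_cancel, keepWt_zero_zero]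
    exact hE.E_chain_X_zero n g
  have hS0' : S ≠ 0 := by omega
  have hSR : S ∈ R := by simpa [Avail, hS0'] using hS
  by_cases hSa : S = a
  · subst hSa
    rw [if_neg (by simp [Avail, hS0']), keepWt_zero_right _ _ _ hS0' hak, one_smul, zero_add,
      opB_right hS0' hak, below_eq_zero hmin, opN_zero, opN_self hS0', opB_zero, chain_zero, one_mul,
      one_mul, H.chain_R_chain_X_of_killed (by simpa using hg)]
  have haS : a < S := lt_of_le_of_ne (hmin S hSR) (Ne.symm hSa)
  obtain ⟨b, hb⟩ : ∃ b, below R S = b + 1 := ⟨_, (below_erase_of_lt haR haS).symm⟩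
  have hb' : below (R.erase a) S = b := by
    have := below_erase_of_lt haR haS
    omega
  rw [if_pos (by simp [Avail, hS0', hSR, hSa]), swapWt_zero_left _ _ _ hS0', one_smul]
  simp only [hid, hS0', if_false, opN_zero, opB_zero]
  by_cases hk : S ≤ k
  · rw [keepWt_zero_right _ _ _ hS0' hk, one_smul]
    rcases h with _ | n
    · simp only [opB_right hS0' hk, opN_zeros_right hS0' hSa hk, below_erase_of_le (le_refl S), hb,
        hb', chain_zero, one_mul, Nat.add_sub_cancel, chain_succ, mul_one, zero_add]
      rw [← mul_assoc (chain p 0 b), ← hE.E_chain_p]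
      simp only [opR, sub_mul, mul_sub, mul_assoc, Algebra.smul_mul_assoc, Algebra.mul_smul_comm,
        one_mul, zero_add]
      abel
    · simp only [opB_right hS0' hk, opN_right hS0' hSa hk, below_erase_of_le (le_refl S), hb,
        hb', Nat.add_sub_cancel]
      exact hE.right_zero_enter H _ hg
  · rw [Nat.not_le] at hk
    rw [keepWt_zero_top _ _ _ hk]
    rcases h with _ | n
    · simp only [opB_top hk, opN_zeros_top hSa hk, hb, hb', chain_zero, one_mul, zero_mul, smul_zero,
        add_zero, show 0 + (b + 1) = 0 + 1 + b by omega]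
    · simp only [opB_top hk, opN_top hSa hk, below_erase_of_le (le_refl S), hb, hb']
      rw [hE.top_zero H _ (hg.mono le_rfl (by omega))]
      simp only [show n + 1 + 1 + b = n + 1 + (b + 1) by omega]

theorem tile_relation_enter_pipe {a : ℕ} (H : DemazureRel β p X) (hE : ShiftRel p X E s)
    (h0 : 0 ∉ R) (hak : a ≤ k) (haR : a ∈ R) (hmin : ∀ x ∈ R, a ≤ x)
    (hW : W ∉ R) (haW : a < W) (hS : Avail R h S) (hg : Killed p 0 (h - 1) g) :
    opB β k p E R h S * (opN β k p X a R h W * g)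
      = (if Avail ((insert W R).erase a) h S then swapWt β k s W S •
          (opN β k p X a (R.erase S) (hid h S) W
            * (opB β k p E ((insert W R).erase a) h S * g)) else 0)
        + keepWt β k s W S • (opN β k p X a (R.erase S) (hid h S) S
            * (opB β k p E ((insert W R).erase a) h W * g)) := by
  have hW0 : W ≠ 0 := by omega
  have hWa : W ≠ a := by omega
  have haR' : a ∈ insert W R := by simp [haR]
  obtain ⟨r, hr⟩ : ∃ r, below R W = r + 1 := ⟨_, (below_erase_of_lt haR haW).symm⟩
  have hr' : below ((insert W R).erase a) W = r := by
    have := below_erase_of_lt haR' haW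
    rw [below_insert_of_le le_rfl] at this
    omega
  rcases Nat.eq_zero_or_pos S with rfl | hS0
  · obtain ⟨n, rfl⟩ : ∃ n, h = n + 1 := ⟨h - 1, by simp [Avail] at hS; omega⟩
    rw [if_pos (by simp [Avail])]
    simp only [opN_zero, opB_zero, hid, if_true, Nat.add_sub_cancel, Finset.erase_eq_of_notMem h0,
      swapWt_zero_right _ _ _ hW0, one_smul]
    by_cases hk : W ≤ k
    · rw [keepWt_right_zero _ _ _ hW0 hk]
      rcases n with _ | n
      · simp only [opN_zeros_right hW0 hWa hk, opN_right hW0 hWa hk, opB_right hW0 hk, hr, hr',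
          Nat.add_sub_cancel, chain_zero, one_mul, opZ_mul, mul_add, hE.E_one_add, chain_succ,
          mul_one, Algebra.mul_smul_comm]
        rw [← mul_assoc E (chain p (0 + 1) r), hE.E_chain_p, mul_assoc]
        abel
      · simp only [opN_right hW0 hWa hk, opB_right hW0 hk, hr, hr', Nat.add_sub_cancel]
        exact hE.zero_right_enter H _ hg
    · rw [Nat.not_le] at hk
      rw [keepWt_top_zero _ _ _ hk, one_smul]
      rcases n with _ | n
      · simp only [opN_zeros_top hWa hk, opN_top hWa hk, opB_top hk, hr, hr', chain_zero, one_mul,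
          zero_mul, zero_add, show 1 + r = r + 1 by omega]
      · simp only [opN_top hWa hk, opB_top hk, hr, hr']
        rw [hE.zero_top H _ (hg.mono le_rfl (by omega))]
        simp only [show n + 1 + 1 + r = n + 1 + (r + 1) by omega]
  have hS0' : S ≠ 0 := by omega
  have hSR : S ∈ R := by simpa [Avail, hS0'] using hS
  have hWS : W ≠ S := fun hh => hW (hh ▸ hSR)
  by_cases hSa : S = a
  · subst hSa
    rw [if_neg (by simp [Avail, hS0']), zero_add, opB_right hS0' hak, below_eq_zero hmin,
      opN_self hS0', one_mul, chain_zero, one_mul]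
    by_cases hk : W ≤ k
    · rw [keepWt_eq_beta _ _ _ hS0' haW (Or.inr hk), opB_right hW0 hk, hr']
      rcases h with _ | n
      · simp only [opN_zeros_right hW0 hWa hk, hr, Nat.add_sub_cancel, chain_zero, one_mul,
          Algebra.mul_smul_comm]
      · rw [opN_right hW0 hWa hk, hr, Nat.add_sub_cancel, ShiftRel.enter_right H (n := n) hg,
          Algebra.mul_smul_comm]
    · rw [Nat.not_le] at hk
      rw [keepWt_top_right _ _ _ hk hS0' hak, zero_smul]
      rcases h with _ | n
      · simp only [opN_zeros_top hWa hk, zero_mul, mul_zero]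
      · rw [opN_top hWa hk, hr]
        have := ShiftRel.right_top H (n := n) (e := 0) (Nat.succ_pos r) g
        rw [chain_zero, one_mul] at this
        rw [this, mul_zero]
  have haS : a < S := lt_of_le_of_ne (hmin S hSR) (Ne.symm hSa)
  obtain ⟨e, he⟩ : ∃ e, below R S = e + 1 := ⟨_, (below_erase_of_lt haR haS).symm⟩
  rw [if_pos (by simp [Avail, hS0', hSR, hSa])]
  simp only [hid, hS0', if_false]
  have hSS : below (R.erase S) S = e + 1 := by rw [below_erase_of_le le_rfl, he]
  rcases lt_or_gt_of_ne hWS with hlt | hlt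
  · have h1 : below ((insert W R).erase a) S = e + 1 := by
      have := below_erase_of_lt haR' haS
      rw [below_insert_of_lt hW hlt] at this
      omega
    have h2 : below (R.erase S) W = r + 1 := by rw [below_erase_of_le hlt.le, hr]
    have h3 : r ≤ e := by
      have : below R W ≤ below R S := below_mono hlt.le
      omega
    rw [swapWt_of_lt _ _ _ hW0 hlt, one_smul]
    have hshift : E * (chain p 0 (e + 1) * (chain p 0 r * g))
        = chain p 0 r * (E * (chain p 0 (e + 1) * g)) := by
      rw [mul_eq_assoc (H.chain_p_shift_p le_rfl (by omega)), ← mul_assoc, hE.E_chain_p, mul_assoc]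
    by_cases hk' : W ≤ k
    · by_cases hk : S ≤ k
      · rw [keepWt_eq_zero _ _ _ hW0 hS0' hlt.le (Or.inr hk), zero_smul, add_zero]
        rcases h with _ | n
        · simp only [opB_right hS0' hk, opN_zeros_right hW0 hWa hk', he, hr, h1, h2,
            Nat.add_sub_cancel, chain_zero, one_mul, Algebra.mul_smul_comm, hshift]
        · simp only [opB_right hS0' hk, opN_right hW0 hWa hk', he, hr, h1, h2, Nat.add_sub_cancel]
          exact hE.right_right_enter_gt H h3 g
      · rw [Nat.not_le] at hk
        rw [keepWt_right_top _ _ _ hW0 hk' hk]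
        rcases h with _ | n
        · simp only [opB_top hk, opN_zeros_right hW0 hWa hk', opN_zeros_top hSa hk, he, hr, h1, h2,
            Nat.add_sub_cancel, zero_add, Algebra.mul_smul_comm, hshift, zero_mul, smul_zero,
            add_zero]
        · simp only [opB_top hk, opN_right hW0 hWa hk', opN_top hSa hk, opB_right hW0 hk', he, hr,
            hr', hSS, h1, h2, Nat.add_sub_cancel]
          exact hE.top_right_enter H h3 g
    · rw [Nat.not_le] at hk'
      have hk : k < S := by omega
      rw [keepWt_eq_zero _ _ _ hW0 hS0' hlt.le (Or.inl hk'), zero_smul, add_zero]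
      rcases h with _ | n
      · simp only [opN_zeros_top hWa hk', zero_mul, mul_zero]
      · simp only [opB_top hk, opN_top hWa hk', he, hr, h1, h2]
        exact hE.top_top_gt H (by omega) g
  · have h3 : e < r := by
      have : below R S < below R W := below_lt hSR hlt
      omega
    rw [swapWt_of_gt _ _ _ hS0' hlt, zero_smul, zero_add]
    by_cases hk' : W ≤ k
    · have hk : S ≤ k := by omega
      rw [keepWt_eq_beta _ _ _ hS0' hlt (Or.inr hk')]
      rcases h with _ | n
      · obtain ⟨m, rfl⟩ : ∃ m, r = m + 1 := ⟨r - 1, by omega⟩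
        simp only [opB_right hS0' hk, opN_zeros_right hW0 hWa hk', opN_zeros_right hS0' hSa hk,
          opB_right hW0 hk', he, hr, hr', hSS, Nat.add_sub_cancel, chain_zero, one_mul,
          Algebra.mul_smul_comm]
        rw [H.chain_p_absorb (by omega), Algebra.mul_smul_comm, ← mul_assoc E, hE.E_chain_p,
          mul_assoc]
      · simp only [opB_right hS0' hk, opN_right hW0 hWa hk', opN_right hS0' hSa hk,
          opB_right hW0 hk', he, hr, hr', hSS, Nat.add_sub_cancel]
        exact hE.right_right_enter_lt H h3 g
    · rw [Nat.not_le] at hk'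
      by_cases hk : S ≤ k
      · rw [keepWt_top_right _ _ _ hk' hS0' hk, zero_smul]
        rcases h with _ | n
        · simp only [opN_zeros_top hWa hk', zero_mul, mul_zero]
        · simp only [opB_right hS0' hk, opN_top hWa hk']
          rw [ShiftRel.right_top H (by omega), mul_zero]
      · rw [Nat.not_le] at hk
        rw [keepWt_eq_beta _ _ _ hS0' hlt (Or.inl hk)]
        rcases h with _ | n
        · simp only [opN_zeros_top hWa hk', opN_zeros_top hSa hk, zero_mul, mul_zero, smul_zero]
        · simp only [opB_top hk, opN_top hWa hk', opB_top hk', opN_top hSa hk, he, hr, hr', hSS]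
          rw [hE.top_top_lt H (by omega)]
          simp only [show n + 1 + r = n + (r + 1) by omega]

theorem tile_relation {κ : ℕ} (H : DemazureRel β p X) (hE : ShiftRel p X E s)
    (ok : RowOK k κ R W) (hS : Avail R h S) (hg : Killed p 0 (ctxH κ h W - 1) g) :
    opB β k p E R h S * (opRow β k p X κ R h W * g)
      = (if Avail (ctxR κ R W) (ctxH κ h W) S then swapWt β k s W S •
          (opRow β k p X κ (R.erase S) (hid h S) W
            * (opB β k p E (ctxR κ R W) (ctxH κ h W) S * g)) else 0)
        + (if Avail (ctxR κ R W) (ctxH κ h W) W then keepWt β k s W S •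
          (opRow β k p X κ (R.erase S) (hid h S) S
            * (opB β k p E (ctxR κ R W) (ctxH κ h W) W * g)) else 0) := by
  by_cases hκ : κ = 0
  · subst hκ
    by_cases hW : W = 0
    · subst hW
      simp only [ctxR, ctxH, opRow, if_true, Finset.erase_eq_of_notMem ok.zero,
        Nat.add_sub_cancel] at hg ⊢
      rw [if_pos hS, tile_relation_zero H hE hS hg]
      simp [Avail]
    · have h0 : 0 ∉ insert W R := by simp [Ne.symm hW, ok.zero]
      simp only [ctxR, ctxH, opRow, if_true, hW, if_false, Finset.erase_eq_of_notMem h0] at hg ⊢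
      rw [tile_relation_pipe H hE ok.zero hW ok.west hS hg]
      simp [Avail, hW]
  · simp only [ctxR, ctxH, opRow, hκ, if_false, Nat.sub_zero] at hg ⊢
    by_cases hW : W = 0
    · subst hW
      simp only [if_true, Nat.add_sub_cancel] at hg ⊢
      rw [tile_relation_enter_zero H hE ok.le (ok.mem hκ (Ne.symm hκ)) (ok.small hκ)
        hS hg]
      simp [Avail]
    · simp only [hW, if_false] at hg ⊢
      by_cases hWκ : W = κ
      · subst hWκ
        rw [Finset.erase_insert ok.west, if_pos hS, if_neg (by simp [Avail, hW, ok.west]), add_zero,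
          opN_self hW, opN_self hW, one_mul, one_mul]
        have hS1 : swapWt β k s W S = 1 := by
          by_cases hS0 : S = 0
          · rw [hS0, swapWt_zero_right _ _ _ hW]
          · have hSR : S ∈ R := by simpa [Avail, hS0] using hS
            exact swapWt_of_lt _ _ _ hW (lt_of_le_of_ne (ok.small hκ S hSR)
              fun hh => ok.west (hh ▸ hSR))
        rw [hS1, one_smul]
      · rw [tile_relation_enter_pipe H hE ok.zero ok.le (ok.mem hκ hWκ) (ok.small hκ) ok.west
          (lt_of_le_of_ne (ok.small' hκ hW) (Ne.symm hWκ)) hS hg]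
        simp [Avail, hW, hWκ]

end TileRelation

open DemazureRel

section DividedDifference

variable {K : Type*} [Field K]

/-- Exchange of the variables `X i` and `X (i + 1)`. -/
def sAct (i : ℕ) : MvPolynomial ℕ K →ₐ[K] MvPolynomial ℕ K := rename (Equiv.swap i (i + 1))

theorem sAct_X_left (i : ℕ) : sAct i (X i : MvPolynomial ℕ K) = X (i + 1) := by
  simp [sAct]

theorem sAct_X_right (i : ℕ) : sAct i (X (i + 1) : MvPolynomial ℕ K) = X i := by
  simp [sAct]

theorem sAct_X_of_ne {i j : ℕ} (h : j ≠ i) (h' : j ≠ i + 1) :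
    sAct i (X j : MvPolynomial ℕ K) = X j := by
  simp [sAct, Equiv.swap_apply_of_ne_of_ne h h']

theorem sAct_C (i : ℕ) (c : K) : sAct i (C c : MvPolynomial ℕ K) = C c := by
  simp [sAct]

theorem sAct_sAct (i : ℕ) (f : MvPolynomial ℕ K) : sAct i (sAct i f) = f := by
  rw [sAct, rename_rename]
  have : (⇑(Equiv.swap i (i + 1)) ∘ ⇑(Equiv.swap i (i + 1))) = id := by
    funext x; simp
  rw [this, rename_id_apply]

theorem sAct_comm {i j : ℕ} (h : i + 2 ≤ j) (f : MvPolynomial ℕ K) :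
    sAct i (sAct j f) = sAct j (sAct i f) := by
  simp only [sAct, rename_rename]
  congr 2
  funext x
  simp only [Function.comp_apply, Equiv.swap_apply_def]
  grind

theorem sAct_braid (i : ℕ) (f : MvPolynomial ℕ K) :
    sAct i (sAct (i + 1) (sAct i f)) = sAct (i + 1) (sAct i (sAct (i + 1) f)) := by
  simp only [sAct, rename_rename]
  congr 2
  funext x
  simp only [Function.comp_apply, Equiv.swap_apply_def]
  grind

theorem X_sub_X_ne_zero {i j : ℕ} (h : i ≠ j) : (X i - X j : MvPolynomial ℕ K) ≠ 0 := by
  rw [sub_ne_zero]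
  exact fun hh => h (X_injective hh)

theorem exists_divDiff (i : ℕ) (f : MvPolynomial ℕ K) :
    ∃ g, (X i - X (i + 1)) * g = f - sAct i f := by
  induction f using MvPolynomial.induction_on with
  | C a => exact ⟨0, by simp⟩
  | add p q hp hq =>
    obtain ⟨a, ha⟩ := hp
    obtain ⟨b, hb⟩ := hq
    exact ⟨a + b, by rw [map_add]; linear_combination ha + hb⟩
  | mul_X p n hp =>
    obtain ⟨a, ha⟩ := hp
    rw [map_mul]
    by_cases h1 : n = i
    · subst h1
      exact ⟨a * X n + sAct n p, by rw [sAct_X_left]; linear_combination X n * ha⟩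
    · by_cases h2 : n = i + 1
      · subst h2
        exact ⟨a * X (i + 1) - sAct i p, by rw [sAct_X_right]; linear_combination X (i + 1) * ha⟩
      · exact ⟨a * X n, by rw [sAct_X_of_ne h1 h2]; linear_combination X n * ha⟩

/-- The divided difference operator. -/
def divDiff (i : ℕ) : MvPolynomial ℕ K →ₗ[K] MvPolynomial ℕ K where
  toFun f := (exists_divDiff i f).choose
  map_add' f g := by
    apply mul_left_cancel₀ (X_sub_X_ne_zero (K := K) (Nat.succ_ne_self i).symm)
    rw [mul_add, (exists_divDiff i f).choose_spec, (exists_divDiff i g).choose_spec,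
      (exists_divDiff i (f + g)).choose_spec, map_add]
    ring
  map_smul' c f := by
    apply mul_left_cancel₀ (X_sub_X_ne_zero (K := K) (Nat.succ_ne_self i).symm)
    rw [(exists_divDiff i (c • f)).choose_spec, mul_smul_comm, RingHom.id_apply,
      (exists_divDiff i f).choose_spec, map_smul, smul_sub]

theorem divDiff_spec (i : ℕ) (f : MvPolynomial ℕ K) :
    (X i - X (i + 1)) * divDiff i f = f - sAct i f := (exists_divDiff i f).choose_spec

theorem divDiff_unique {i : ℕ} {f g : MvPolynomial ℕ K}
    (h : (X i - X (i + 1)) * g = f - sAct i f) : divDiff i f = g := by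
  apply mul_left_cancel₀ (X_sub_X_ne_zero (K := K) (Nat.succ_ne_self i).symm)
  rw [divDiff_spec, h]

theorem divDiff_mul (i : ℕ) (f g : MvPolynomial ℕ K) :
    divDiff i (f * g) = divDiff i f * g + sAct i f * divDiff i g := by
  apply divDiff_unique
  rw [map_mul]
  linear_combination g * divDiff_spec i f + sAct i f * divDiff_spec i g

theorem divDiff_eq_zero_iff {i : ℕ} {f : MvPolynomial ℕ K} : divDiff i f = 0 ↔ sAct i f = f := by
  constructor
  · intro h
    have := divDiff_spec i f
    rw [h, mul_zero] at this
    exact (sub_eq_zero.1 this.symm).symm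
  · intro h
    apply divDiff_unique
    rw [h]; ring

theorem divDiff_mul_of_sAct_eq {i : ℕ} {f : MvPolynomial ℕ K} (h : sAct i f = f)
    (g : MvPolynomial ℕ K) : divDiff i (f * g) = f * divDiff i g := by
  rw [divDiff_mul, divDiff_eq_zero_iff.2 h, h, zero_mul, zero_add]

theorem sAct_divDiff (i : ℕ) (f : MvPolynomial ℕ K) : sAct i (divDiff i f) = divDiff i f := by
  apply mul_left_cancel₀ (X_sub_X_ne_zero (K := K) (Nat.succ_ne_self i).symm)
  have h := congrArg (sAct i) (divDiff_spec i f)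
  rw [map_mul, map_sub, map_sub, sAct_X_left, sAct_X_right, sAct_sAct] at h
  linear_combination -h - divDiff_spec i f

theorem divDiff_divDiff (i : ℕ) (f : MvPolynomial ℕ K) : divDiff i (divDiff i f) = 0 :=
  divDiff_eq_zero_iff.2 (sAct_divDiff i f)

theorem divDiff_comm {i j : ℕ} (h : i + 2 ≤ j) (f : MvPolynomial ℕ K) :
    divDiff i (divDiff j f) = divDiff j (divDiff i f) := by
  apply mul_left_cancel₀ (X_sub_X_ne_zero (K := K) (Nat.succ_ne_self i).symm)
  apply mul_left_cancel₀ (X_sub_X_ne_zero (K := K) (Nat.succ_ne_self j).symm)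
  have h1 := divDiff_spec i (divDiff j f)
  have h2 := divDiff_spec j (divDiff i f)
  have h3 := divDiff_spec i f
  have h4 := divDiff_spec j f
  have h5 := congrArg (sAct i) h4
  have h6 := congrArg (sAct j) h3
  rw [map_mul, map_sub, map_sub, sAct_X_of_ne (by omega) (by omega),
    sAct_X_of_ne (by omega) (by omega)] at h5 h6
  rw [sAct_comm h] at h5
  linear_combination (X j - X (j + 1)) * h1 - (X i - X (i + 1)) * h2 - h3 + h4 - h5 + h6

theorem divDiff_braid (i : ℕ) (f : MvPolynomial ℕ K) :
    divDiff i (divDiff (i + 1) (divDiff i f))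
      = divDiff (i + 1) (divDiff i (divDiff (i + 1) f)) := by
  have hab := X_sub_X_ne_zero (K := K) (i := i) (j := i + 1) (by omega)
  have hac := X_sub_X_ne_zero (K := K) (i := i) (j := i + 2) (by omega)
  have hbc := X_sub_X_ne_zero (K := K) (i := i + 1) (j := i + 2) (by omega)
  have key : ∀ j l : ℕ, (j = i ∧ l = i + 1) ∨ (j = i + 1 ∧ l = i) →
      (X i - X (i + 1)) * ((X i - X (i + 2)) * ((X (i + 1) - X (i + 2)) *
        divDiff j (divDiff l (divDiff j f))))
      = f - sAct j f - sAct l f + sAct l (sAct j f) + sAct j (sAct l f)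
        - sAct j (sAct l (sAct j f)) := by
    intro j l hjl
    have h1 := divDiff_spec j (divDiff l (divDiff j f))
    have h2 := divDiff_spec l (divDiff j f)
    have h3 := divDiff_spec j f
    have h4 := congrArg (sAct l) h3
    have h5 := congrArg (sAct j) h2
    have h6 := congrArg (sAct j) h4
    rcases hjl with ⟨rfl, rfl⟩ | ⟨rfl, rfl⟩
    · have x0 : sAct (j + 1) (X j : MvPolynomial ℕ K) = X j :=
        sAct_X_of_ne (by omega) (by omega)
      have x1 : sAct j (X (j + 1 + 1) : MvPolynomial ℕ K) = X (j + 2) :=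
        sAct_X_of_ne (by omega) (by omega)
      simp only [map_mul, map_sub, sAct_X_left, sAct_X_right, x0, x1, sAct_divDiff]
        at h4 h5 h6
      linear_combination (X j - X (j + 2)) * (X (j + 1) - X (j + 2)) * h1
        + (X j - X (j + 2)) * h2 - (X (j + 1) - X (j + 2)) * h5 + h3 - h4 + h6
    · have x0 : sAct (l + 1) (X l : MvPolynomial ℕ K) = X l :=
        sAct_X_of_ne (by omega) (by omega)
      have x1 : sAct l (X (l + 1 + 1) : MvPolynomial ℕ K) = X (l + 2) :=
        sAct_X_of_ne (by omega) (by omega)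
      simp only [map_mul, map_sub, sAct_X_left, sAct_X_right, x0, x1, sAct_divDiff]
        at h4 h5 h6
      linear_combination (X l - X (l + 2)) * (X l - X (l + 1)) * h1
        + (X l - X (l + 2)) * h2 - (X l - X (l + 1)) * h5 + h3 - h4 + h6
  apply mul_left_cancel₀ hbc
  apply mul_left_cancel₀ hac
  apply mul_left_cancel₀ hab
  rw [key i (i + 1) (Or.inl ⟨rfl, rfl⟩), key (i + 1) i (Or.inr ⟨rfl, rfl⟩), sAct_braid]
  ring

end DividedDifference

section Operators

variable {K : Type*} [Field K] (β : K)

/-- The operator `π_i + β`. -/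
def pOp (i : ℕ) : Module.End K (MvPolynomial ℕ K) :=
  (LinearMap.mulLeft K (1 + C β * X i)).comp (divDiff i)

theorem pOp_apply (i : ℕ) (f : MvPolynomial ℕ K) : pOp β i f = (1 + C β * X i) * divDiff i f := rfl

/-- Multiplication by `X i ⊖ y`. -/
def xOp (y : K) (i : ℕ) : Module.End K (MvPolynomial ℕ K) :=
  LinearMap.mulLeft K (C ((1 + β * y)⁻¹) * (X i - C y))

theorem xOp_apply (y : K) (i : ℕ) (f : MvPolynomial ℕ K) :
    xOp β y i f = C ((1 + β * y)⁻¹) * (X i - C y) * f := rfl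

/-- Evaluation of the first variable, followed by a shift of the remaining ones. -/
def eOp (t : K) : MvPolynomial ℕ K →ₐ[K] MvPolynomial ℕ K :=
  aeval (fun i => match i with | 0 => C t | j + 1 => X j)

theorem eOp_X_zero (t : K) : eOp t (X 0) = C t := by simp [eOp]

theorem eOp_X_succ (t : K) (j : ℕ) : eOp t (X (j + 1)) = X j := by simp [eOp]

theorem eOp_C (t c : K) : eOp t (C c) = C c := by simp [eOp, algebraMap_eq]

theorem eOp_sAct (t : K) (i : ℕ) (f : MvPolynomial ℕ K) :
    eOp t (sAct (i + 1) f) = sAct i (eOp t f) := by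
  have : (eOp t).comp (sAct (i + 1)) = (sAct i).comp (eOp t) := by
    apply algHom_ext
    intro j
    simp only [AlgHom.comp_apply]
    rcases j with _ | j
    · rw [sAct_X_of_ne (by omega) (by omega), eOp_X_zero, sAct_C]
    · rw [eOp_X_succ]
      by_cases h1 : j = i
      · subst h1; rw [sAct_X_left, sAct_X_left, eOp_X_succ]
      · by_cases h2 : j = i + 1
        · subst h2; rw [sAct_X_right, sAct_X_right, eOp_X_succ]
        · rw [sAct_X_of_ne (by omega) (by omega), sAct_X_of_ne h1 h2, eOp_X_succ]
  exact DFunLike.congr_fun this f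

theorem eOp_divDiff (t : K) (i : ℕ) (f : MvPolynomial ℕ K) :
    eOp t (divDiff (i + 1) f) = divDiff i (eOp t f) := by
  symm
  apply divDiff_unique
  have := congrArg (eOp t) (divDiff_spec (i + 1) f)
  rwa [map_mul, map_sub, map_sub, eOp_X_succ, eOp_X_succ, eOp_sAct] at this

theorem shiftRel (t y : K) :
    ShiftRel (pOp β) (xOp β y) (eOp t).toLinearMap (ominus β t y) where
  Ep i := by
    refine LinearMap.ext fun f => ?_
    simp only [Module.End.mul_apply, pOp_apply, AlgHom.toLinearMap_apply, map_mul, map_add, map_one,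
      eOp_C, eOp_X_succ, eOp_divDiff]
  EX i := by
    refine LinearMap.ext fun f => ?_
    simp only [Module.End.mul_apply, xOp_apply, AlgHom.toLinearMap_apply, map_mul, map_sub,
      eOp_C, eOp_X_succ]
  EX0 := by
    refine LinearMap.ext fun f => ?_
    simp only [Module.End.mul_apply, xOp_apply, AlgHom.toLinearMap_apply, map_mul, map_sub,
      eOp_C, eOp_X_zero, LinearMap.smul_apply, smul_eq_C_mul, ominus, div_eq_mul_inv]
    ring

theorem divDiff_X_left (i : ℕ) : divDiff i (X i : MvPolynomial ℕ K) = 1 :=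
  divDiff_unique (by rw [sAct_X_left, mul_one])

theorem divDiff_X_right (i : ℕ) : divDiff i (X (i + 1) : MvPolynomial ℕ K) = -1 :=
  divDiff_unique (by rw [sAct_X_right]; ring)

theorem divDiff_C (i : ℕ) (c : K) : divDiff i (C c : MvPolynomial ℕ K) = 0 :=
  divDiff_eq_zero_iff.2 (sAct_C i c)

theorem divDiff_one (i : ℕ) : divDiff i (1 : MvPolynomial ℕ K) = 0 :=
  divDiff_eq_zero_iff.2 (map_one _)

theorem demazureRel {y : K} (hy : 1 + β * y ≠ 0) : DemazureRel β (pOp β) (xOp β y) where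
  sq i := by
    refine LinearMap.ext fun f => ?_
    simp only [Module.End.mul_apply, pOp_apply, LinearMap.smul_apply, smul_eq_C_mul, divDiff_mul,
      map_add, map_one, divDiff_one, divDiff_C, divDiff_X_left, divDiff_divDiff, sAct_C]
    ring
  braid i := by
    refine LinearMap.ext fun f => ?_
    have x0 : sAct (i + 1) (X i : MvPolynomial ℕ K) = X i := sAct_X_of_ne (by omega) (by omega)
    have x1 : divDiff (i + 1) (X i : MvPolynomial ℕ K) = 0 := divDiff_eq_zero_iff.2 x0
    simp only [Module.End.mul_apply, pOp_apply, divDiff_mul,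
      map_add, map_mul, map_one, map_neg, divDiff_one, divDiff_C, divDiff_X_left, divDiff_X_right,
      divDiff_divDiff, sAct_C, sAct_X_left, sAct_X_right, x0, x1, divDiff_braid,
      map_zero]
    ring
  comm i j h := by
    refine LinearMap.ext fun f => ?_
    have x0 : sAct i (X j : MvPolynomial ℕ K) = X j := sAct_X_of_ne (by omega) (by omega)
    have x1 : sAct j (X i : MvPolynomial ℕ K) = X i := sAct_X_of_ne (by omega) (by omega)
    simp only [Module.End.mul_apply, pOp_apply]
    rw [divDiff_mul_of_sAct_eq (by simp only [map_add, map_mul, map_one, sAct_C, x0]),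
      divDiff_mul_of_sAct_eq (by simp only [map_add, map_mul, map_one, sAct_C, x1]),
      divDiff_comm h]
    ring
  pX i := by
    refine LinearMap.ext fun f => ?_
    have hc : (C ((1 + β * y)⁻¹) : MvPolynomial ℕ K) * (1 + C β * C y) = 1 := by
      rw [← C_mul, ← C_1, ← C_add, ← C_mul, inv_mul_cancel₀ hy]
    simp only [Module.End.mul_apply, pOp_apply, xOp_apply, LinearMap.add_apply,
      LinearMap.smul_apply, smul_eq_C_mul, Module.End.one_apply, divDiff_mul, map_sub, map_mul,
      divDiff_C, divDiff_X_left, sAct_C, sAct_X_left]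
    linear_combination f * hc
  pX' i := by
    refine LinearMap.ext fun f => ?_
    have hc : (C ((1 + β * y)⁻¹) : MvPolynomial ℕ K) * (1 + C β * C y) = 1 := by
      rw [← C_mul, ← C_1, ← C_add, ← C_mul, inv_mul_cancel₀ hy]
    simp only [Module.End.mul_apply, pOp_apply, xOp_apply, LinearMap.sub_apply,
      LinearMap.smul_apply, smul_eq_C_mul, Module.End.one_apply, divDiff_mul, map_sub, map_mul,
      divDiff_C, divDiff_X_right, sAct_C, sAct_X_right]
    linear_combination -f * hc
  pXc i j h h' := by
    refine LinearMap.ext fun f => ?_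
    simp only [Module.End.mul_apply, pOp_apply, xOp_apply]
    rw [divDiff_mul_of_sAct_eq (by simp only [map_sub, map_mul, sAct_C, sAct_X_of_ne h h'])]
    ring
  XX i j := by
    refine LinearMap.ext fun f => ?_
    simp only [Module.End.mul_apply, xOp_apply]
    ring

end Operators

open DemazureRel

section RowSum

variable {K : Type*} [Field K] (β : K) (k : ℕ)

/-- The partition function of a row acting on functions of label sequences: the row occupies the
columns whose south labels are at the positions `j + 1, …, j + m`, its west label is at `j`. -/
def rowOp : (ℕ → K) → ℕ → ℕ → ((ℕ → ℕ) → K) → (ℕ → ℕ) → K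
  | _, _, 0, φ, s => φ s
  | x, j, m + 1, φ, s =>
    keepWt β k (x 0) (s j) (s (j + 1)) * rowOp (fun i => x (i + 1)) (j + 1) m φ s
      + swapWt β k (x 0) (s j) (s (j + 1)) *
          rowOp (fun i => x (i + 1)) (j + 1) m φ (s ∘ Equiv.swap j (j + 1))

theorem rowOp_congr {φ ψ : (ℕ → ℕ) → K} : ∀ {m j : ℕ} {x : ℕ → K} {s : ℕ → ℕ},
    (∀ s' : ℕ → ℕ, (∀ i, i < j ∨ j + m < i → s' i = s i) → φ s' = ψ s') →
    rowOp β k x j m φ s = rowOp β k x j m ψ s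
  | 0, _, _, s, h => h s fun _ _ => rfl
  | m + 1, j, x, s, h => by
    rw [rowOp, rowOp, rowOp_congr (m := m) (s := s) (φ := φ) (ψ := ψ),
      rowOp_congr (m := m) (φ := φ) (ψ := ψ)]
    · intro s' hs'
      apply h
      intro i hi
      rw [hs' i (by omega), Function.comp_apply, Equiv.swap_apply_of_ne_of_ne (by omega) (by omega)]
    · intro s' hs'
      exact h s' fun i hi => hs' i (by omega)

theorem rowOp_zero : ∀ {m j : ℕ} {x : ℕ → K} {s : ℕ → ℕ},
    rowOp β k x j m (fun _ => 0) s = 0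
  | 0, _, _, _ => rfl
  | m + 1, j, x, s => by rw [rowOp, rowOp_zero, rowOp_zero]; ring

end RowSum

/-- The window `s` of length `m` uses exactly the visible labels `R` and `h` zeros. -/
def ValidWin : ℕ → Finset ℕ → ℕ → (ℕ → ℕ) → Prop
  | 0, R, h, _ => R = ∅ ∧ h = 0
  | m + 1, R, h, s =>
    Avail R h (s 0) ∧ ValidWin m (R.erase (s 0)) (hid h (s 0)) fun i => s (i + 1)

section Contexts

variable {k κ h W S : ℕ} {R : Finset ℕ}

theorem RowOK.swap (ok : RowOK k κ R W) (hS : Avail R h S)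
    (ha : Avail (ctxR κ R W) (ctxH κ h W) S) : RowOK k κ (R.erase S) W where
  zero h0 := ok.zero (Finset.mem_of_mem_erase h0)
  west h0 := ok.west (Finset.mem_of_mem_erase h0)
  le := ok.le
  mem h1 h2 := by
    refine Finset.mem_erase.2 ⟨?_, ok.mem h1 h2⟩
    rintro rfl
    simp [Avail, h1, ctxR] at ha
  small h1 x hx := ok.small h1 x (Finset.mem_of_mem_erase hx)
  small' := ok.small'

theorem RowOK.keep (ok : RowOK k κ R W) (hS : Avail R h S)
    (ha : Avail (ctxR κ R W) (ctxH κ h W) W) : RowOK k κ (R.erase S) S where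
  zero h0 := ok.zero (Finset.mem_of_mem_erase h0)
  west h0 := by simp at h0
  le := ok.le
  mem h1 h2 := by
    refine Finset.mem_erase.2 ⟨h2.symm, ok.mem h1 ?_⟩
    rintro rfl
    simp [Avail, h1, ctxR] at ha
  small h1 x hx := ok.small h1 x (Finset.mem_of_mem_erase hx)
  small' h1 h2 := ok.small h1 S (by simpa [Avail, h2] using hS)

theorem ctxR_swap (ok : RowOK k κ R W) (hS : Avail R h S) :
    (ctxR κ R W).erase S = ctxR κ (R.erase S) W := by
  have h0 := ok.zero
  have hw := ok.west
  ext x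
  by_cases hS0 : S = 0
  · simp only [Avail, hS0, ctxR, if_true] at hS ⊢
    split_ifs <;> simp only [Finset.mem_erase, Finset.mem_insert] <;> grind
  · simp only [Avail, hS0, ctxR, if_false] at hS ⊢
    split_ifs <;> simp only [Finset.mem_erase, Finset.mem_insert] <;> grind

theorem ctxH_swap (hS : Avail R h S) : hid (ctxH κ h W) S = ctxH κ (hid h S) W := by
  by_cases hS0 : S = 0
  · simp only [Avail, hS0, ctxH, hid, if_true] at hS ⊢
    split_ifs <;> omega
  · simp only [ctxH, hid, hS0, if_false]

theorem ctxR_keep (ok : RowOK k κ R W) (hS : Avail R h S) :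
    (ctxR κ R W).erase W = ctxR κ (R.erase S) S := by
  have h0 := ok.zero
  have hw := ok.west
  ext x
  by_cases hS0 : S = 0
  · simp only [Avail, hS0, ctxR, if_true] at hS ⊢
    split_ifs <;> simp only [Finset.mem_erase, Finset.mem_insert] <;> grind
  · simp only [Avail, hS0, ctxR, if_false] at hS ⊢
    split_ifs <;> simp only [Finset.mem_erase, Finset.mem_insert] <;> grind

theorem ctxH_keep (hS : Avail R h S) : hid (ctxH κ h W) W = ctxH κ (hid h S) S := by
  by_cases hS0 : S = 0
  · simp only [Avail, hS0, ctxH, hid, if_true] at hS ⊢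
    split_ifs <;> omega
  · simp only [ctxH, hid, hS0, if_false]
    split_ifs <;> omega

end Contexts

theorem opB_killed {K A : Type*} [Field K] [Ring A] [Algebra K A] {β s : K} {k : ℕ} {p X : ℕ → A}
    {E : A} {R : Finset ℕ} {h e : ℕ} {g : A} (H : DemazureRel β p X) (hE : ShiftRel p X E s)
    (hg : Killed p 0 (h - 1) g) : Killed p 0 (hid h e - 1) (opB β k p E R h e * g) := by
  intro i _ hi
  unfold hid at hi
  have far : ∀ i j, i + 2 ≤ j ∨ j + 2 ≤ i → p j * p i = p i * p j :=
    fun i j hij => (H.commute_p_p hij).symm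
  rcases Nat.eq_zero_or_pos e with rfl | he
  · rw [opB_zero, mul_eq_assoc (hE.Ep i).symm, hg _ (Nat.zero_le _) (by simp at hi; omega),
      mul_zero]
  have he0 : e ≠ 0 := by omega
  rw [if_neg he0] at hi
  by_cases hk : e ≤ k
  · rw [opB_right he0 hk, mul_eq_assoc (hE.Ep i).symm, mul_eq_assoc
      (chain_mul_shift (opR β p) p H.opR_loc_p
        (fun i j hij => opR_commute (far i j hij)) 0 h i (by omega) (by omega)).symm,
      mul_eq_assoc ((commute_chain_right fun j h1 h2 => H.commute_p_p (Or.inl (by omega))).eq),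
      hg i (Nat.zero_le _) hi]
    simp only [mul_zero]
  · rw [Nat.not_le] at hk
    rw [opB_top hk, mul_eq_assoc (hE.Ep i).symm, mul_eq_assoc
      (chain_mul_shift p p H.braid far 0 (h + below R e) i (by omega) (by omega)).symm,
      hg i (Nat.zero_le _) hi]
    simp only [mul_zero]

section Functional

variable {K : Type*} [Field K] (β : K) (k : ℕ)

/-- The functional attached to a window `s` of `m` labels, in the context `(R, h)`. -/
def Phi : ℕ → (ℕ → K) → Finset ℕ → ℕ → (ℕ → ℕ) → MvPolynomial ℕ K →ₗ[K] K
  | 0, t, _, _, _ => (aeval t).toLinearMap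
  | m + 1, t, R, h, s =>
    if Avail R h (s 0) then
      (Phi m (fun i => t (i + 1)) (R.erase (s 0)) (hid h (s 0)) fun i => s (i + 1)).comp
        (opB β k (pOp β) (eOp (t 0)).toLinearMap R h (s 0))
    else 0

/-- The operator `g` with `g 1 = f` factoring through the evaluation at the origin. -/
def rankOne (f : MvPolynomial ℕ K) : Module.End K (MvPolynomial ℕ K) :=
  (LinearMap.toSpanSingleton K _ f).comp (aeval fun _ => (0 : K)).toLinearMap

theorem rankOne_one (f : MvPolynomial ℕ K) : rankOne f 1 = f := by simp [rankOne]

theorem mul_rankOne (a : Module.End K (MvPolynomial ℕ K)) (f : MvPolynomial ℕ K) :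
    a * rankOne f = rankOne (a f) := by
  refine LinearMap.ext fun x => ?_
  simp [rankOne]

theorem rankOne_zero : rankOne (0 : MvPolynomial ℕ K) = 0 := by
  refine LinearMap.ext fun x => ?_
  simp [rankOne]

theorem killed_rankOne {n : ℕ} {f : MvPolynomial ℕ K} :
    Killed (pOp β) 0 n (rankOne f) ↔ ∀ i < n, pOp β i f = 0 := by
  constructor
  · intro h i hi
    have := h i (Nat.zero_le _) hi
    rw [← rankOne_one (pOp β i f), ← mul_rankOne, this, LinearMap.zero_apply]
  · intro h i _ hi
    rw [mul_rankOne, h i hi, rankOne_zero]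

theorem Phi_succ_of_avail {m : ℕ} {t : ℕ → K} {R : Finset ℕ} {h : ℕ} {s : ℕ → ℕ}
    (ha : Avail R h (s 0)) (f : MvPolynomial ℕ K) :
    Phi β k (m + 1) t R h s f
      = Phi β k m (fun i => t (i + 1)) (R.erase (s 0)) (hid h (s 0)) (fun i => s (i + 1))
        (opB β k (pOp β) (eOp (t 0)).toLinearMap R h (s 0) f) := by
  rw [Phi, if_pos ha, LinearMap.comp_apply]

theorem Phi_succ_of_not_avail {m : ℕ} {t : ℕ → K} {R : Finset ℕ} {h : ℕ} {s : ℕ → ℕ}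
    (ha : ¬ Avail R h (s 0)) (f : MvPolynomial ℕ K) :
    Phi β k (m + 1) t R h s f = 0 := by
  rw [Phi, if_neg ha, LinearMap.zero_apply]

variable {β k}

theorem row_lemma {y : K} (hy : 1 + β * y ≠ 0) {κ : ℕ} :
    ∀ (m j : ℕ) (t : ℕ → K) (R : Finset ℕ) (h : ℕ) (s : ℕ → ℕ) (f : MvPolynomial ℕ K),
    RowOK k κ R (s j) → ValidWin m R h (fun i => s (j + 1 + i)) →
    (∀ i < ctxH κ h (s j) - 1, pOp β i f = 0) →
    Phi β k m t R h (fun i => s (j + 1 + i)) (opRow β k (pOp β) (xOp β y) κ R h (s j) f)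
      = rowOp β k (fun i => ominus β (t i) y) j m
          (fun s' => if s' (j + m) = κ then
            Phi β k m t (ctxR κ R (s j)) (ctxH κ h (s j)) (fun i => s' (j + i)) f else 0) s
  | 0, j, t, R, h, s, f, ok, hv, _ => by
    obtain ⟨rfl, rfl⟩ := hv
    simp only [Phi, rowOp, add_zero]
    by_cases hκ : κ = 0
    · subst hκ
      by_cases hW : s j = 0
      · simp [opRow, hW, opM_zero, chain]
      · simp [opRow, hW, opM_zeros hW]
    · by_cases hW : s j = κ
      · simp [opRow, hκ, hW, opN_self hκ]
      · have := ok.mem hκ hW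
        simp at this
  | m + 1, j, t, R, h, s, f, ok, hv, hf => by
    obtain ⟨hS, hv⟩ := hv
    have e1 : (fun i => s (j + 1 + (i + 1))) = fun i => s (j + 1 + 1 + i) := by
      funext i; congr 1; omega
    have hv' : ValidWin m (R.erase (s (j + 1))) (hid h (s (j + 1)))
        (fun i => s (j + 1 + 1 + i)) := by
      rw [← e1]
      exact hv
    simp only [add_zero] at hS
    have hg : Killed (pOp β) 0 (ctxH κ h (s j) - 1) (rankOne f) := (killed_rankOne β).2 hf
    have tr := congrArg (fun a => a 1) (tile_relation (k := k) (demazureRel β hy)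
      (shiftRel β (t 0) y) ok hS hg)
    have key : ∀ e, Killed (pOp β) 0 (hid (ctxH κ h (s j)) e - 1)
        (rankOne (opB β k (pOp β) (eOp (t 0)).toLinearMap (ctxR κ R (s j)) (ctxH κ h (s j)) e f)) :=
      fun e => by
        rw [← mul_rankOne]
        exact opB_killed (demazureRel β hy) (shiftRel β (t 0) y) hg
    rw [Phi_succ_of_avail _ _ (by simpa using hS), add_zero]
    rw [e1]
    simp only [mul_rankOne, rankOne_one, LinearMap.add_apply] at tr
    rw [tr, map_add, add_comm, rowOp]
    congr 1
    · by_cases ha : Avail (ctxR κ R (s j)) (ctxH κ h (s j)) (s j)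
      · rw [if_pos ha, LinearMap.smul_apply, rankOne_one, map_smul, smul_eq_mul,
          row_lemma hy m (j + 1) _ _ _ s _ (ok.keep hS ha) hv'
          (by rw [← ctxH_keep hS]; exact (killed_rankOne β).1 (key _))]
        congr 1
        apply rowOp_congr
        intro s' hs'
        have e2 : (fun i => s' (j + (i + 1))) = fun i => s' (j + 1 + i) := by
          funext i; congr 1; omega
        rw [Phi_succ_of_avail _ _ (by rw [add_zero, hs' j (by omega)]; exact ha), add_zero,
          hs' j (by omega), ctxR_keep ok hS, ctxH_keep hS, e2, show j + 1 + m = j + (m + 1) by omega]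
      · rw [if_neg ha, LinearMap.zero_apply, map_zero]
        rw [rowOp_congr (ψ := fun _ => 0), rowOp_zero, mul_zero]
        intro s' hs'
        rw [Phi_succ_of_not_avail _ _ (by rw [add_zero, hs' j (by omega)]; exact ha), ite_self]
    · have es0 : (s ∘ Equiv.swap j (j + 1)) j = s (j + 1) := by simp
      have es1 : (s ∘ Equiv.swap j (j + 1)) (j + 1) = s j := by simp
      have es2 : (fun i => (s ∘ Equiv.swap j (j + 1)) (j + 1 + 1 + i))
          = fun i => s (j + 1 + 1 + i) := by
        funext i
        rw [Function.comp_apply, Equiv.swap_apply_of_ne_of_ne (by omega) (by omega)]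
      by_cases ha : Avail (ctxR κ R (s j)) (ctxH κ h (s j)) (s (j + 1))
      · have IH := row_lemma (κ := κ) hy m (j + 1) (fun i => t (i + 1)) (R.erase (s (j + 1)))
          (hid h (s (j + 1))) (s ∘ Equiv.swap j (j + 1))
          (opB β k (pOp β) (eOp (t 0)).toLinearMap (ctxR κ R (s j)) (ctxH κ h (s j)) (s (j + 1)) f)
        rw [es1, es2] at IH
        rw [if_pos ha, LinearMap.smul_apply, rankOne_one, map_smul, smul_eq_mul,
          IH (ok.swap hS ha) hv'
          (by rw [← ctxH_swap hS]; exact (killed_rankOne β).1 (key _))]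
        congr 1
        apply rowOp_congr
        intro s' hs'
        have e2 : (fun i => s' (j + (i + 1))) = fun i => s' (j + 1 + i) := by
          funext i; congr 1; omega
        rw [Phi_succ_of_avail _ _ (by rw [add_zero, hs' j (by omega), es0]; exact ha), add_zero,
          hs' j (by omega), es0, ctxR_swap ok hS, ctxH_swap hS, e2,
          show j + 1 + m = j + (m + 1) by omega]
      · rw [if_neg ha, LinearMap.zero_apply, map_zero]
        rw [rowOp_congr (ψ := fun _ => 0), rowOp_zero, mul_zero]
        intro s' hs'
        rw [Phi_succ_of_not_avail _ _ (by rw [add_zero, hs' j (by omega), es0]; exact ha), ite_self]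

end Functional

open DemazureRel

/-- The multiset of the labels of `s` at the positions `a, …, a + n - 1`. -/
def win (s : ℕ → ℕ) : ℕ → ℕ → Multiset ℕ
  | _, 0 => 0
  | a, n + 1 => s a ::ₘ win s (a + 1) n

theorem win_congr {s s' : ℕ → ℕ} : ∀ {a n : ℕ}, (∀ i, a ≤ i → i < a + n → s i = s' i) →
    win s a n = win s' a n
  | _, 0, _ => rfl
  | a, n + 1, h => by
    rw [win, win, h a le_rfl (by omega), win_congr fun i h1 h2 => h i (by omega) (by omega)]

theorem win_succ_last (s : ℕ → ℕ) : ∀ a n : ℕ, win s a (n + 1) = s (a + n) ::ₘ win s a n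
  | a, 0 => rfl
  | a, n + 1 => by
    rw [win, win_succ_last s (a + 1) n, Multiset.cons_swap, win, show a + 1 + n = a + (n + 1) by omega]

theorem win_shift (s : ℕ → ℕ) (b : ℕ) : ∀ a n : ℕ,
    win (fun i => s (b + i)) a n = win s (b + a) n
  | _, 0 => rfl
  | a, n + 1 => by rw [win, win, win_shift s b (a + 1) n, add_assoc]

theorem mem_win {s : ℕ → ℕ} {e : ℕ} : ∀ {a n : ℕ}, e ∈ win s a n ↔ ∃ i, a ≤ i ∧ i < a + n ∧ s i = e
  | a, 0 => by simp only [win, Multiset.notMem_zero, false_iff]; rintro ⟨i, h⟩; omega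
  | a, n + 1 => by
    rw [win, Multiset.mem_cons, mem_win]
    constructor
    · rintro (rfl | ⟨i, h1, h2, h3⟩)
      · exact ⟨a, le_rfl, by omega, rfl⟩
      · exact ⟨i, by omega, by omega, h3⟩
    · rintro ⟨i, h1, h2, h3⟩
      rcases h1.eq_or_lt with rfl | h1
      · exact Or.inl h3.symm
      · exact Or.inr ⟨i, by omega, by omega, h3⟩

theorem validWin_of_win : ∀ {m : ℕ} {R : Finset ℕ} {h : ℕ} {s : ℕ → ℕ}, 0 ∉ R →
    win s 0 m = R.val + Multiset.replicate h 0 → ValidWin m R h s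
  | 0, R, h, s, _, hw => by
    have := congrArg Multiset.card hw
    simp only [win, Multiset.card_zero, Multiset.card_add, Finset.card_val,
      Multiset.card_replicate] at this
    exact ⟨Finset.card_eq_zero.1 (by omega), by omega⟩
  | m + 1, R, h, s, h0, hw => by
    have hsh : win s (0 + 1) m = win (fun i => s (i + 1)) 0 m := by
      have := win_shift s 1 0 m
      simp only [add_comm 1] at this
      exact this.symm
    rw [win, hsh] at hw
    have hmem : s 0 ∈ R.val + Multiset.replicate h 0 := hw ▸ Multiset.mem_cons_self _ _
    rw [Multiset.mem_add, Finset.mem_val, Multiset.mem_replicate] at hmem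
    by_cases hs : s 0 = 0
    · have hh : 0 < h := by
        rcases hmem with h1 | h1
        · exact absurd (hs ▸ h1) h0
        · omega
      obtain ⟨h, rfl⟩ : ∃ h', h = h' + 1 := ⟨h - 1, by omega⟩
      refine ⟨by simp [Avail, hs], validWin_of_win (by simp [h0]) ?_⟩
      rw [hs, Finset.erase_eq_of_notMem h0, hid, if_pos rfl]
      rw [hs, Multiset.replicate_succ, Multiset.add_cons] at hw
      exact Multiset.cons_inj_right 0 |>.1 hw
    · have hR : s 0 ∈ R := by
        rcases hmem with h1 | h1
        · exact h1
        · exact absurd h1.2 hs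
      refine ⟨by simpa [Avail, hs] using hR, validWin_of_win (by simp [h0]) ?_⟩
      rw [hid, if_neg hs]
      rw [← Finset.insert_erase hR, Finset.insert_val,
        Multiset.ndinsert_of_notMem (Finset.notMem_erase (s 0) R),
        Multiset.cons_add] at hw
      exact Multiset.cons_inj_right (s 0) |>.1 hw

section

variable {K : Type*} [Field K] (β : K) (k : ℕ)

theorem rowOp_congr_win {φ ψ : (ℕ → ℕ) → K} : ∀ {m j : ℕ} {x : ℕ → K} {s : ℕ → ℕ},
    (∀ s' : ℕ → ℕ, (∀ i, i < j ∨ j + m < i → s' i = s i) →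
      win s' j (m + 1) = win s j (m + 1) → φ s' = ψ s') →
    rowOp β k x j m φ s = rowOp β k x j m ψ s
  | 0, _, _, s, h => h s (fun _ _ => rfl) rfl
  | m + 1, j, x, s, h => by
    rw [rowOp, rowOp, rowOp_congr_win (m := m) (s := s) (φ := φ) (ψ := ψ),
      rowOp_congr_win (m := m) (φ := φ) (ψ := ψ)]
    · intro s' hs' hw
      apply h
      · intro i hi
        rw [hs' i (by omega), Function.comp_apply,
          Equiv.swap_apply_of_ne_of_ne (by omega) (by omega)]
      · rw [win, hw, hs' j (by omega), win, win, win, Function.comp_apply, Function.comp_apply,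
          Equiv.swap_apply_left, Equiv.swap_apply_right, Multiset.cons_swap]
        congr 2
        apply win_congr
        intro i h1 h2
        rw [Function.comp_apply, Equiv.swap_apply_of_ne_of_ne (by omega) (by omega)]
    · intro s' hs' hw
      exact h s' (fun i hi => hs' i (by omega)) (by rw [win, hw, hs' j (by omega), ← win])

/-- The partition function of the first `m` rows of a grid of width `n`, acting on functions of
label sequences. -/
def gridOp (t y : ℕ → K) (n : ℕ) : ℕ → ((ℕ → ℕ) → K) → (ℕ → ℕ) → K
  | 0, φ, s => φ s
  | m + 1, φ, s => rowOp β k (fun j => ominus β (t j) (y m)) m n (gridOp t y n m φ) s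

variable {β k}

theorem commute_p_chain_X {A : Type*} [Ring A] [Algebra K A] {p X : ℕ → A}
    (H : DemazureRel β p X) {i N : ℕ} (hi : i + 1 < N) : Commute (p i) (chain X 0 N) := by
  obtain ⟨d, rfl⟩ : ∃ d, N = i + (d + 2) := ⟨N - i - 2, by omega⟩
  rw [chain_add, chain_succ, chain_succ, zero_add, ← mul_assoc (X i)]
  refine (commute_chain_right fun j h1 h2 => H.commute_p_X (Or.inl (by omega))).mul_right
    (Commute.mul_right ?_ (commute_chain_right fun j h1 h2 => H.commute_p_X (Or.inr (by omega))))
  have : p i * (X i * X (i + 1)) = X i * X (i + 1) * p i := by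
    rw [← mul_assoc, H.pX, add_mul, add_mul, mul_assoc, H.pX', one_mul, smul_mul_assoc,
      mul_sub, mul_sub, mul_smul_comm, mul_one, ← mul_assoc, H.XX (i + 1) i]
    abel
  exact this

theorem gridOp_base {n : ℕ} {t y : ℕ → K} (hy : ∀ m, 1 + β * y m ≠ 0) {a κ : ℕ → ℕ}
    {F : ℕ → MvPolynomial ℕ K} {s0 : ℕ → ℕ}
    (hak : ∀ m ≤ n, a m ≤ k) (hkn : k ≤ n)
    (hκ : ∀ m < n, (κ m = 0 ∧ a (m + 1) = a m) ∨ (κ m = a m ∧ a m = a (m + 1) + 1))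
    (hs0 : ∀ m < n, s0 (n + m) = κ m)
    (hF : ∀ m < n, F (m + 1) = chain (xOp β (y m)) 0 (a (m + 1)) (F m))
    (hF0 : ∀ i < a 0 - 1, pOp β i (F 0) = 0)
    (init : ∀ s, ValidWin n (Finset.Ioc (a 0) n) (a 0) s →
      Phi β k n t (Finset.Ioc (a 0) n) (a 0) s (F 0) = if ∀ i < n, s i = s0 i then 1 else 0)
    (m : ℕ) (hm : m ≤ n) :
    (∀ i < a m - 1, pOp β i (F m) = 0) ∧
    ∀ s : ℕ → ℕ,
    ((∃ i, m + n ≤ i ∧ i < n + n ∧ s i ≠ s0 i) →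
      gridOp β k t y n m (fun s' => if ∀ i < n + n, s' i = s0 i then 1 else 0) s = 0) ∧
    ((∀ i < m, s i = 0) → (∀ i, m + n ≤ i → i < n + n → s i = s0 i) →
      win s m n = (Finset.Ioc (a m) n).val + Multiset.replicate (a m) 0 →
      gridOp β k t y n m (fun s' => if ∀ i < n + n, s' i = s0 i then 1 else 0) s
        = Phi β k n t (Finset.Ioc (a m) n) (a m) (fun i => s (m + i)) (F m)) := by
  induction m with
  | zero =>
    refine ⟨hF0, fun s => ⟨?_, ?_⟩⟩
    · rintro ⟨i, h1, h2, h3⟩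
      rw [gridOp, if_neg fun h => h3 (h i h2)]
    · intro _ h1 h2
      simp only [zero_add] at h1 ⊢
      rw [gridOp, init s (validWin_of_win (by simp) h2)]
      by_cases h3 : ∀ i < n, s i = s0 i
      · rw [if_pos h3, if_pos]
        intro i hi
        by_cases h4 : i < n
        · exact h3 i h4
        · exact h1 i (by omega) hi
      · rw [if_neg h3, if_neg fun h => h3 fun i hi => h i (by omega)]
  | succ m ih =>
    obtain ⟨ih1, ih2⟩ := ih (by omega)
    have hκm := hκ m (by omega)
    refine ⟨?_, fun s => ⟨?_, ?_⟩⟩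
    · intro i hi
      have := congrArg (fun g => g (F m))
        (commute_p_chain_X (demazureRel β (hy m)) (i := i) (N := a (m + 1)) (by omega)).eq
      simp only [Module.End.mul_apply] at this
      rw [hF m (by omega), this, ih1 i (by omega), map_zero]
    · rintro ⟨i, h1, h2, h3⟩
      rw [gridOp, rowOp_congr (ψ := fun _ => 0), rowOp_zero]
      intro s' hs'
      exact (ih2 s').1 ⟨i, by omega, h2, by rwa [hs' i (by omega)]⟩
    · intro h1 h2 h3
      have hW : s m = 0 := h1 m (by omega)
      have hle := hak m (by omega)
      have ok : RowOK k (κ m) (Finset.Ioc (a (m + 1)) n) (s m) := by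
        rw [hW]
        refine ⟨by simp, by simp, ?_, ?_, ?_, by simp⟩
        · omega
        · intro h4 _
          rw [Finset.mem_Ioc]; omega
        · intro h4 x hx
          rw [Finset.mem_Ioc] at hx; omega
      have eR : ctxR (κ m) (Finset.Ioc (a (m + 1)) n) (s m) = Finset.Ioc (a m) n := by
        rw [ctxR, if_pos hW]
        ext x
        simp only [Finset.mem_erase, Finset.mem_Ioc]
        omega
      have eH : ctxH (κ m) (a (m + 1)) (s m) = a m := by
        rw [ctxH, if_pos hW]
        split_ifs <;> omega
      have hop : opRow β k (pOp β) (xOp β (y m)) (κ m) (Finset.Ioc (a (m + 1)) n) (a (m + 1)) (s m)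
          = chain (xOp β (y m)) 0 (a (m + 1)) := by
        rw [hW, opRow, opM_zero, opN_zero, ite_self]
      have hwin := win_shift s (m + 1) 0 n
      rw [add_zero, h3] at hwin
      rw [hF m (by omega), ← hop, row_lemma (hy m) n m t _ _ s _ ok
        (validWin_of_win (by simp) hwin) (by rw [eH]; exact ih1), gridOp, eR, eH]
      apply rowOp_congr_win
      intro s' hs' hw
      split_ifs with h4
      · refine (ih2 s').2 ?_ ?_ ?_
        · intro i hi
          rw [hs' i (by omega), h1 i (by omega)]
        · intro i h5 h6
          rcases h5.eq_or_lt with rfl | h5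
          · rw [h4, ← hs0 m (by omega), add_comm]
          · rw [hs' i (by omega), h2 i (by omega) h6]
        · rw [win_succ_last, h4, win, h3, hW] at hw
          rcases hκm with ⟨h5, h6⟩ | ⟨h5, h6⟩
          · rw [h5, h6] at hw
            exact (Multiset.cons_inj_right 0).1 hw
          · have : Finset.Ioc (a (m + 1)) n = insert (κ m) (Finset.Ioc (a m) n) := by
              ext x
              simp only [Finset.mem_insert, Finset.mem_Ioc]
              omega
            rw [this, Finset.insert_val, Multiset.ndinsert_of_notMem (by simp; omega),
              Multiset.cons_add, Multiset.cons_swap, Multiset.cons_inj_right] at hw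
            rw [hw, ← Multiset.add_cons, ← Multiset.replicate_succ, h6]
      · refine (ih2 s').1 ⟨m + n, le_rfl, by omega, ?_⟩
        rwa [add_comm m n, hs0 m (by omega), add_comm n m]

end

open DemazureRel

section Permutations

theorem perm_inv_apply (w : Equiv.Perm ℕ) (i : ℕ) : w⁻¹ (w i) = i := w.symm_apply_apply i

theorem perm_apply_inv (w : Equiv.Perm ℕ) (i : ℕ) : w (w⁻¹ i) = i := w.apply_symm_apply i

theorem sTr_left (i : ℕ) : sTr i i = i + 1 := Equiv.swap_apply_left _ _

theorem sTr_right (i : ℕ) : sTr i (i + 1) = i := Equiv.swap_apply_right _ _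

theorem sTr_of_ne {i j : ℕ} (h : j ≠ i) (h' : j ≠ i + 1) : sTr i j = j :=
  Equiv.swap_apply_of_ne_of_ne h h'

theorem sTr_mul_sTr (i : ℕ) : sTr i * sTr i = 1 := Equiv.swap_mul_self _ _

theorem mul_sTr_mul_sTr (w : Equiv.Perm ℕ) (i : ℕ) : w * sTr i * sTr i = w := by
  rw [mul_assoc, sTr_mul_sTr, mul_one]

theorem mul_sTr_left (w : Equiv.Perm ℕ) (i : ℕ) : (w * sTr i) i = w (i + 1) := by
  rw [Equiv.Perm.mul_apply, sTr_left]

theorem mul_sTr_right (w : Equiv.Perm ℕ) (i : ℕ) : (w * sTr i) (i + 1) = w i := by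
  rw [Equiv.Perm.mul_apply, sTr_right]

theorem mul_sTr_of_ne (w : Equiv.Perm ℕ) {i j : ℕ} (h : j ≠ i) (h' : j ≠ i + 1) :
    (w * sTr i) j = w j := by
  rw [Equiv.Perm.mul_apply, sTr_of_ne h h']

theorem perm_ne (w : Equiv.Perm ℕ) {i j : ℕ} (h : i ≠ j) : w i ≠ w j := fun e => h (w.injective e)

theorem InSn.mul_sTr {n i : ℕ} {w : Equiv.Perm ℕ} (h : InSn n w) (hi : i + 1 < n) :
    InSn n (w * sTr i) := fun j hj => by
  rw [mul_sTr_of_ne _ (by omega) (by omega), h j hj]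

theorem InSn.lt {n i : ℕ} {w : Equiv.Perm ℕ} (h : InSn n w) (hi : i < n) : w i < n := by
  by_contra h1
  have := w.injective (h (w i) (by omega))
  omega

theorem InSn.inv {n : ℕ} {w : Equiv.Perm ℕ} (h : InSn n w) : InSn n w⁻¹ := fun j hj => by
  rw [Equiv.Perm.inv_eq_iff_eq, h j hj]

theorem InSn.mono {n m : ℕ} {w : Equiv.Perm ℕ} (h : InSn n w) (hm : n ≤ m) : InSn m w :=
  fun j hj => h j (hm.trans hj)

theorem InSn.finPerm {n : ℕ} {w : Equiv.Perm ℕ} (h : InSn n w) : FinPerm w := ⟨n, h⟩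

theorem FinPerm.mul_sTr {i : ℕ} {w : Equiv.Perm ℕ} (h : FinPerm w) : FinPerm (w * sTr i) := by
  obtain ⟨N, hN⟩ := h
  exact (InSn.mul_sTr (n := N + i + 2) (fun j hj => hN j (by omega)) (by omega)).finPerm

theorem inSn_zero {w : Equiv.Perm ℕ} : InSn 0 w ↔ w = 1 :=
  ⟨fun h => Equiv.ext fun j => h j (Nat.zero_le _), by rintro rfl j _; rfl⟩

theorem revPerm_lt {n j : ℕ} (h : j < n) : revPerm n j = n - 1 - j := if_pos h

theorem inSn_revPerm (n : ℕ) : InSn n (revPerm n) := fun _ hj => if_neg (by omega)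

theorem eq_revPerm {n : ℕ} {w : Equiv.Perm ℕ} (h : InSn n w)
    (hd : ∀ i, i + 1 < n → w (i + 1) < w i) : w = revPerm n := by
  have h1 : ∀ i, i < n → w i + i < n := by
    intro i
    induction i with
    | zero => intro hi; simpa using h.lt hi
    | succ i ih => intro hi; have := hd i hi; have := ih (by omega); omega
  have h2 : ∀ d i, i + d + 1 = n → d ≤ w i := by
    intro d
    induction d with
    | zero => intro i _; omega
    | succ d ih => intro i hi; have := hd i (by omega); have := ih (i + 1) (by omega); omega
  refine Equiv.ext fun i => ?_
  by_cases hi : i < n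
  · rw [revPerm_lt hi]
    have := h1 i hi
    have := h2 (n - 1 - i) i (by omega)
    omega
  · rw [h i (by omega), inSn_revPerm n i (by omega)]

theorem desc_measure {k i : ℕ} {w : Equiv.Perm ℕ} (hi : i + 1 < k) (h : w i < w (i + 1)) :
    ∑ j ∈ Finset.range k, j * (w * sTr i) j < ∑ j ∈ Finset.range k, j * w j := by
  have key : ∀ u : Equiv.Perm ℕ, ∑ j ∈ Finset.range k, j * u j
      = i * u i + ((i + 1) * u (i + 1)
        + ∑ j ∈ ((Finset.range k).erase i).erase (i + 1), j * u j) := by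
    intro u
    rw [Finset.add_sum_erase _ (fun j => j * u j), Finset.add_sum_erase _ (fun j => j * u j)]
    · simp; omega
    · simp; omega
  rw [key, key w, mul_sTr_left, mul_sTr_right]
  have : ∑ j ∈ ((Finset.range k).erase i).erase (i + 1), j * (w * sTr i) j
      = ∑ j ∈ ((Finset.range k).erase i).erase (i + 1), j * w j := by
    refine Finset.sum_congr rfl fun j hj => ?_
    simp only [Finset.mem_erase] at hj
    rw [mul_sTr_of_ne _ hj.2.1 hj.1]
  rw [this]
  nlinarith

theorem desc_induction {n k : ℕ} (hkn : k ≤ n) {P : Equiv.Perm ℕ → Prop}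
    (base : ∀ w, InSn n w → (∀ i, i + 1 < k → w (i + 1) < w i) → P w)
    (step : ∀ w, InSn n w → ∀ i, i + 1 < k → w i < w (i + 1) → P (w * sTr i) → P w)
    (w : Equiv.Perm ℕ) (hw : InSn n w) : P w := by
  by_cases h : ∃ i, i + 1 < k ∧ w i < w (i + 1)
  · obtain ⟨i, hi, h⟩ := h
    exact step w hw i hi h
      (desc_induction hkn base step (w * sTr i) (hw.mul_sTr (by omega)))
  · refine base w hw fun i hi => ?_
    by_contra h1
    exact h ⟨i, hi, lt_of_le_of_ne (by omega) (perm_ne w (by omega))⟩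
termination_by ∑ j ∈ Finset.range k, j * w j
decreasing_by exact desc_measure hi h

/-- Insert the value `0` at position `q` of the one-line notation of `w`, raising all other
values by one. -/
def ins (q : ℕ) (w : Equiv.Perm ℕ) : Equiv.Perm ℕ where
  toFun i := if i < q then w i + 1 else if i = q then 0 else w (i - 1) + 1
  invFun j := match j with
    | 0 => q
    | j + 1 => if w⁻¹ j < q then w⁻¹ j else w⁻¹ j + 1
  left_inv i := by
    rcases lt_trichotomy i q with h | h | h
    · simp only [h, if_true, perm_inv_apply]
    · simp [h]
    · have h1 : ¬ i - 1 < q := by omega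
      have h2 : ¬ i < q := by omega
      have h3 : i ≠ q := by omega
      simp only [h2, h3, if_false, perm_inv_apply, h1]
      omega
  right_inv j := by
    rcases j with _ | j
    · simp
    · by_cases h : w⁻¹ j < q
      · simp only [h, if_true, perm_apply_inv]
      · have h2 : ¬ w⁻¹ j + 1 < q := by omega
        have h3 : w⁻¹ j + 1 ≠ q := by omega
        simp only [h, h2, h3, if_false, Nat.add_sub_cancel, perm_apply_inv]

theorem ins_of_lt {q i : ℕ} (w : Equiv.Perm ℕ) (h : i < q) : ins q w i = w i + 1 := if_pos h

theorem ins_self (q : ℕ) (w : Equiv.Perm ℕ) : ins q w q = 0 := by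
  change (if q < q then _ else if q = q then 0 else _) = 0
  simp

theorem ins_succ {q i : ℕ} (w : Equiv.Perm ℕ) (h : q ≤ i) : ins q w (i + 1) = w i + 1 := by
  change (if i + 1 < q then _ else if i + 1 = q then 0 else w (i + 1 - 1) + 1) = w i + 1
  rw [if_neg (by omega), if_neg (by omega), Nat.add_sub_cancel]

theorem ins_succ_mul_sTr (q : ℕ) (w : Equiv.Perm ℕ) : ins (q + 1) w * sTr q = ins q w := by
  refine Equiv.ext fun i => ?_
  rcases lt_trichotomy i q with h | rfl | h
  · rw [mul_sTr_of_ne _ (by omega) (by omega), ins_of_lt _ (by omega), ins_of_lt _ h]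
  · rw [mul_sTr_left, ins_self, ins_self]
  · obtain ⟨i, rfl⟩ : ∃ i', i = i' + 1 := ⟨i - 1, by omega⟩
    rcases (Nat.lt_succ_iff.1 h).eq_or_lt with rfl | h1
    · rw [mul_sTr_right, ins_of_lt _ (by omega), ins_succ _ le_rfl]
    · rw [mul_sTr_of_ne _ (by omega) (by omega), ins_succ _ (by omega), ins_succ _ (by omega)]

theorem ins_mul_sTr {q i : ℕ} (w : Equiv.Perm ℕ) (h : i + 1 < q) :
    ins q w * sTr i = ins q (w * sTr i) := by
  refine Equiv.ext fun j => ?_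
  rcases lt_trichotomy j q with h1 | rfl | h1
  · rw [Equiv.Perm.mul_apply, ins_of_lt _ h1, Equiv.Perm.mul_apply, ins_of_lt]
    unfold sTr
    rw [Equiv.swap_apply_def]
    split_ifs <;> omega
  · rw [mul_sTr_of_ne _ (by omega) (by omega), ins_self, ins_self]
  · obtain ⟨j, rfl⟩ : ∃ j', j = j' + 1 := ⟨j - 1, by omega⟩
    rw [mul_sTr_of_ne _ (by omega) (by omega), ins_succ _ (by omega), ins_succ _ (by omega),
      mul_sTr_of_ne _ (by omega) (by omega)]

theorem ins_revPerm (N : ℕ) : ins N (revPerm N) = revPerm (N + 1) := by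
  refine Equiv.ext fun j => ?_
  rcases lt_trichotomy j N with h1 | rfl | h1
  · rw [ins_of_lt _ h1, revPerm_lt h1, revPerm_lt (by omega)]
    omega
  · rw [ins_self, revPerm_lt (by omega)]
    omega
  · obtain ⟨j, rfl⟩ : ∃ j', j = j' + 1 := ⟨j - 1, by omega⟩
    rw [ins_succ _ (by omega), inSn_revPerm _ _ (by omega), inSn_revPerm _ _ (by omega)]

theorem zero_lt_of_ne {w : Equiv.Perm ℕ} {i : ℕ} (h : i ≠ w⁻¹ 0) : 0 < w i :=
  Nat.pos_of_ne_zero fun h1 => h (by rw [← h1, perm_inv_apply])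

/-- Remove the value `0` from the one-line notation of `w`, lowering all other values by one. -/
def del (w : Equiv.Perm ℕ) : Equiv.Perm ℕ where
  toFun i := w (if i < w⁻¹ 0 then i else i + 1) - 1
  invFun j := if w⁻¹ (j + 1) < w⁻¹ 0 then w⁻¹ (j + 1) else w⁻¹ (j + 1) - 1
  left_inv i := by
    by_cases h : i < w⁻¹ 0
    · have := zero_lt_of_ne h.ne
      simp only [h, if_true]
      rw [Nat.sub_add_cancel this, perm_inv_apply, if_pos h]
    · have := zero_lt_of_ne (w := w) (i := i + 1) (by omega)
      simp only [h, if_false]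
      rw [Nat.sub_add_cancel this, perm_inv_apply, if_neg (by omega)]
      omega
  right_inv j := by
    by_cases h : w⁻¹ (j + 1) < w⁻¹ 0
    · simp only [h, if_true, perm_apply_inv, Nat.add_sub_cancel]
    · have h1 := perm_ne w⁻¹ (Nat.succ_ne_zero j)
      have h2 : ¬ w⁻¹ (j + 1) - 1 < w⁻¹ 0 := by simp only [Nat.succ_eq_add_one] at h1; omega
      have h3 : w⁻¹ (j + 1) - 1 + 1 = w⁻¹ (j + 1) := by
        simp only [Nat.succ_eq_add_one] at h1; omega
      simp only [h, h2, h3, if_false, perm_apply_inv]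
      omega

theorem del_of_lt {w : Equiv.Perm ℕ} {i : ℕ} (h : i < w⁻¹ 0) : del w i + 1 = w i := by
  have := zero_lt_of_ne h.ne
  change w (if i < w⁻¹ 0 then i else i + 1) - 1 + 1 = w i
  rw [if_pos h]
  omega

theorem del_of_le {w : Equiv.Perm ℕ} {i : ℕ} (h : w⁻¹ 0 ≤ i) : del w i + 1 = w (i + 1) := by
  have := zero_lt_of_ne (w := w) (i := i + 1) (by omega)
  change w (if i < w⁻¹ 0 then i else i + 1) - 1 + 1 = w (i + 1)
  rw [if_neg (by omega)]
  omega

theorem del_inv_apply (w : Equiv.Perm ℕ) (j : ℕ) :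
    (del w)⁻¹ j = if w⁻¹ (j + 1) < w⁻¹ 0 then w⁻¹ (j + 1) else w⁻¹ (j + 1) - 1 := rfl

theorem ins_del (w : Equiv.Perm ℕ) : ins (w⁻¹ 0) (del w) = w := by
  refine Equiv.ext fun i => ?_
  rcases lt_trichotomy i (w⁻¹ 0) with h1 | h1 | h1
  · rw [ins_of_lt _ h1, del_of_lt h1]
  · rw [h1, ins_self, perm_apply_inv]
  · obtain ⟨i, rfl⟩ : ∃ i', i = i' + 1 := ⟨i - 1, by omega⟩
    rw [ins_succ _ (by omega), del_of_le (by omega)]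

theorem ins_inv_zero (q : ℕ) (w : Equiv.Perm ℕ) : (ins q w)⁻¹ 0 = q := by
  rw [Equiv.Perm.inv_eq_iff_eq, ins_self]

theorem del_ins (q : ℕ) (w : Equiv.Perm ℕ) : del (ins q w) = w := by
  refine Equiv.ext fun i => ?_
  by_cases h : i < q
  · have := del_of_lt (w := ins q w) (i := i) (by rwa [ins_inv_zero])
    rw [ins_of_lt _ h] at this
    omega
  · have := del_of_le (w := ins q w) (i := i) (by rw [ins_inv_zero]; omega)
    rw [ins_succ _ (by omega)] at this
    omega

theorem del_mul_sTr {w : Equiv.Perm ℕ} {s : ℕ} (h : w (s + 1) = 0) : del (w * sTr s) = del w := by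
  have h1 : w⁻¹ 0 = s + 1 := by rw [Equiv.Perm.inv_eq_iff_eq, h]
  conv_lhs => rw [← ins_del w, h1, ins_succ_mul_sTr, del_ins]

theorem InSn.del {n : ℕ} {w : Equiv.Perm ℕ} (h : InSn (n + 1) w) : InSn n (del w) := by
  intro j hj
  have h1 : w⁻¹ 0 < n + 1 := h.inv.lt (by omega)
  have := del_of_le (w := w) (i := j) (by omega)
  rw [h _ (by omega)] at this
  omega

theorem FinPerm.del {w : Equiv.Perm ℕ} (h : FinPerm w) : FinPerm (del w) := by
  obtain ⟨N, hN⟩ := h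
  exact (InSn.del (n := N) fun j hj => hN j (by omega)).finPerm

theorem inSn_of_del {n : ℕ} {w : Equiv.Perm ℕ} (h : InSn n (BPDPuzzle.del w)) (h0 : w⁻¹ 0 ≤ n) :
    InSn (n + 1) w := by
  intro j hj
  obtain ⟨i, rfl⟩ : ∃ i', j = i' + 1 := ⟨j - 1, by omega⟩
  rw [← del_of_le (by omega), h i (by omega)]

end Permutations

open DemazureRel

section

variable {K : Type*} [Field K] {β : K}

theorem chain_xOp_mul (y : K) (f g : MvPolynomial ℕ K) : ∀ a n : ℕ,
    chain (xOp β y) a n (f * g) = chain (xOp β y) a n f * g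
  | a, 0 => rfl
  | a, n + 1 => by
    rw [chain_succ, Module.End.mul_apply, Module.End.mul_apply, chain_xOp_mul y f g (a + 1) n,
      xOp_apply, xOp_apply, mul_assoc _ _ g]

theorem chain_xOp_apply (y : K) (g : MvPolynomial ℕ K) (n : ℕ) :
    chain (xOp β y) 0 n g
      = (∏ i ∈ Finset.range n, C ((1 + β * y)⁻¹) * (X i - C y)) * g := by
  induction n generalizing g with
  | zero => simp
  | succ n ih =>
    rw [chain_succ_last, Module.End.mul_apply, ih, Finset.prod_range_succ, xOp_apply, zero_add]
    ring

theorem opR_apply (i : ℕ) (f : MvPolynomial ℕ K) :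
    opR β (pOp β) i f = pOp β i f - C β * f := by
  rw [opR, LinearMap.sub_apply, LinearMap.smul_apply, Module.End.one_apply, smul_eq_C_mul]

theorem pOp_opR (i : ℕ) (f : MvPolynomial ℕ K) : pOp β i (opR β (pOp β) i f) = 0 := by
  have := congrArg (fun g => g f) ((demazureRel β (y := 0) (by simp)).p_mul_opR i)
  simpa using this

/-- Substitution of `t` for the variable `X q`, lowering the later variables. -/
def evAt (t : K) (q : ℕ) : MvPolynomial ℕ K →ₐ[K] MvPolynomial ℕ K :=
  aeval fun j => if j < q then X j else if j = q then C t else X (j - 1)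

theorem evAt_X_of_lt {t : K} {q j : ℕ} (h : j < q) : evAt t q (X j) = X j := by
  rw [evAt, aeval_X, if_pos h]

theorem evAt_X_self (t : K) (q : ℕ) : evAt t q (X q) = C t := by
  rw [evAt, aeval_X, if_neg (lt_irrefl _), if_pos rfl]

theorem evAt_X_succ {t : K} {q j : ℕ} (h : q ≤ j) : evAt t q (X (j + 1)) = X j := by
  rw [evAt, aeval_X, if_neg (by omega), if_neg (by omega), Nat.add_sub_cancel]

theorem evAt_C (t : K) (q : ℕ) (c : K) : evAt t q (C c) = C c := algHom_C _ _

theorem evAt_zero (t : K) : evAt t 0 = eOp t := by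
  apply algHom_ext
  intro j
  rcases j with _ | j
  · rw [evAt_X_self, eOp_X_zero]
  · rw [evAt_X_succ (Nat.zero_le _), eOp_X_succ]

theorem evAt_succ (t : K) (q : ℕ) (f : MvPolynomial ℕ K) :
    evAt t q (sAct q f) = evAt t (q + 1) f := by
  have : (evAt t q).comp (sAct q) = evAt t (q + 1) := by
    apply algHom_ext
    intro j
    rw [AlgHom.comp_apply]
    rcases lt_trichotomy j q with h | rfl | h
    · rw [sAct_X_of_ne (by omega) (by omega), evAt_X_of_lt h, evAt_X_of_lt (by omega)]
    · rw [sAct_X_left, evAt_X_succ le_rfl, evAt_X_of_lt (by omega)]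
    · obtain ⟨j, rfl⟩ : ∃ j', j = j' + 1 := ⟨j - 1, by omega⟩
      rcases (Nat.lt_succ_iff.1 h).eq_or_lt with rfl | h1
      · rw [sAct_X_right, evAt_X_self, evAt_X_self]
      · rw [sAct_X_of_ne (by omega) (by omega), evAt_X_succ (by omega), evAt_X_succ (by omega)]
  rw [← this, AlgHom.comp_apply]

theorem evAt_sAct {t : K} {q i : ℕ} (h : i + 1 < q) (f : MvPolynomial ℕ K) :
    evAt t q (sAct i f) = sAct i (evAt t q f) := by
  have : (evAt t q).comp (sAct i) = (sAct i).comp (evAt t q) := by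
    apply algHom_ext
    intro j
    rw [AlgHom.comp_apply, AlgHom.comp_apply]
    rcases lt_trichotomy j q with h1 | rfl | h1
    · rw [evAt_X_of_lt h1]
      by_cases h2 : j = i
      · rw [h2, sAct_X_left, evAt_X_of_lt h]
      by_cases h3 : j = i + 1
      · rw [h3, sAct_X_right, evAt_X_of_lt (by omega)]
      · rw [sAct_X_of_ne h2 h3, evAt_X_of_lt h1]
    · rw [sAct_X_of_ne (by omega) (by omega), evAt_X_self, sAct_C]
    · obtain ⟨j, rfl⟩ : ∃ j', j = j' + 1 := ⟨j - 1, by omega⟩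
      rw [sAct_X_of_ne (by omega) (by omega), evAt_X_succ (by omega),
        sAct_X_of_ne (by omega) (by omega)]
  exact congrArg (fun g => g f) this

theorem evAt_opR {t : K} {q i : ℕ} (h : i + 1 < q) (f : MvPolynomial ℕ K) :
    evAt t q (opR β (pOp β) i f) = opR β (pOp β) i (evAt t q f) := by
  have hd : evAt t q (divDiff i f) = divDiff i (evAt t q f) := by
    symm
    apply divDiff_unique
    have := congrArg (evAt t q) (divDiff_spec i f)
    rw [map_mul, map_sub, map_sub, evAt_X_of_lt (by omega), evAt_X_of_lt h, evAt_sAct h] at this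
    exact this
  rw [opR_apply, opR_apply, pOp_apply, pOp_apply, map_sub, map_mul, map_mul, map_add, map_mul,
    map_one, hd, evAt_C, evAt_X_of_lt (by omega)]

theorem evAt_opR_xOp {t : K} (ht : 1 + β * t ≠ 0) (q : ℕ) (f : MvPolynomial ℕ K) :
    evAt t q (opR β (pOp β) q (xOp β t q f)) = evAt t (q + 1) f := by
  have h1 : opR β (pOp β) q (xOp β t q f) = f + xOp β t (q + 1) (pOp β q f) := by
    have := congrArg (fun g => g f) ((demazureRel β ht).opR_mul_X q)
    simpa [opQ] using this
  have h2 := congrArg (evAt t q) (divDiff_spec q f)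
  rw [map_mul, map_sub, map_sub, evAt_X_self, evAt_X_succ le_rfl, evAt_succ] at h2
  have h3 : C ((1 + β * t)⁻¹) * (1 + C β * C t) = (1 : MvPolynomial ℕ K) := by
    rw [← C_1, ← C_mul, ← C_add, ← C_mul, inv_mul_cancel₀ ht]
  rw [h1, map_add, xOp_apply, pOp_apply, map_mul, map_mul, map_mul, map_sub, map_add, map_mul,
    map_one, evAt_C, evAt_C, evAt_C, evAt_X_self, evAt_X_succ le_rfl]
  linear_combination -h2 + (X q - C t) * evAt t q (divDiff q f) * h3

end

section

variable {K : Type*} [Field K] {β : K} {G : (ℕ → K) → Equiv.Perm ℕ → MvPolynomial ℕ K}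
  (hG : GrothFamily β G) {t : ℕ → K} (ht : ∀ j, 1 + β * t j ≠ 0)

include hG ht

theorem groth_descent {w : Equiv.Perm ℕ} {i : ℕ} (h : w (i + 1) < w i) :
    G t (w * sTr i) = opR β (pOp β) i (G t w) := by
  apply mul_left_cancel₀ (X_sub_X_ne_zero (K := K) (Nat.succ_ne_self i).symm)
  have h1 := (hG t ht).2 w i h
  have h2 := divDiff_spec i (G t w)
  rw [h1, opR_apply, pOp_apply]
  change _ = (X i - X (i + 1)) * _
  rw [show rename ⇑(Equiv.swap i (i + 1)) (G t w) = sAct i (G t w) from rfl]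
  linear_combination -(1 + C β * X i) * h2

theorem groth_ascent {w : Equiv.Perm ℕ} {i : ℕ} (h : w i < w (i + 1)) :
    pOp β i (G t w) = 0 := by
  have := groth_descent hG ht (w := w * sTr i) (i := i) (by rwa [mul_sTr_left, mul_sTr_right])
  rw [mul_sTr_mul_sTr] at this
  rw [this, pOp_opR]

theorem groth_p_descent {w : Equiv.Perm ℕ} {i : ℕ} (h : w (i + 1) < w i) :
    pOp β i (G t w) = G t (w * sTr i) + C β * G t w := by
  rw [groth_descent hG ht h, opR_apply]
  ring

theorem groth_one : G t 1 = 1 := by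
  have := (hG t ht).1 0
  rw [inSn_zero.1 (inSn_revPerm 0)] at this
  simpa using this

theorem evAt_groth (c : K) {N : ℕ} {w : Equiv.Perm ℕ} (hw : InSn N w) :
    evAt c N (G t w) = G t w := by
  refine desc_induction (P := fun w => evAt c N (G t w) = G t w) le_rfl
    (fun w hw hd => ?_) (fun w hw i hi h ih => ?_) w hw
  · rw [eq_revPerm hw hd, (hG t ht).1 N, map_prod]
    refine Finset.prod_congr rfl fun i hi => ?_
    rw [map_prod]
    refine Finset.prod_congr rfl fun j hj => ?_
    rw [map_mul, map_sub, evAt_C, evAt_C, evAt_X_of_lt (Finset.mem_range.1 hi)]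
  · have := groth_descent hG ht (w := w * sTr i) (i := i) (by rwa [mul_sTr_left, mul_sTr_right])
    rw [mul_sTr_mul_sTr] at this
    rw [this, evAt_opR hi, ih]

theorem groth_ins_last {N : ℕ} {w : Equiv.Perm ℕ} (hw : InSn N w) :
    G t (ins N w) = chain (xOp β (t 0)) 0 N (G (fun i => t (i + 1)) w) := by
  refine desc_induction (P := fun w => G t (ins N w)
      = chain (xOp β (t 0)) 0 N (G (fun i => t (i + 1)) w)) le_rfl
    (fun w hw hd => ?_) (fun w hw i hi h ih => ?_) w hw
  · rw [eq_revPerm hw hd, ins_revPerm, (hG t ht).1, (hG _ fun j => ht (j + 1)).1, chain_xOp_apply,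
      ← Finset.prod_mul_distrib, Finset.prod_range_succ]
    simp only [Nat.add_sub_cancel, Nat.sub_self, Finset.range_zero, Finset.prod_empty, mul_one]
    refine Finset.prod_congr rfl fun i hi => ?_
    rw [Finset.mem_range] at hi
    rw [show N - i = N - 1 - i + 1 by omega, Finset.prod_range_succ', mul_comm]
  · have h1 := groth_descent hG ht (w := ins N (w * sTr i)) (i := i)
      (by rw [ins_of_lt _ (by omega), ins_of_lt _ (by omega), mul_sTr_left, mul_sTr_right]; omega)
    have h2 := groth_descent hG (fun j => ht (j + 1)) (w := w * sTr i) (i := i)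
      (by rwa [mul_sTr_left, mul_sTr_right])
    rw [ins_mul_sTr _ hi, mul_sTr_mul_sTr, ih] at h1
    rw [mul_sTr_mul_sTr] at h2
    have h3 := congrArg (fun g => g (G (fun i => t (i + 1)) (w * sTr i)))
      (commute_opR_left (β := β) (commute_p_chain_X (demazureRel β (ht 0)) hi)).eq
    simp only [Module.End.mul_apply] at h3
    rw [h1, h2, h3]

theorem groth_ins {N : ℕ} {w : Equiv.Perm ℕ} (hw : InSn N w) : ∀ d q : ℕ, q + d = N →
    G t (ins q w) = chain (xOp β (t 0)) 0 q
      (chain (fun i => opR β (pOp β) i * xOp β (t 0) i) q d (G (fun i => t (i + 1)) w))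
  | 0, q, h => by
    obtain rfl : q = N := h
    rw [groth_ins_last hG ht hw, chain_zero, Module.End.one_apply]
  | d + 1, q, h => by
    have h1 := groth_descent hG ht (w := ins (q + 1) w) (i := q)
      (by rw [ins_self, ins_of_lt _ (by omega)]; omega)
    rw [ins_succ_mul_sTr, groth_ins hw d (q + 1) (by omega)] at h1
    rw [h1, chain_succ_last, zero_add, chain_succ _ q d]
    have h3 := fun f => congrArg (fun g => g f)
      (commute_opR_left (β := β) (commute_chain_right (f := xOp β (t 0)) (a := 0) (n := q) fun j _ h2 =>
        (demazureRel β (ht 0)).commute_p_X (i := q) (Or.inl (by omega)))).eq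
    simp only [Module.End.mul_apply] at h3 ⊢
    rw [h3]

theorem eOp_groth_ins (q : ℕ) {w : Equiv.Perm ℕ} (hw : FinPerm w) :
    eOp (t 0) (G t (ins q w)) = if q = 0 then G (fun i => t (i + 1)) w else 0 := by
  obtain ⟨N, hN⟩ := hw
  have hN' : InSn (N + q) w := fun j hj => hN j (by omega)
  rw [groth_ins hG ht hN' N q (by omega)]
  split_ifs with h
  · subst h
    have key : ∀ (d q : ℕ) (f : MvPolynomial ℕ K),
        evAt (t 0) q (chain (fun i => opR β (pOp β) i * xOp β (t 0) i) q d f)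
          = evAt (t 0) (q + d) f := by
      intro d
      induction d with
      | zero => intro q f; rfl
      | succ d ih =>
        intro q f
        rw [chain_succ, Module.End.mul_apply, Module.End.mul_apply, evAt_opR_xOp (ht 0), ih,
          show q + 1 + d = q + (d + 1) by omega]
    rw [chain_zero, Module.End.one_apply, ← evAt_zero, key,
      evAt_groth hG (fun j => ht (j + 1)) _ (by rw [zero_add]; exact hN)]
  · obtain ⟨q, rfl⟩ : ∃ q', q = q' + 1 := ⟨q - 1, by omega⟩
    rw [chain_succ, Module.End.mul_apply, xOp_apply, map_mul, map_mul, map_sub, eOp_X_zero, eOp_C,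
      eOp_C, sub_self, mul_zero, zero_mul]

theorem eOp_chain_groth (s : ℕ) {w : Equiv.Perm ℕ} (hw : FinPerm w) :
    eOp (t 0) (chain (pOp β) 0 s (G t w))
      = if w s = 0 then G (fun i => t (i + 1)) (del w) else 0 := by
  induction s generalizing w with
  | zero =>
    have := eOp_groth_ins hG ht (w⁻¹ 0) hw.del
    rw [ins_del] at this
    rw [chain_zero, Module.End.one_apply, this]
    simp only [Equiv.Perm.inv_eq_iff_eq, eq_comm (a := 0)]
  | succ s ih =>
    rw [chain_succ_last, Module.End.mul_apply, zero_add]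
    rcases lt_or_gt_of_ne (perm_ne w (Nat.succ_ne_self s).symm) with h | h
    · rw [groth_ascent hG ht h, map_zero, map_zero, if_neg (Nat.ne_zero_of_lt h)]
    · rw [groth_p_descent hG ht h, map_add, map_add, ih hw.mul_sTr, ← smul_eq_C_mul, map_smul,
        map_smul, ih hw, if_neg (c := w s = 0) (by omega), smul_zero, add_zero, mul_sTr_left]
      split_ifs with h1
      · rw [del_mul_sTr h1]
      · rfl

theorem groth_ins_of_ascending {q : ℕ} {w : Equiv.Perm ℕ} (hw : FinPerm w)
    (h : ∀ i, q ≤ i → w i < w (i + 1)) :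
    G t (ins q w) = chain (xOp β (t 0)) 0 q (G (fun i => t (i + 1)) w) := by
  obtain ⟨N, hN⟩ := hw
  have hN' : InSn (N + q) w := fun j hj => hN j (by omega)
  rw [groth_ins hG ht hN' N q (by omega)]
  congr 1
  have key : ∀ (d a : ℕ), q ≤ a →
      chain (fun i => opR β (pOp β) i * xOp β (t 0) i) a d (G (fun i => t (i + 1)) w)
        = G (fun i => t (i + 1)) w := by
    intro d
    induction d with
    | zero => intro a _; rfl
    | succ d ih =>
      intro a ha
      rw [chain_succ, Module.End.mul_apply, ih (a + 1) (by omega),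
        (demazureRel β (ht 0)).opR_mul_X, opQ, LinearMap.add_apply, Module.End.mul_apply,
        groth_ascent hG (fun j => ht (j + 1)) (h a ha), map_zero, add_zero, Module.End.one_apply]
  exact key N q le_rfl

end

section

variable {K : Type*} [Field K] {β : K} {G : (ℕ → K) → Equiv.Perm ℕ → MvPolynomial ℕ K}
  (hG : GrothFamily β G)

include hG

open Classical in
theorem aeval_groth : ∀ (N : ℕ) {t : ℕ → K} (_ : ∀ j, 1 + β * t j ≠ 0) {w : Equiv.Perm ℕ},
    InSn N w → aeval t (G t w) = if w = 1 then 1 else 0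
  | 0, t, ht, w, hw => by
    obtain rfl := inSn_zero.1 hw
    rw [groth_one hG ht, map_one, if_pos rfl]
  | N + 1, t, ht, w, hw => by
    have h1 : (aeval fun i => t (i + 1)).comp (eOp (t 0)) = aeval (R := K) t := by
      apply algHom_ext
      intro j
      rw [AlgHom.comp_apply, aeval_X]
      rcases j with _ | j
      · rw [eOp_X_zero, aeval_C, Algebra.algebraMap_self_apply]
      · rw [eOp_X_succ, aeval_X]
    have h2 := eOp_chain_groth hG ht 0 hw.finPerm
    rw [chain_zero, Module.End.one_apply] at h2
    rw [← h1, AlgHom.comp_apply, h2]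
    by_cases h3 : w 0 = 0
    · rw [if_pos h3, aeval_groth N (fun j => ht (j + 1)) hw.del]
      have h4 : w⁻¹ 0 = 0 := by rw [Equiv.Perm.inv_eq_iff_eq, h3]
      congr 1
      apply propext
      constructor
      · intro h5
        have : InSn 1 w := inSn_of_del (by rw [h5]; exact inSn_zero.2 rfl) (by omega)
        rw [← inSn_zero]
        intro j _
        rcases j with _ | j
        · exact h3
        · exact this _ (by omega)
      · rintro rfl
        exact inSn_zero.1 ((inSn_zero.2 rfl : InSn 0 (1 : Equiv.Perm ℕ)).mono (Nat.zero_le 1)).del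
    · rw [if_neg h3, map_zero, if_neg]
      rintro rfl
      exact h3 rfl

end

open DemazureRel

/-- The window `θ` in the context `(R, h)` records the inverse of the permutation `w ∈ S_m`. -/
def WinMatch (m : ℕ) (R : Finset ℕ) (h : ℕ) (θ : ℕ → ℕ) (w : Equiv.Perm ℕ) : Prop :=
  (∀ j < m, (θ j = 0 ∧ w⁻¹ j < h) ∨ (θ j ∈ R ∧ w⁻¹ j = h + below R (θ j))) ∧ InSn m w

theorem below_lt_card {R : Finset ℕ} {e : ℕ} (he : e ∈ R) : below R e < R.card := by
  apply Finset.card_lt_card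
  rw [Finset.ssubset_iff_of_subset (Finset.filter_subset _ _)]
  exact ⟨e, he, by simp⟩

theorem winMatch_succ {m h e : ℕ} {R : Finset ℕ} {θ : ℕ → ℕ} {w : Equiv.Perm ℕ} (h0 : 0 ∉ R)
    (hc : R.card + h = m + 1) (he : θ 0 = e) (ha : Avail R h e)
    (hq : w⁻¹ 0 = if e = 0 then 0 else h + below R e) :
    WinMatch m (R.erase e) (hid h e) (fun i => θ (i + 1)) (del w) ↔ WinMatch (m + 1) R h θ w := by
  have key : ∀ j, ((θ (j + 1) = 0 ∧ w⁻¹ (j + 1) < h)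
        ∨ (θ (j + 1) ∈ R ∧ w⁻¹ (j + 1) = h + below R (θ (j + 1)))) ↔
      ((θ (j + 1) = 0 ∧ (del w)⁻¹ j < hid h e)
        ∨ (θ (j + 1) ∈ R.erase e ∧ (del w)⁻¹ j = hid h e + below (R.erase e) (θ (j + 1)))) := by
    intro j
    have hne : w⁻¹ (j + 1) ≠ w⁻¹ 0 := perm_ne w⁻¹ (Nat.succ_ne_zero j)
    rw [del_inv_apply]
    generalize w⁻¹ (j + 1) = p at *
    generalize θ (j + 1) = x
    rw [hq] at hne ⊢
    by_cases he0 : e = 0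
    · subst he0
      rw [Finset.erase_eq_of_notMem h0]
      simp only [Avail, hid, if_true] at *
      by_cases hx : x ∈ R
      · have : x ≠ 0 := fun h1 => h0 (h1 ▸ hx)
        simp only [this, hx, false_and, true_and, false_or]
        split_ifs <;> omega
      · simp only [hx, false_and, or_false]
        split_ifs <;> omega
    · simp only [Avail, hid, he0, if_false] at *
      by_cases hx : x ∈ R
      · have hx0 : x ≠ 0 := fun h1 => h0 (h1 ▸ hx)
        simp only [hx0, hx, false_and, true_and, false_or, Finset.mem_erase, and_true]
        rcases lt_trichotomy x e with h1 | h1 | h1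
        · rw [below_erase_of_le h1.le]
          have := below_lt hx h1
          split_ifs <;> omega
        · subst h1
          split_ifs <;> omega
        · have h2 := below_erase_of_lt ha h1
          have := below_lt ha h1
          split_ifs <;> omega
      · simp only [hx, Finset.mem_erase, and_false, false_and, or_false]
        split_ifs <;> omega
  have hle : w⁻¹ 0 ≤ m := by
    rw [hq]
    split_ifs with h1
    · omega
    · rw [Avail, if_neg h1] at ha
      have := below_lt_card ha
      omega
  constructor
  · rintro ⟨h1, h2⟩
    refine ⟨fun j hj => ?_, inSn_of_del h2 hle⟩
    rcases j with _ | j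
    · rw [hq, he]
      by_cases h3 : e = 0
      · rw [Avail, if_pos h3] at ha
        exact Or.inl ⟨h3, by rwa [if_pos h3]⟩
      · rw [Avail, if_neg h3] at ha
        exact Or.inr ⟨ha, by rw [if_neg h3]⟩
    · exact (key j).2 (h1 j (by omega))
  · rintro ⟨h1, h2⟩
    exact ⟨fun j hj => (key j).1 (h1 (j + 1) (by omega)), h2.del⟩

section

variable {K : Type*} [Field K] {β : K} {G : (ℕ → K) → Equiv.Perm ℕ → MvPolynomial ℕ K}
  (hG : GrothFamily β G)

include hG

open Classical in
theorem Phi_groth {k : ℕ} : ∀ (m : ℕ) {t : ℕ → K} (_ : ∀ j, 1 + β * t j ≠ 0) {R : Finset ℕ} {h : ℕ}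
    {θ : ℕ → ℕ} {w : Equiv.Perm ℕ}, FinPerm w → 0 ∉ R → (∀ e ∈ R, k < e ∨ h = 0) →
    R.card + h = m → (∀ i, i + 1 < h → w i < w (i + 1)) →
    Phi β k m t R h θ (G t w) = if WinMatch m R h θ w then 1 else 0
  | 0, t, ht, R, h, θ, w, hw, h0, hR, hc, hinc => by
    obtain ⟨N, hN⟩ := hw
    rw [Phi, AlgHom.toLinearMap_apply, aeval_groth hG N ht hN]
    congr 1
    simp only [WinMatch, Nat.not_lt_zero, false_imp_iff, implies_true, true_and, inSn_zero]
  | m + 1, t, ht, R, h, θ, w, hw, h0, hR, hc, hinc => by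
    by_cases ha : Avail R h (θ 0)
    · obtain ⟨e, he⟩ : ∃ e, θ 0 = e := ⟨_, rfl⟩
      rw [Phi_succ_of_avail _ _ ha]
      rw [he] at ha ⊢
      obtain ⟨q, hq⟩ : ∃ q, q = if e = 0 then 0 else h + below R e := ⟨_, rfl⟩
      have hB : opB β k (pOp β) (eOp (t 0)).toLinearMap R h e (G t w)
          = if w q = 0 then G (fun i => t (i + 1)) (del w) else 0 := by
        rw [← eOp_chain_groth hG ht q hw, hq]
        by_cases he0 : e = 0
        · rw [he0, opB_zero, if_pos rfl]
          rfl
        · rw [if_neg he0]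
          rw [Avail, if_neg he0] at ha
          by_cases hk : e ≤ k
          · have hh : h = 0 := by
              rcases hR e ha with h1 | h1
              · omega
              · exact h1
            rw [opB, if_neg he0, if_pos hk, hh, chain_zero, one_mul, zero_add]
            rfl
          · rw [opB, if_neg he0, if_neg hk]
            rfl
      rw [hB]
      by_cases h1 : w q = 0
      · have h2 : w⁻¹ 0 = q := by rw [Equiv.Perm.inv_eq_iff_eq, h1]
        rw [if_pos h1, Phi_groth m (fun j => ht (j + 1)) hw.del
          (fun h3 => h0 (Finset.mem_of_mem_erase h3))]
        · simp only [winMatch_succ h0 hc he ha (h2.trans hq)]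
        · intro e' he'
          rcases hR e' (Finset.mem_of_mem_erase he') with h3 | h3
          · exact Or.inl h3
          · right; unfold hid; split_ifs <;> omega
        · by_cases he0 : e = 0
          · rw [he0, Finset.erase_eq_of_notMem h0, hid, if_pos rfl]
            rw [Avail, if_pos he0] at ha
            omega
          · rw [Avail, if_neg he0] at ha
            rw [Finset.card_erase_of_mem ha, hid, if_neg he0]
            have := Finset.card_pos.2 ⟨e, ha⟩
            omega
        · intro i hi
          by_cases he0 : e = 0
          · rw [hid, if_pos he0] at hi
            rw [if_pos he0] at hq
            have := del_of_le (w := w) (i := i) (by omega)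
            have := del_of_le (w := w) (i := i + 1) (by omega)
            have := hinc (i + 1) (by omega)
            omega
          · rw [hid, if_neg he0] at hi
            rw [if_neg he0] at hq
            have := del_of_lt (w := w) (i := i) (by omega)
            have := del_of_lt (w := w) (i := i + 1) (by omega)
            have := hinc i (by omega)
            omega
      · rw [if_neg h1, map_zero, if_neg]
        rintro ⟨h2, -⟩
        apply h1
        rcases h2 0 (by omega) with ⟨h3, h4⟩ | ⟨h3, h4⟩
        · rw [hq, if_pos (he.symm.trans h3)]
          have key : ∀ i, i < h → w 0 ≤ w i := by
            intro i
            induction i with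
            | zero => intro _; exact le_rfl
            | succ i ih => intro hi; exact (ih (by omega)).trans (hinc i hi).le
          have := key _ h4
          rw [perm_apply_inv] at this
          omega
        · have he0 : e ≠ 0 := by
            rintro rfl
            exact h0 (he ▸ h3)
          rw [hq, if_neg he0, ← he, ← h4, perm_apply_inv]
    · rw [Phi_succ_of_not_avail _ _ ha, if_neg]
      rintro ⟨h2, -⟩
      apply ha
      unfold Avail
      rcases h2 0 (by omega) with ⟨h3, h4⟩ | ⟨h3, h4⟩
      · rw [if_pos h3]; omega
      · have he0 : θ 0 ≠ 0 := fun h5 => h0 (h5 ▸ h3)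
        rwa [if_neg he0]

end

theorem below_Ioc {a n e : ℕ} (h2 : e ≤ n) : below (Finset.Ioc a n) e = e - a - 1 := by
  have : (Finset.Ioc a n).filter (· < e) = Finset.Ioo a e := by
    ext x; simp only [Finset.mem_filter, Finset.mem_Ioc, Finset.mem_Ioo]; omega
  rw [below, this, Nat.card_Ioo]

theorem winMatch_eta {n : ℕ} {w w' : Equiv.Perm ℕ} (hw : InSn n w) :
    WinMatch n (Finset.Ioc 0 n) 0 (etaLab w) w' ↔ w' = w := by
  have hb : ∀ j < n, below (Finset.Ioc 0 n) (etaLab w j) = w⁻¹ j := by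
    intro j hj
    have := hw.inv.lt hj
    rw [etaLab, below_Ioc (by omega)]
    omega
  constructor
  · rintro ⟨h1, h2⟩
    rw [← inv_inj]
    refine Equiv.ext fun j => ?_
    by_cases hj : j < n
    · rcases h1 j hj with ⟨h3, h4⟩ | ⟨h3, h4⟩
      · omega
      · rw [h4, hb j hj, zero_add]
    · rw [h2.inv j (by omega), hw.inv j (by omega)]
  · rintro rfl
    refine ⟨fun j hj => Or.inr ⟨?_, ?_⟩, hw⟩
    · have := hw.inv.lt hj
      rw [Finset.mem_Ioc, etaLab]; omega
    · rw [hb j hj, zero_add]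

theorem winMatch_theta {n k : ℕ} {θ : ℕ → ℕ} {v : Equiv.Perm ℕ} (hv : InSn n v) :
    WinMatch n (Finset.Ioc k n) k θ v ↔ ∀ j < n, θ j = thetaLab k v j := by
  rw [WinMatch, and_iff_left hv]
  refine forall₂_congr fun j hj => ?_
  have hlt := hv.inv.lt hj
  rw [thetaLab, Finset.mem_Ioc]
  constructor
  · rintro (⟨h3, h4⟩ | ⟨h3, h4⟩)
    · rw [if_neg (by omega), h3]
    · rw [below_Ioc h3.2] at h4
      rw [if_pos (by omega)]
      omega
  · intro h1
    split_ifs at h1 with h2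
    · refine Or.inr ⟨by omega, ?_⟩
      rw [below_Ioc (by omega)]
      omega
    · exact Or.inl ⟨h1, by omega⟩

section

variable {K : Type*} [Field K] {β : K} {G : (ℕ → K) → Equiv.Perm ℕ → MvPolynomial ℕ K}
  (hG : GrothFamily β G)

include hG

theorem structConst_eq_Phi {c : (ℕ → K) → (ℕ → K) → Equiv.Perm ℕ → Equiv.Perm ℕ → Equiv.Perm ℕ → K}
    (hc : StructConsts β G c) (k : ℕ) {t y : ℕ → K} (ht : ∀ j, 1 + β * t j ≠ 0)
    (hy : ∀ j, 1 + β * y j ≠ 0) {n : ℕ} {u v w : Equiv.Perm ℕ} (hu : FinPerm u) (hv : FinPerm v)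
    (hw : InSn n w) :
    c t y u v w = Phi β k n t (Finset.Ioc 0 n) 0 (etaLab w) (G y u * G t v) := by
  classical
  obtain ⟨h1, h2, h3⟩ := hc t y ht hy u v hu hv
  have hsub : (Function.support fun w' => C (c t y u v w') * G t w') ⊆ h1.toFinset := by
    intro w' hw'
    rw [Set.Finite.coe_toFinset]
    intro h4
    exact hw' (by simp [h4])
  rw [h3, finsum_eq_sum_of_support_subset _ hsub, map_sum]
  have key : ∀ w', Phi β k n t (Finset.Ioc 0 n) 0 (etaLab w) (C (c t y u v w') * G t w')
      = if w' = w then c t y u v w' else 0 := by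
    intro w'
    by_cases hf : FinPerm w'
    · rw [← smul_eq_C_mul, map_smul, Phi_groth hG n ht hf (by simp) (fun _ _ => Or.inr rfl) (by simp)
        (fun i hi => by omega)]
      simp only [winMatch_eta hw, smul_eq_mul, mul_ite, mul_one, mul_zero]
    · rw [h2 w' hf, C_0, zero_mul, map_zero, ite_self]
  simp only [key]
  rw [Finset.sum_ite_eq']
  split_ifs with h4
  · rfl
  · rw [Set.Finite.mem_toFinset, Set.mem_ofPred_eq, not_not] at h4
    exact h4

theorem groth_dominant : ∀ (n k : ℕ) {y : ℕ → K} (_ : ∀ j, 1 + β * y j ≠ 0) {u : Equiv.Perm ℕ}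
    {a : ℕ → ℕ} {F : ℕ → MvPolynomial ℕ K}, InSn n u →
    (∀ i, i + 1 < k → u (i + 1) < u i) → (∀ i, k ≤ i → u i < u (i + 1)) → a 0 = k →
    (∀ m < n, (kappaLab k u m = 0 ∧ a (m + 1) = a m)
      ∨ (kappaLab k u m = a m ∧ a m = a (m + 1) + 1)) →
    (∀ m < n, F (m + 1) = chain (xOp β (y m)) 0 (a (m + 1)) (F m)) →
    F n = G y u * F 0
  | 0, k, y, hy, u, a, F, hu, _, _, _, _, _ => by
    rw [inSn_zero.1 hu, groth_one hG hy, one_mul]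
  | n + 1, k, y, hy, u, a, F, hu, hdec, hinc, ha, hκ, hF => by
    have hp : u⁻¹ 0 = a 1 := by
      have h0 := hκ 0 (by omega)
      rw [kappaLab, zero_add] at h0
      split_ifs at h0 with h1
      · rcases h0 with ⟨⟨⟩, _⟩ | h0; omega
      · have : a 1 = k := by omega
        rw [this]
        by_contra h2
        have h3 := hinc (u⁻¹ 0 - 1) (by omega)
        rw [show u⁻¹ 0 - 1 + 1 = u⁻¹ 0 by omega, perm_apply_inv] at h3
        omega
    have ha1 : a 1 = k ∨ a 1 + 1 = k := by
      have := hκ 0 (by omega)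
      rw [zero_add] at this
      omega
    have hdinc : ∀ i, a 1 ≤ i → del u i < del u (i + 1) := by
      intro i hi
      have := del_of_le (w := u) (i := i) (by omega)
      have := del_of_le (w := u) (i := i + 1) (by omega)
      have := hinc (i + 1) (by omega)
      omega
    have h1 := groth_ins_of_ascending hG hy (q := a 1) (w := del u) hu.finPerm.del hdinc
    rw [← hp, ins_del, hp] at h1
    have h2 := groth_dominant n (a 1) (fun j => hy (j + 1)) (u := del u) (a := fun m => a (m + 1))
      (F := fun m => F (m + 1)) hu.del ?_ hdinc rfl ?_ (fun m hm => hF (m + 1) (by omega))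
    · simp only [zero_add] at h2
      rw [h2, h1, hF 0 (by omega), zero_add, mul_comm, ← chain_xOp_mul, ← chain_xOp_mul, mul_comm]
    · intro i hi
      have := del_of_lt (w := u) (i := i) (by omega)
      have := del_of_lt (w := u) (i := i + 1) (by omega)
      have := hdec i (by omega)
      omega
    · intro m hm
      have h3 : kappaLab (a 1) (del u) m = kappaLab k u (m + 1) := by
        have hne : u⁻¹ (m + 1) ≠ u⁻¹ 0 := perm_ne u⁻¹ (Nat.succ_ne_zero m)
        unfold kappaLab
        rw [del_inv_apply, hp]
        rw [hp] at hne
        split_ifs <;> omega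
      rw [h3]
      exact hκ (m + 1) (by omega)

end

open DemazureRel

theorem card_win (s : ℕ → ℕ) : ∀ a n : ℕ, (win s a n).card = n
  | _, 0 => rfl
  | a, n + 1 => by rw [win, Multiset.card_cons, card_win s (a + 1) n]

theorem nodup_win {s : ℕ → ℕ} : ∀ {a n : ℕ},
    (∀ i j, a ≤ i → i < j → j < a + n → s i ≠ s j) → (win s a n).Nodup
  | _, 0, _ => Multiset.nodup_zero
  | a, n + 1, h => by
    rw [win, Multiset.nodup_cons, mem_win]
    refine ⟨?_, nodup_win fun i j h1 h2 h3 => h i j (by omega) h2 (by omega)⟩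
    rintro ⟨i, h1, h2, h3⟩
    exact h a i le_rfl (by omega) (by omega) h3.symm

/-- The labels on the top and right boundary, read from the top left to the bottom right corner. -/
def topRight (n k : ℕ) (u v : Equiv.Perm ℕ) (i : ℕ) : ℕ :=
  if i < n then thetaLab k v i else kappaLab k u (i - n)

/-- The labels on the left and bottom boundary, read from the top left to the bottom right corner. -/
def leftBottom (n : ℕ) (w : Equiv.Perm ℕ) (i : ℕ) : ℕ :=
  if i < n then 0 else etaLab w (i - n)

theorem win_leftBottom {n : ℕ} {w : Equiv.Perm ℕ} (hw : InSn n w) :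
    win (leftBottom n w) n n = (Finset.Ioc 0 n).val := by
  have h1 : ∀ i, leftBottom n w (n + i) = w⁻¹ i + 1 := by
    intro i
    rw [leftBottom, if_neg (by omega), Nat.add_sub_cancel_left, etaLab]
  have h2 : (win (leftBottom n w) n n).Nodup := by
    apply nodup_win
    intro i j hi hij hj h
    obtain ⟨i, rfl⟩ := Nat.exists_eq_add_of_le hi
    obtain ⟨j, rfl⟩ := Nat.exists_eq_add_of_le (hi.trans hij.le)
    rw [h1, h1] at h
    exact perm_ne w⁻¹ (by omega : i ≠ j) (by omega)
  refine Multiset.eq_of_le_of_card_le ((Multiset.le_iff_subset h2).2 ?_) ?_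
  · intro e he
    rw [mem_win] at he
    obtain ⟨i, hi, hj, rfl⟩ := he
    obtain ⟨i, rfl⟩ := Nat.exists_eq_add_of_le hi
    have := hw.inv.lt (i := i) (by omega)
    rw [h1, Finset.mem_val, Finset.mem_Ioc]
    omega
  · rw [card_win, Finset.card_val, Nat.card_Ioc, Nat.sub_zero]

theorem lt_of_forall_succ_lt {u : Equiv.Perm ℕ} {k : ℕ} (h : ∀ i, i + 1 < k → u (i + 1) < u i)
    {i : ℕ} : ∀ {j : ℕ}, i < j → j < k → u j < u i
  | j + 1, h1, h2 => by
    rcases Nat.lt_succ_iff_lt_or_eq.1 h1 with h3 | rfl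
    · exact (h j h2).trans (lt_of_forall_succ_lt h h3 (by omega))
    · exact h i h2

/-- The number of the positions below `k` at which `u` takes a value at least `m`. -/
def aboveCount (k : ℕ) (u : Equiv.Perm ℕ) (m : ℕ) : ℕ :=
  ((Finset.range k).filter fun j => m ≤ u j).card

theorem aboveCount_le (k : ℕ) (u : Equiv.Perm ℕ) (m : ℕ) : aboveCount k u m ≤ k :=
  (Finset.card_filter_le _ _).trans (Finset.card_range k).le

theorem aboveCount_zero (k : ℕ) (u : Equiv.Perm ℕ) : aboveCount k u 0 = k := by
  simp [aboveCount]

theorem aboveCount_eq_zero {n k : ℕ} (hkn : k ≤ n) {u : Equiv.Perm ℕ} (hu : InSn n u) :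
    aboveCount k u n = 0 := by
  rw [aboveCount, Finset.card_eq_zero, Finset.filter_eq_empty_iff]
  intro j hj
  have := hu.lt (i := j) (by rw [Finset.mem_range] at hj; omega)
  omega

theorem kappaLab_aboveCount {k : ℕ} {u : Equiv.Perm ℕ} (h : ∀ i, i + 1 < k → u (i + 1) < u i)
    (m : ℕ) : (kappaLab k u m = 0 ∧ aboveCount k u (m + 1) = aboveCount k u m)
      ∨ (kappaLab k u m = aboveCount k u m ∧ aboveCount k u m = aboveCount k u (m + 1) + 1) := by
  have hanti : ∀ {i j}, i < j → j < k → u j < u i := lt_of_forall_succ_lt h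
  obtain ⟨q, hq⟩ : ∃ q, q = u⁻¹ m := ⟨_, rfl⟩
  have hm : u q = m := by rw [hq, perm_apply_inv]
  rw [kappaLab, ← hq]
  by_cases hqk : q < k
  · right
    have h1 : aboveCount k u m = q + 1 := by
      rw [aboveCount, ← Finset.card_range (q + 1)]
      congr 1
      ext j
      rw [Finset.mem_filter, Finset.mem_range, Finset.mem_range]
      constructor
      · rintro ⟨h1, h2⟩
        by_contra h3
        have := hanti (i := q) (j := j) (by omega) h1
        omega
      · intro h1
        refine ⟨by omega, ?_⟩
        rcases Nat.lt_succ_iff_lt_or_eq.1 h1 with h3 | rfl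
        · have := hanti h3 hqk
          omega
        · omega
    have h2 : aboveCount k u (m + 1) = q := by
      rw [aboveCount, ← Finset.card_range q]
      congr 1
      ext j
      rw [Finset.mem_filter, Finset.mem_range, Finset.mem_range]
      constructor
      · rintro ⟨h1, h2⟩
        by_contra h3
        rcases Nat.lt_or_eq_of_le (not_lt.1 h3) with h3 | rfl
        · have := hanti h3 h1
          omega
        · omega
      · intro h1
        refine ⟨by omega, ?_⟩
        have := hanti h1 hqk
        omega
    rw [if_pos hqk]
    omega
  · left
    refine ⟨if_neg hqk, ?_⟩
    rw [aboveCount, aboveCount]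
    congr 1
    apply Finset.filter_congr
    intro j hj
    rw [Finset.mem_range] at hj
    have : u j ≠ u q := perm_ne u (by omega)
    omega

section

variable {K : Type*} [Field K] {β : K} {G : (ℕ → K) → Equiv.Perm ℕ → MvPolynomial ℕ K}
  (hG : GrothFamily β G)

include hG

open Classical in
/-- The partition function of the grid is a structure constant when `u` is dominant. -/
theorem gridOp_of_dominant
    {c : (ℕ → K) → (ℕ → K) → Equiv.Perm ℕ → Equiv.Perm ℕ → Equiv.Perm ℕ → K}
    (hc : StructConsts β G c) {t y : ℕ → K} (ht : ∀ j, 1 + β * t j ≠ 0)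
    (hy : ∀ j, 1 + β * y j ≠ 0) {n k : ℕ} (hkn : k ≤ n) {u v w : Equiv.Perm ℕ} (hu : InSn n u)
    (hv : InSn n v) (hw : InSn n w) (hdec : ∀ i, i + 1 < k → u (i + 1) < u i)
    (hinc : ∀ i, k ≤ i → u i < u (i + 1)) (hvinc : ∀ i, i + 1 < k → v i < v (i + 1)) :
    gridOp β k t y n n (fun s' => if ∀ i < n + n, s' i = topRight n k u v i then 1 else 0)
      (leftBottom n w) = c t y u v w := by
  let F : ℕ → MvPolynomial ℕ K := fun m => Nat.rec (G t v)
    (fun m f => chain (xOp β (y m)) 0 (aboveCount k u (m + 1)) f) m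
  have hF : ∀ m < n, F (m + 1) = chain (xOp β (y m)) 0 (aboveCount k u (m + 1)) (F m) :=
    fun _ _ => rfl
  have hFn : F n = G y u * G t v :=
    groth_dominant hG n k hy hu hdec hinc (aboveCount_zero k u) (fun m _ => kappaLab_aboveCount hdec m)
      hF
  have := (gridOp_base (β := β) (k := k) (t := t) hy (a := aboveCount k u) (κ := kappaLab k u) (F := F)
    (s0 := topRight n k u v) (fun m _ => aboveCount_le k u m) hkn
    (fun m _ => kappaLab_aboveCount hdec m)
    (fun m _ => by rw [topRight, if_neg (by omega), Nat.add_sub_cancel_left]) hF ?_ ?_ n le_rfl).2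
      (leftBottom n w)
  · rw [this.2 (fun i hi => by rw [leftBottom, if_pos hi]) (fun i h1 h2 => by omega) ?_, hFn,
      aboveCount_eq_zero hkn hu, structConst_eq_Phi hG hc k ht hy hu.finPerm hv.finPerm hw]
    · congr 2
      funext i
      rw [leftBottom, if_neg (by omega), Nat.add_sub_cancel_left]
    · rw [aboveCount_eq_zero hkn hu, win_leftBottom hw, Multiset.replicate_zero, add_zero]
  · rw [aboveCount_zero]
    exact fun i hi => groth_ascent hG ht (hvinc i (by omega))
  · rw [aboveCount_zero]
    intro s _
    rw [show F 0 = G t v from rfl, Phi_groth hG n ht hv.finPerm (by simp)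
      (fun e he => Or.inl (Finset.mem_Ioc.1 he).1) (by simp; omega) hvinc]
    congr 1
    rw [winMatch_theta hv]
    refine propext (forall₂_congr fun j hj => ?_)
    rw [topRight, if_pos hj]

end

open DemazureRel

section

variable {K : Type*} [Field K] {β : K}

theorem opR_mul_of_pOp_eq_zero {i : ℕ} (f : MvPolynomial ℕ K) {g : MvPolynomial ℕ K}
    (h : pOp β i g = 0) : opR β (pOp β) i (f * g) = opR β (pOp β) i f * g := by
  rw [opR_apply, opR_apply, pOp_apply, pOp_apply, divDiff_mul]
  rw [pOp_apply] at h
  linear_combination sAct i f * h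

variable {G : (ℕ → K) → Equiv.Perm ℕ → MvPolynomial ℕ K} (hG : GrothFamily β G)

include hG

open Classical in
theorem Phi_eta_groth {t : ℕ → K} (ht : ∀ j, 1 + β * t j ≠ 0) (n k : ℕ) {w w' : Equiv.Perm ℕ}
    (hw : InSn n w) (hw' : FinPerm w') :
    Phi β k n t (Finset.Ioc 0 n) 0 (etaLab w) (G t w') = if w' = w then 1 else 0 := by
  rw [Phi_groth hG n ht hw' (by simp) (fun _ _ => Or.inr rfl) (by simp) (fun i hi => by omega)]
  simp only [winMatch_eta hw]

theorem Phi_eta_opR {t : ℕ → K} (ht : ∀ j, 1 + β * t j ≠ 0) {n : ℕ} (k : ℕ) {w w' : Equiv.Perm ℕ}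
    (hw : InSn n w) (hw' : FinPerm w') {i : ℕ} (hi : i + 1 < n) :
    Phi β k n t (Finset.Ioc 0 n) 0 (etaLab w) (opR β (pOp β) i (G t w'))
      = if w i < w (i + 1) then
          Phi β k n t (Finset.Ioc 0 n) 0 (etaLab (w * sTr i)) (G t w')
            - β * Phi β k n t (Finset.Ioc 0 n) 0 (etaLab w) (G t w')
        else 0 := by
  classical
  rw [Phi_eta_groth hG ht n k hw hw', Phi_eta_groth hG ht n k (hw.mul_sTr hi) hw']
  have hne : w' i ≠ w' (i + 1) := perm_ne w' (by omega)
  have hiff : w' * sTr i = w ↔ w' = w * sTr i :=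
    ⟨fun h => by rw [← h, mul_sTr_mul_sTr], fun h => by rw [h, mul_sTr_mul_sTr]⟩
  rcases hne.lt_or_gt with h | h
  · have h1 : w i < w (i + 1) → w' ≠ w * sTr i := by
      rintro h2 rfl
      rw [mul_sTr_left, mul_sTr_right] at h
      omega
    have h2 : ¬ w i < w (i + 1) → w' ≠ w := by
      rintro h2 rfl
      exact h2 h
    rw [opR_apply, groth_ascent hG ht h, zero_sub, map_neg, ← smul_eq_C_mul, map_smul,
      Phi_eta_groth hG ht n k hw hw', smul_eq_mul]
    by_cases h3 : w i < w (i + 1)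
    · rw [if_pos h3, if_neg (h1 h3), zero_sub]
    · rw [if_neg h3, if_neg (h2 h3), mul_zero, neg_zero]
  · have h1 : w i < w (i + 1) → w' ≠ w := by
      rintro h2 rfl
      omega
    have h2 : ¬ w i < w (i + 1) → w' ≠ w * sTr i := by
      rintro h2 rfl
      rw [mul_sTr_left, mul_sTr_right] at h
      exact h2 h
    rw [← groth_descent hG ht h, Phi_eta_groth hG ht n k hw hw'.mul_sTr]
    simp only [hiff]
    by_cases h3 : w i < w (i + 1)
    · rw [if_pos h3, if_neg (h1 h3), mul_zero, sub_zero]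
    · rw [if_neg h3, if_neg (h2 h3)]

/-- The recursion of the structure constants in the first permutation. -/
theorem structConst_of_ascent
    {c : (ℕ → K) → (ℕ → K) → Equiv.Perm ℕ → Equiv.Perm ℕ → Equiv.Perm ℕ → K}
    (hc : StructConsts β G c) {t y : ℕ → K} (ht : ∀ j, 1 + β * t j ≠ 0)
    (hy : ∀ j, 1 + β * y j ≠ 0) {n : ℕ} {u v w : Equiv.Perm ℕ} (hu : FinPerm u) (hv : FinPerm v)
    (hw : InSn n w) {i : ℕ} (hi : i + 1 < n) (hui : u i < u (i + 1)) (hvi : v i < v (i + 1)) :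
    c t y u v w = if w i < w (i + 1) then
      c t y (u * sTr i) v (w * sTr i) - β * c t y (u * sTr i) v w else 0 := by
  rw [structConst_eq_Phi hG hc 0 ht hy hu hv hw, structConst_eq_Phi hG hc 0 ht hy hu.mul_sTr hv hw,
    structConst_eq_Phi hG hc 0 ht hy hu.mul_sTr hv (hw.mul_sTr hi)]
  have h1 : G y u = opR β (pOp β) i (G y (u * sTr i)) := by
    rw [← groth_descent hG hy (by rwa [mul_sTr_left, mul_sTr_right]), mul_sTr_mul_sTr]
  rw [h1, ← opR_mul_of_pOp_eq_zero _ (groth_ascent hG ht hvi)]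
  obtain ⟨hfin, hz, hexp⟩ := hc t y ht hy (u * sTr i) v hu.mul_sTr hv
  have hsub : (Function.support fun w' => C (c t y (u * sTr i) v w') * G t w') ⊆ hfin.toFinset := by
    intro w' hw'
    rw [Set.Finite.coe_toFinset]
    intro h4
    exact hw' (by simp [h4])
  rw [hexp, finsum_eq_sum_of_support_subset _ hsub]
  have hterm : ∀ w' ∈ hfin.toFinset, FinPerm w' := by
    intro w' hw'
    by_contra h
    rw [Set.Finite.mem_toFinset] at hw'
    exact hw' (hz w' h)
  simp only [map_sum, ← smul_eq_C_mul, map_smul]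
  rw [Finset.sum_congr rfl fun w' hw' => by rw [Phi_eta_opR hG ht 0 hw (hterm w' hw') hi]]
  split_ifs
  · rw [Finset.mul_sum, ← Finset.sum_sub_distrib]
    refine Finset.sum_congr rfl fun w' _ => ?_
    simp only [smul_eq_mul]
    ring
  · simp

end

section

variable {K : Type*} [Field K] {β : K} {k : ℕ}

theorem keepWt_congr (x : K) {W S W' S' : ℕ} (h1 : W = 0 ↔ W' = 0) (h2 : S = 0 ↔ S' = 0)
    (h3 : W < S ↔ W' < S') (h4 : W = S ↔ W' = S') (h5 : W ≤ k ↔ W' ≤ k) (h6 : S ≤ k ↔ S' ≤ k) :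
    keepWt β k x W S = keepWt β k x W' S' := by
  unfold keepWt Lwt
  iterate 11 refine if_congr (by omega) rfl ?_
  rfl

theorem swapWt_congr (x : K) {W S W' S' : ℕ} (h1 : W = 0 ↔ W' = 0) (h2 : S = 0 ↔ S' = 0)
    (h3 : W < S ↔ W' < S') (h4 : W = S ↔ W' = S') (h5 : W ≤ k ↔ W' ≤ k) (h6 : S ≤ k ↔ S' ≤ k) :
    swapWt β k x W S = swapWt β k x W' S' := by
  unfold swapWt Lwt
  iterate 12 refine if_congr (by omega) rfl ?_
  rfl

theorem sTr_cases (a e : ℕ) : (e = a ∧ sTr a e = a + 1) ∨ (e = a + 1 ∧ sTr a e = a)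
    ∨ (e ≠ a ∧ e ≠ a + 1 ∧ sTr a e = e) := by
  by_cases h : e = a
  · exact Or.inl ⟨h, h ▸ sTr_left a⟩
  · by_cases h' : e = a + 1
    · exact Or.inr (Or.inl ⟨h', h' ▸ sTr_right a⟩)
    · exact Or.inr (Or.inr ⟨h, h', sTr_of_ne h h'⟩)

theorem keepWt_sTr {a : ℕ} (ha : a ≠ 0) (hak : a + 1 ≤ k) (x : K) {W S : ℕ}
    (h : ¬ ((W = a ∨ W = a + 1) ∧ (S = a ∨ S = a + 1))) :
    keepWt β k x (sTr a W) (sTr a S) = keepWt β k x W S := by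
  rcases sTr_cases a W with e1 | e1 | e1 <;> rcases sTr_cases a S with e2 | e2 | e2 <;>
    first | omega | skip
  all_goals apply keepWt_congr <;> omega

theorem swapWt_sTr {a : ℕ} (ha : a ≠ 0) (hak : a + 1 ≤ k) (x : K) {W S : ℕ}
    (h : ¬ ((W = a ∨ W = a + 1) ∧ (S = a ∨ S = a + 1))) :
    swapWt β k x (sTr a W) (sTr a S) = swapWt β k x W S := by
  rcases sTr_cases a W with e1 | e1 | e1 <;> rcases sTr_cases a S with e2 | e2 | e2 <;>
    first | omega | skip
  all_goals apply swapWt_congr <;> omega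

variable (β)

/-- The relation between the partition functions `χ`, `ω` of two boundary conditions differing by
the exchange of the labels `a` and `a + 1`. -/
def LabelExch (a : ℕ) (χ ω : (ℕ → ℕ) → K) : Prop :=
  ∀ (s : ℕ → ℕ) (p q : ℕ), (∀ j, s j = a ↔ j = p) → (∀ j, s j = a + 1 ↔ j = q) →
    (p < q → χ s = ω (sTr a ∘ s) - β * ω s) ∧ (q < p → χ s = 0)

variable {β}

theorem LabelExch.tile {a : ℕ} (ha : a ≠ 0) (hak : a + 1 ≤ k) {χ ω : (ℕ → ℕ) → K}
    (h : LabelExch β a χ ω) (x : K) (j : ℕ) :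
    LabelExch β a
      (fun s => keepWt β k x (s j) (s (j + 1)) * χ s
        + swapWt β k x (s j) (s (j + 1)) * χ (s ∘ Equiv.swap j (j + 1)))
      (fun s => keepWt β k x (s j) (s (j + 1)) * ω s
        + swapWt β k x (s j) (s (j + 1)) * ω (s ∘ Equiv.swap j (j + 1))) := by
  intro s p q hp hq
  have hsp : s p = a := (hp p).2 rfl
  have hsq : s q = a + 1 := (hq q).2 rfl
  have hswap : ∀ {b r : ℕ}, (∀ l, s l = b ↔ l = r) →
      ∀ l, (s ∘ Equiv.swap j (j + 1)) l = b ↔ l = sTr j r := by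
    intro b r hr l
    rw [Function.comp_apply, hr, ← sTr]
    constructor
    · rintro rfl
      rw [← Equiv.Perm.mul_apply, sTr_mul_sTr, Equiv.Perm.one_apply]
    · rintro rfl
      rw [← Equiv.Perm.mul_apply, sTr_mul_sTr, Equiv.Perm.one_apply]
  have h' := h (s ∘ Equiv.swap j (j + 1)) _ _ (hswap hp) (hswap hq)
  have h0 := h s p q hp hq
  simp only [Function.comp_apply]
  have hpj := sTr_cases j p
  have hqj := sTr_cases j q
  by_cases hc1 : p = j ∧ q = j + 1
  · obtain ⟨rfl, rfl⟩ := hc1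
    refine ⟨fun _ => ?_, fun h1 => by omega⟩
    rw [h'.2 (by omega), hsp, hsq, sTr_left, sTr_right, keepWt_eq_zero _ _ _ ha (by omega) (by omega)
      (by omega), swapWt_of_lt _ _ _ ha (by omega), keepWt_eq_beta _ _ _ ha (by omega) (by omega),
      swapWt_of_gt _ _ _ ha (by omega)]
    have : s ∘ Equiv.swap p (p + 1) = sTr a ∘ s := by
      funext l
      rw [Function.comp_apply, Function.comp_apply, ← sTr]
      rcases sTr_cases p l with ⟨rfl, h1⟩ | ⟨rfl, h1⟩ | ⟨h1, h2, h3⟩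
      · rw [h1, hsp, hsq, sTr_left]
      · rw [h1, hsp, hsq, sTr_right]
      · rw [h3, sTr_of_ne (fun h4 => h1 ((hp l).1 h4)) (fun h4 => h2 ((hq l).1 h4))]
    rw [this]
    ring
  · by_cases hc2 : q = j ∧ p = j + 1
    · obtain ⟨rfl, rfl⟩ := hc2
      refine ⟨fun h1 => by omega, fun h1 => ?_⟩
      rw [h0.2 h1, hsp, hsq, swapWt_of_gt _ _ _ ha (by omega)]
      ring
    · have p1 := hp j
      have p2 := hp (j + 1)
      have q1 := hq j
      have q2 := hq (j + 1)
      have hne : ¬ ((s j = a ∨ s j = a + 1) ∧ (s (j + 1) = a ∨ s (j + 1) = a + 1)) := by omega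
      rw [keepWt_sTr ha hak x hne, swapWt_sTr ha hak x hne]
      constructor
      · intro h1
        rw [h0.1 h1, h'.1 (by omega), Function.comp_assoc]
        ring
      · intro h1
        rw [h0.2 h1, h'.2 (by omega)]
        ring

theorem LabelExch.rowOp {a : ℕ} (ha : a ≠ 0) (hak : a + 1 ≤ k) {χ ω : (ℕ → ℕ) → K}
    (h : LabelExch β a χ ω) : ∀ (m j : ℕ) (x : ℕ → K),
    LabelExch β a (rowOp β k x j m χ) (rowOp β k x j m ω)
  | 0, _, _ => h
  | m + 1, j, x => (LabelExch.rowOp ha hak h m (j + 1) fun i => x (i + 1)).tile ha hak (x 0) j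

theorem LabelExch.gridOp {a : ℕ} (ha : a ≠ 0) (hak : a + 1 ≤ k) {χ ω : (ℕ → ℕ) → K}
    (h : LabelExch β a χ ω) (t y : ℕ → K) (n : ℕ) : ∀ m : ℕ,
    LabelExch β a (gridOp β k t y n m χ) (gridOp β k t y n m ω)
  | 0 => h
  | m + 1 => (LabelExch.gridOp ha hak h t y n m).rowOp ha hak n m _

theorem mul_sTr_inv_apply (w : Equiv.Perm ℕ) (i j : ℕ) : (w * sTr i)⁻¹ j = sTr i (w⁻¹ j) := by
  rw [mul_inv_rev, Equiv.Perm.mul_apply, sTr, Equiv.swap_inv]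

theorem sTr_succ (i e : ℕ) : sTr (i + 1) (e + 1) = sTr i e + 1 := by
  have h1 := sTr_cases (i + 1) (e + 1)
  have h2 := sTr_cases i e
  omega

theorem topRight_mul_sTr {n i : ℕ} (hi : i + 1 < k) (u v : Equiv.Perm ℕ) :
    topRight n k (u * sTr i) v = sTr (i + 1) ∘ topRight n k u v := by
  funext j
  rw [Function.comp_apply]
  unfold topRight
  by_cases hj : j < n
  · rw [if_pos hj, if_pos hj, thetaLab]
    split_ifs with h
    · rw [sTr_of_ne (by omega) (by omega)]
    · rw [sTr_of_ne (by omega) (by omega)]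
  · rw [if_neg hj, if_neg hj, kappaLab, kappaLab, mul_sTr_inv_apply]
    have := sTr_cases i (u⁻¹ (j - n))
    split_ifs with h1 h2
    · rw [sTr_succ]
    · omega
    · omega
    · rw [sTr_of_ne (by omega) (by omega)]

theorem leftBottom_mul_sTr (n i : ℕ) (w : Equiv.Perm ℕ) :
    leftBottom n (w * sTr i) = sTr (i + 1) ∘ leftBottom n w := by
  funext j
  rw [Function.comp_apply]
  unfold leftBottom
  split_ifs
  · rw [sTr_of_ne (by omega) (by omega)]
  · rw [etaLab, etaLab, mul_sTr_inv_apply, sTr_succ]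

theorem leftBottom_eq_iff (n i : ℕ) (w : Equiv.Perm ℕ) (j : ℕ) :
    leftBottom n w j = i + 1 ↔ j = n + w i := by
  unfold leftBottom etaLab
  by_cases h : j < n
  · rw [if_pos h]
    omega
  · rw [if_neg h]
    constructor
    · intro h1
      have h2 : w⁻¹ (j - n) = i := by omega
      rw [← h2, perm_apply_inv]
      omega
    · rintro rfl
      rw [Nat.add_sub_cancel_left, perm_inv_apply]

theorem topRight_apply {n : ℕ} {i : ℕ} (hi : i < k) (u v : Equiv.Perm ℕ) :
    topRight n k u v (n + u i) = i + 1 := by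
  rw [topRight, if_neg (by omega), Nat.add_sub_cancel_left, kappaLab, perm_inv_apply, if_pos hi]

open Classical in
theorem labelExch_topRight {n i : ℕ} (hkn : k ≤ n) (hi : i + 1 < k) {u v : Equiv.Perm ℕ}
    (hu : InSn n u) (hui : u i < u (i + 1)) :
    LabelExch β (i + 1)
      (fun s => if ∀ j < n + n, s j = topRight n k u v j then (1 : K) else 0)
      (fun s => if ∀ j < n + n, s j = topRight n k (u * sTr i) v j then (1 : K) else 0) := by
  intro s p q hp hq
  have hi1 := hu.lt (i := i) (by omega)
  have hi2 := hu.lt (i := i + 1) (by omega)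
  constructor
  · intro hpq
    have h1 : ¬ ∀ j < n + n, s j = topRight n k (u * sTr i) v j := by
      intro h
      have e1 := h (n + (u * sTr i) i) (by rw [mul_sTr_left]; omega)
      have e2 := h (n + (u * sTr i) (i + 1)) (by rw [mul_sTr_right]; omega)
      rw [topRight_apply (by omega), hp, mul_sTr_left] at e1
      rw [topRight_apply (by omega), hq, mul_sTr_right] at e2
      omega
    simp only [if_neg h1, mul_zero, sub_zero]
    congr 1
    refine propext (forall₂_congr fun j _ => ?_)
    rw [topRight_mul_sTr hi, Function.comp_apply, Function.comp_apply,
      (sTr (i + 1)).injective.eq_iff]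
  · intro hqp
    refine if_neg fun h => ?_
    have e1 := h (n + u i) (by omega)
    have e2 := h (n + u (i + 1)) (by omega)
    rw [topRight_apply (by omega), hp] at e1
    rw [topRight_apply (by omega), hq] at e2
    omega

end

section

variable {K : Type*} [Field K] {β : K} {G : (ℕ → K) → Equiv.Perm ℕ → MvPolynomial ℕ K}
  (hG : GrothFamily β G)

include hG

open Classical in
/-- The partition function of the grid is a structure constant. -/
theorem gridOp_eq_structConst
    {c : (ℕ → K) → (ℕ → K) → Equiv.Perm ℕ → Equiv.Perm ℕ → Equiv.Perm ℕ → K}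
    (hc : StructConsts β G c) {t y : ℕ → K} (ht : ∀ j, 1 + β * t j ≠ 0)
    (hy : ∀ j, 1 + β * y j ≠ 0) {n k : ℕ} (hkn : k ≤ n) {u v w : Equiv.Perm ℕ} (hu : InSn n u)
    (hv : InSn n v) (hw : InSn n w) (hsep : SepDesc k u v) :
    gridOp β k t y n n (fun s' => if ∀ i < n + n, s' i = topRight n k u v i then 1 else 0)
      (leftBottom n w) = c t y u v w := by
  have hvinc : ∀ i, i + 1 < k → v i < v (i + 1) := fun i hi =>
    lt_of_le_of_ne (hsep.2 i hi) (perm_ne v (by omega))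
  have huinc : ∀ i, k ≤ i → u i < u (i + 1) := fun i hi =>
    lt_of_le_of_ne (hsep.1 i hi) (perm_ne u (by omega))
  clear hsep
  revert huinc w
  refine desc_induction hkn (P := fun u => ∀ {w : Equiv.Perm ℕ}, InSn n w →
    (∀ i, k ≤ i → u i < u (i + 1)) → gridOp β k t y n n
      (fun s' => if ∀ i < n + n, s' i = topRight n k u v i then 1 else 0) (leftBottom n w)
        = c t y u v w) ?_ ?_ u hu
  · intro u hu hdec w hw hinc
    exact gridOp_of_dominant hG hc ht hy hkn hu hv hw hdec hinc hvinc
  · intro u hu i hi hui ih w hw hinc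
    have hinc' : ∀ j, k ≤ j → (u * sTr i) j < (u * sTr i) (j + 1) := by
      intro j hj
      rw [mul_sTr_of_ne _ (by omega) (by omega), mul_sTr_of_ne _ (by omega) (by omega)]
      exact hinc j hj
    have hex := (labelExch_topRight (K := K) (β := β) (v := v) hkn hi hu hui).gridOp (k := k)
      (by omega) (by omega) t y n n (leftBottom n w) _ _ (leftBottom_eq_iff n i w)
      (leftBottom_eq_iff n (i + 1) w)
    rw [structConst_of_ascent hG hc ht hy hu.finPerm hv.finPerm hw (by omega) hui (hvinc i hi)]
    split_ifs with h
    · rw [hex.1 (by omega), ← leftBottom_mul_sTr, ih hw hinc', ih (hw.mul_sTr (by omega)) hinc']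
    · have := perm_ne w (by omega : i ≠ i + 1)
      exact hex.2 (by omega)

end

section

variable {K : Type*} [Field K] {β : K} {k : ℕ}

theorem Lwt_eq_zero (x : K) {N E W S : ℕ} (h1 : ¬ (N = W ∧ E = S)) (h2 : ¬ (N = S ∧ E = W)) :
    Lwt β k x N E W S = 0 := by
  unfold Lwt
  repeat' rw [if_neg (by omega)]

theorem sum_Lwt_mul {M : ℕ} (x : K) (W S : Fin M) (g : Fin M → Fin M → K) :
    ∑ a : Fin M, ∑ b : Fin M, Lwt β k x a b W S * g a b
      = keepWt β k x W S * g W S + swapWt β k x W S * g S W := by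
  have key : ∀ a b : Fin M, Lwt β k x a b W S * g a b
      = (if a = W then if b = S then keepWt β k x W S * g W S else 0 else 0)
        + if a = S then if b = W then swapWt β k x W S * g S W else 0 else 0 := by
    intro a b
    by_cases hWS : W = S
    · subst hWS
      rw [swapWt_self, zero_mul, ite_self, ite_self, add_zero]
      by_cases ha : a = W
      · rw [if_pos ha]
        by_cases hb : b = W
        · rw [if_pos hb, ha, hb, keepWt]
        · rw [if_neg hb, Lwt_eq_zero, zero_mul] <;> exact fun h => hb (Fin.ext h.2)
      · rw [if_neg ha, Lwt_eq_zero, zero_mul] <;> exact fun h => ha (Fin.ext h.1)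
    · by_cases ha : a = W
      · rw [if_pos ha, if_neg fun h => hWS (ha.symm.trans h), add_zero]
        by_cases hb : b = S
        · rw [if_pos hb, ha, hb, keepWt]
        · rw [if_neg hb, Lwt_eq_zero, zero_mul]
          · exact fun h => hb (Fin.ext h.2)
          · exact fun h => hWS (ha.symm.trans (Fin.ext h.1))
      · rw [if_neg ha, zero_add]
        by_cases ha' : a = S
        · rw [if_pos ha']
          by_cases hb : b = W
          · rw [if_pos hb, ha', hb, swapWt, if_neg fun h => hWS (Fin.ext h)]
          · rw [if_neg hb, Lwt_eq_zero, zero_mul]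
            · exact fun h => ha (Fin.ext h.1)
            · exact fun h => hb (Fin.ext h.2)
        · rw [if_neg ha', Lwt_eq_zero, zero_mul]
          · exact fun h => ha (Fin.ext h.1)
          · exact fun h => ha' (Fin.ext h.1)
  simp only [key, Finset.sum_add_distrib]
  simp

theorem sum_fin_cons {α : Type*} [Fintype α] {m : ℕ} (f : (Fin (m + 1) → α) → K) :
    ∑ V, f V = ∑ a, ∑ V' : Fin m → α, f (Fin.cons a V') := by
  rw [← Fintype.sum_prod_type' fun a (V' : Fin m → α) => f (Fin.cons a V')]
  exact ((Fin.consEquiv fun _ => α).sum_comp f).symm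

theorem sum_fin_snoc {α : Type*} [Fintype α] {m : ℕ} (f : (Fin (m + 1) → α) → K) :
    ∑ V, f V = ∑ a, ∑ V' : Fin m → α, f (Fin.snoc V' a) := by
  rw [← Fintype.sum_prod_type' fun a (V' : Fin m → α) => f (Fin.snoc V' a)]
  exact ((Fin.snocEquiv fun _ => α).sum_comp f).symm

/-- The label sequence above a row of `m` tiles, with north labels `V` and last east label `e`. -/
def updRow {M : ℕ} (s : ℕ → ℕ) (j m : ℕ) (V : Fin m → Fin M) (e : Fin M) (i : ℕ) : ℕ :=
  if h : j ≤ i ∧ i < j + m then (V ⟨i - j, by omega⟩ : ℕ) else if i = j + m then e else s i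

theorem updRow_add {M : ℕ} (s : ℕ → ℕ) (j : ℕ) {m : ℕ} (V : Fin m → Fin M) (e : Fin M) (l : Fin m) :
    updRow s j m V e (j + l) = V l := by
  rw [updRow, dif_pos ⟨by omega, by omega⟩]
  congr 2
  exact Fin.ext (Nat.add_sub_cancel_left _ _)

theorem updRow_last {M : ℕ} (s : ℕ → ℕ) (j : ℕ) {m : ℕ} (V : Fin m → Fin M) (e : Fin M) :
    updRow s j m V e (j + m) = e := by
  rw [updRow, dif_neg (by omega), if_pos rfl]

theorem updRow_of_not {M : ℕ} (s : ℕ → ℕ) {j m i : ℕ} (V : Fin m → Fin M) (e : Fin M)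
    (h : i < j ∨ j + m < i) : updRow s j m V e i = s i := by
  rw [updRow, dif_neg (by omega), if_neg (by omega)]

theorem updRow_cons {M : ℕ} {s s' : ℕ → ℕ} {j : ℕ} (m : ℕ) (a : Fin M) (V : Fin m → Fin M) (e : Fin M)
    (ha : s' j = a) (hs : ∀ i, i < j ∨ j + 1 < i → s' i = s i) :
    updRow s' (j + 1) m V e = updRow s j (m + 1) (Fin.cons a V) e := by
  funext i
  rcases lt_trichotomy i j with h | rfl | h
  · rw [updRow_of_not _ _ _ (by omega), updRow_of_not _ _ _ (by omega), hs i (by omega)]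
  · rw [updRow_of_not _ _ _ (by omega), ha]
    exact (updRow_add s i (Fin.cons a V : Fin (m + 1) → Fin M) e 0).symm
  · by_cases h1 : i < j + 1 + m
    · obtain ⟨l, rfl⟩ := Nat.exists_eq_add_of_le (show j + 1 ≤ i from h)
      have e1 := updRow_add s' (j + 1) V e ⟨l, by omega⟩
      have e2 := updRow_add s j (Fin.cons a V : Fin (m + 1) → Fin M) e (Fin.succ ⟨l, by omega⟩)
      rw [Fin.cons_succ, Fin.val_succ] at e2
      rw [show j + 1 + l = j + (l + 1) by omega] at e1 ⊢
      exact e1.trans e2.symm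
    · by_cases h2 : i = j + 1 + m
      · subst h2
        rw [updRow_last, add_assoc, add_comm 1 m, updRow_last]
      · rw [updRow_of_not _ _ _ (by omega), updRow_of_not _ _ _ (by omega), hs i (by omega)]

theorem rowOp_eq_sum {M : ℕ} (φ : (ℕ → ℕ) → K) : ∀ (m j : ℕ) (x : ℕ → K) (s : ℕ → ℕ),
    (∀ i, j ≤ i → i ≤ j + m → s i < M) →
    rowOp β k x j m φ s = ∑ V : Fin m → Fin M, ∑ H : Fin (m + 1) → Fin M,
      if (H 0 : ℕ) = s j then
        (∏ l : Fin m, Lwt β k (x l) (V l) (H l.succ) (H l.castSucc) (s (j + 1 + l)))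
          * φ (updRow s j m V (H (Fin.last m)))
      else 0
  | 0, j, x, s, hs => by
    rw [rowOp, Fintype.sum_unique, sum_fin_cons,
      Finset.sum_eq_single (⟨s j, hs j le_rfl le_rfl⟩ : Fin M)]
    · rw [Fintype.sum_unique, Fin.cons_zero, if_pos rfl, Finset.univ_eq_empty, Finset.prod_empty, one_mul]
      congr 1
      funext i
      by_cases hi : i = j
      · subst hi
        rw [updRow, dif_neg (by omega), if_pos (Nat.add_zero i).symm]
        rfl
      · rw [updRow_of_not _ _ _ (by omega)]
    · intro b _ hb
      rw [Fintype.sum_unique, if_neg]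
      exact fun h => hb (Fin.ext h)
    · simp
  | m + 1, j, x, s, hs => by
    have hsw1 : (s ∘ Equiv.swap j (j + 1)) (j + 1) = s j := by simp
    have hsw0 : (s ∘ Equiv.swap j (j + 1)) j = s (j + 1) := by simp
    have hsw : ∀ i, i < j ∨ j + 1 < i → (s ∘ Equiv.swap j (j + 1)) i = s i := fun i hi => by
      rw [Function.comp_apply, Equiv.swap_apply_of_ne_of_ne (by omega) (by omega)]
    have hs0 := hs j le_rfl (by omega)
    have hs1 := hs (j + 1) (by omega) (by omega)
    rw [rowOp]
    generalize s ∘ Equiv.swap j (j + 1) = s' at hsw1 hsw0 hsw ⊢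
    rw [rowOp_eq_sum (M := M) φ m (j + 1) _ s (fun i h1 h2 => hs i (by omega) (by omega)),
      rowOp_eq_sum (M := M) φ m (j + 1) _ s']
    · have := sum_Lwt_mul (β := β) (k := k) (x 0) ⟨s j, hs0⟩ ⟨s (j + 1), hs1⟩
        fun a b : Fin M => ∑ V : Fin m → Fin M, ∑ H : Fin (m + 1) → Fin M,
          if H 0 = b then
            (∏ l : Fin m, Lwt β k (x (l + 1)) (V l) (H l.succ) (H l.castSucc) (s (j + 1 + 1 + l)))
              * φ (updRow s j (m + 1) (Fin.cons a V) (H (Fin.last m)))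
          else 0
      simp only [hsw1]
      have e1 : ∀ V : Fin m → Fin M, ∀ e, updRow s (j + 1) m V e
          = updRow s j (m + 1) (Fin.cons ⟨s j, hs0⟩ V) e := fun V e =>
        updRow_cons m ⟨s j, hs0⟩ V e rfl fun _ _ => rfl
      have e2 : ∀ V : Fin m → Fin M, ∀ e, updRow s' (j + 1) m V e
          = updRow s j (m + 1) (Fin.cons ⟨s (j + 1), hs1⟩ V) e := fun V e =>
        updRow_cons m ⟨s (j + 1), hs1⟩ V e hsw0 hsw
      have e3 : ∀ l : Fin m, s' (j + 1 + 1 + l) = s (j + 1 + 1 + l) :=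
        fun l => hsw _ (by omega)
      simp only [Fin.ext_iff] at this
      simp only [e1, e2, e3]
      rw [← this, sum_fin_cons]
      refine Finset.sum_congr rfl fun a _ => ?_
      simp only [Finset.mul_sum]
      rw [Finset.sum_comm]
      refine Finset.sum_congr rfl fun V _ => ?_
      rw [Finset.sum_comm]
      refine Eq.trans ?_ (sum_fin_cons _).symm
      rw [Finset.sum_eq_single (s := Finset.univ) (⟨s j, hs0⟩ : Fin M)]
      · refine Finset.sum_congr rfl fun H _ => ?_
        rw [Finset.sum_eq_single (H 0), if_pos rfl, Fin.cons_zero, if_pos rfl, Fin.prod_univ_succ]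
        · simp only [Fin.cons_zero, Fin.cons_succ, Fin.castSucc_zero, Fin.val_zero, add_zero,
            ← Fin.succ_castSucc, Fin.val_succ, ← Fin.succ_last, mul_assoc, add_assoc, add_comm 1]
        · intro b _ hb
          rw [if_neg fun h => hb (Fin.ext h.symm), mul_zero]
        · simp
      · intro b _ hb
        refine Finset.sum_eq_zero fun H _ => if_neg fun h => hb (Fin.ext h)
      · simp
    · intro i h1 h2
      rcases h1.eq_or_lt with rfl | h1
      · rwa [hsw1]
      · rw [hsw i (by omega)]
        exact hs i (by omega) (by omega)

end

section

variable {K : Type*} [Field K] (β : K) (k : ℕ) (t y : ℕ → K)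

open Classical in
/-- The weight of the first `m` rows of a state, with left labels `0` and top and right labels
prescribed by `s`. -/
def stripWt (s : ℕ → ℕ) {n m M : ℕ} (V : Fin (m + 1) → Fin n → Fin M)
    (H : Fin m → Fin (n + 1) → Fin M) : K :=
  if (∀ l : Fin n, (V 0 l : ℕ) = s l) ∧ (∀ i, (H i 0 : ℕ) = 0) ∧
      ∀ i : Fin m, (H i (Fin.last n) : ℕ) = s (n + i) then
    ∏ i : Fin m, ∏ l : Fin n, Lwt β k (ominus β (t l) (y i)) (V i.castSucc l) (H i l.succ)
      (H i l.castSucc) (V i.succ l)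
  else 0

theorem stripWt_snoc (s : ℕ → ℕ) {n m M : ℕ} (V : Fin (m + 1) → Fin n → Fin M)
    (S : Fin n → Fin M) (H : Fin m → Fin (n + 1) → Fin M) (h : Fin (n + 1) → Fin M) :
    stripWt β k t y s (Fin.snoc V S : Fin (m + 2) → Fin n → Fin M)
        (Fin.snoc H h : Fin (m + 1) → Fin (n + 1) → Fin M)
      = if (h 0 : ℕ) = 0 ∧ (h (Fin.last n) : ℕ) = s (n + m) then
          (∏ l : Fin n, Lwt β k (ominus β (t l) (y m)) (V (Fin.last m) l) (h l.succ)
            (h l.castSucc) (S l)) * stripWt β k t y s V H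
        else 0 := by
  have h0 : (Fin.snoc V S : Fin (m + 2) → Fin n → Fin M) 0 = V 0 := by
    rw [← Fin.castSucc_zero, Fin.snoc_castSucc]
  simp only [stripWt, Fin.forall_fin_succ', Fin.prod_univ_castSucc, Fin.snoc_castSucc, Fin.snoc_last,
    Fin.val_castSucc, Fin.val_last, h0, Fin.succ_castSucc, Fin.succ_last]
  by_cases h1 : (h 0 : ℕ) = 0 ∧ (h (Fin.last n) : ℕ) = s (n + m)
  · rw [if_pos h1]
    by_cases h2 : (∀ l : Fin n, (V 0 l : ℕ) = s l) ∧ (∀ i, (H i 0 : ℕ) = 0) ∧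
      ∀ i : Fin m, (H i (Fin.last n) : ℕ) = s (n + i)
    · rw [if_pos h2, if_pos ⟨h2.1, ⟨h2.2.1, h1.1⟩, h2.2.2, h1.2⟩, mul_comm]
    · rw [if_neg h2, mul_zero, if_neg fun h3 => h2 ⟨h3.1, h3.2.1.1, h3.2.2.1⟩]
  · rw [if_neg h1, if_neg fun h3 => h1 ⟨h3.2.1.2, h3.2.2.2⟩]

open Classical in
theorem gridOp_eq_sum (s0 : ℕ → ℕ) {n M : ℕ} (hM : 0 < M) : ∀ m ≤ n, ∀ (s : ℕ → ℕ)
    (S : Fin n → Fin M), (∀ i < m, s i = 0) → (∀ l : Fin n, s (m + l) = S l) →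
    gridOp β k t y n m (fun s' => if ∀ i < n + n, s' i = s0 i then 1 else 0) s
      = if ∀ i, m + n ≤ i → i < n + n → s i = s0 i then
          ∑ V : Fin m → Fin n → Fin M, ∑ H : Fin m → Fin (n + 1) → Fin M,
            stripWt β k t y s0 (Fin.snoc V S : Fin (m + 1) → Fin n → Fin M) H
        else 0
  | 0, _, s, S, _, hS => by
    rw [gridOp, Fintype.sum_unique, Fintype.sum_unique, stripWt]
    have h0 (V : Fin 0 → Fin n → Fin M) : (Fin.snoc V S : Fin 1 → Fin n → Fin M) 0 = S :=
      Fin.snoc_last (α := fun _ => Fin n → Fin M) S V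
    simp only [h0, Finset.univ_eq_empty, Finset.prod_empty, ← ite_and]
    refine if_congr ⟨fun h => ⟨fun i _ => h i, fun l => ?_, fun i => i.elim0, fun i => i.elim0⟩,
      fun h i hi => ?_⟩ rfl rfl
    · rw [← hS, zero_add]
      exact h l (by omega)
    · by_cases hin : i < n
      · rw [← h.2.1 ⟨i, hin⟩, ← hS, zero_add]
      · exact h.1 i (by omega) hi
  | m + 1, hm, s, S, hs, hS => by
    have hbd : ∀ i, m ≤ i → i ≤ m + n → s i < M := by
      intro i h1 h2
      rcases h1.eq_or_lt with rfl | h1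
      · rw [hs m (by omega)]
        exact hM
      · obtain ⟨l, rfl⟩ := Nat.exists_eq_add_of_le (show m + 1 ≤ i from h1)
        rw [hS ⟨l, by omega⟩]
        exact (S _).2
    have hupd (V1 : Fin n → Fin M) (e : Fin M) :
        (∀ i, m + n ≤ i → i < n + n → updRow s m n V1 e i = s0 i) ↔
          (e : ℕ) = s0 (n + m) ∧ ∀ i, m + 1 + n ≤ i → i < n + n → s i = s0 i := by
      constructor
      · intro h
        refine ⟨?_, fun i h1 h2 => ?_⟩
        · rw [← updRow_last s m V1 e, add_comm n m]
          exact h _ le_rfl (by omega)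
        · rw [← updRow_of_not s (j := m) V1 e (by omega)]
          exact h i (by omega) h2
      · rintro ⟨h1, h2⟩ i h3 h4
        rcases h3.eq_or_lt with rfl | h3
        · rw [updRow_last, h1, add_comm]
        · rw [updRow_of_not _ _ _ (by omega)]
          exact h2 i (by omega) h4
    rw [gridOp, rowOp_eq_sum (M := M) _ _ _ _ _ hbd]
    have ih (V1 : Fin n → Fin M) (e : Fin M) := gridOp_eq_sum s0 hM m (by omega)
      (updRow s m n V1 e) V1 (fun i hi => by rw [updRow_of_not _ _ _ (by omega), hs i (by omega)])
      (fun l => updRow_add s m V1 e l)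
    simp only [ih, hupd, hs m (by omega), hS]
    by_cases ht : ∀ i, m + 1 + n ≤ i → i < n + n → s i = s0 i
    · rw [if_pos ht]
      refine Eq.trans ?_ (sum_fin_snoc _).symm
      refine Finset.sum_congr rfl fun V1 _ => ?_
      refine Eq.trans ?_ (Finset.sum_congr rfl fun V' _ => (sum_fin_snoc _).symm)
      refine Eq.trans ?_ Finset.sum_comm
      refine Finset.sum_congr rfl fun H1 _ => ?_
      simp only [stripWt_snoc, Fin.snoc_last]
      by_cases h0 : (H1 0 : ℕ) = 0
      · by_cases h1 : (H1 (Fin.last n) : ℕ) = s0 (n + m)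
        · simp only [h0, h1, true_and, if_true]
          rw [if_pos ht]
          simp only [Finset.mul_sum]
        · simp [h1]
      · simp [h0]
    · rw [if_neg ht]
      refine Finset.sum_eq_zero fun V1 _ => Finset.sum_eq_zero fun H1 _ => ?_
      rw [if_neg (fun h : _ ∧ _ => ht h.2), mul_zero, ite_self]

variable {β k t y} {G : (ℕ → K) → Equiv.Perm ℕ → MvPolynomial ℕ K}
  {c : (ℕ → K) → (ℕ → K) → Equiv.Perm ℕ → Equiv.Perm ℕ → Equiv.Perm ℕ → K}
  {n : ℕ} {u v w : Equiv.Perm ℕ}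

open Classical in
theorem structConst_eq_sum (hG : GrothFamily β G) (hc : StructConsts β G c)
    (ht : ∀ j, 1 + β * t j ≠ 0) (hy : ∀ j, 1 + β * y j ≠ 0) (hkn : k ≤ n)
    (hu : InSn n u) (hv : InSn n v) (hw : InSn n w) (hsep : SepDesc k u v) :
    c t y u v w = ∑ π : GridState n, if BoundaryCond n k u v w π then stateWt β k t y π else 0 := by
  have hη : ∀ l : Fin n, etaLab w l < n + 1 := by
    intro l
    have h : w⁻¹ (l : ℕ) < n := by
      by_contra! h
      have := hw _ h
      rw [perm_apply_inv] at this
      omega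
    rw [etaLab]
    omega
  rw [← gridOp_eq_structConst hG hc ht hy hkn hu hv hw hsep,
    gridOp_eq_sum β k t y (topRight n k u v) (Nat.succ_pos n) n le_rfl (leftBottom n w)
      (fun l => ⟨etaLab w l, hη l⟩) (fun i hi => if_pos hi)
      (fun l => by rw [leftBottom, if_neg (by omega), Nat.add_sub_cancel_left]),
    if_pos fun i h1 h2 => absurd h1 (by omega), Fintype.sum_prod_type_right, sum_fin_snoc,
    Finset.sum_eq_single (s := Finset.univ) (fun l => ⟨etaLab w l, hη l⟩ : Fin n → Fin (n + 1))]
  · refine Finset.sum_congr rfl fun V _ => Finset.sum_congr rfl fun H _ => ?_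
    rw [stripWt]
    refine if_congr ?_ rfl rfl
    simp only [BoundaryCond, topRight, Fin.snoc_last]
    constructor
    · rintro ⟨h1, h2, h3⟩
      refine ⟨h2, fun i => ?_, fun l => ?_, fun _ => trivial⟩
      · rw [h3, if_neg (by omega), Nat.add_sub_cancel_left]
      · rw [h1, if_pos l.2]
    · rintro ⟨h1, h2, h3, -⟩
      refine ⟨fun l => ?_, h1, fun i => ?_⟩
      · rw [h3, if_pos l.2]
      · rw [h2, if_neg (by omega), Nat.add_sub_cancel_left]
  · intro S _ hS
    refine Finset.sum_eq_zero fun V _ => Finset.sum_eq_zero fun H _ => if_neg fun h => hS ?_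
    funext l
    have := h.2.2.2 l
    simp only [Fin.snoc_last] at this
    exact Fin.ext this
  · simp

theorem Lwt_eq_zero_of_not_LAdm (x : K) {N E W S : ℕ} (h : ¬ LAdm k N E W S) :
    Lwt β k x N E W S = 0 := by
  simp only [LAdm, not_or] at h
  obtain ⟨h1, h2, h3, h4, h5, h6, h7, h8, h9, h10, h11⟩ := h
  rw [Lwt, if_neg h1, if_neg h2, if_neg h3, if_neg h4, if_neg h5, if_neg h6, if_neg h7, if_neg h8,
    if_neg h9, if_neg h10, if_neg h11]

theorem stateWt_eq_zero (π : GridState n) (i : Fin n)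
    (h : labN π i i = 0 ∧ labE π i i = 0 ∧ labW π i i = 0 ∧ labS π i i = 0) :
    stateWt β k t t π = 0 := by
  refine Finset.prod_eq_zero (Finset.mem_univ i) (Finset.prod_eq_zero (Finset.mem_univ i) ?_)
  rw [Lwt, if_pos h, ominus, sub_self, zero_div]

theorem structConst_self_eq_finsum (hG : GrothFamily β G) (hc : StructConsts β G c)
    (ht : ∀ j, 1 + β * t j ≠ 0) (hkn : k ≤ n)
    (hu : InSn n u) (hv : InSn n v) (hw : InSn n w) (hsep : SepDesc k u v) :
    c t t u v w = ∑ᶠ π ∈ {π ∈ PP n k u v w | ∀ i : Fin n,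
      ¬(labN π i i = 0 ∧ labE π i i = 0 ∧ labW π i i = 0 ∧ labS π i i = 0)},
        stateWt β k t t π := by
  classical
  rw [structConst_eq_sum hG hc ht ht hkn hu hv hw hsep, finsum_mem_def,
    finsum_eq_sum_of_fintype]
  refine Finset.sum_congr rfl fun π _ => ?_
  rw [Set.indicator_apply]
  by_cases hB : BoundaryCond n k u v w π
  · rw [if_pos hB]
    by_cases hD : ∀ i : Fin n,
        ¬(labN π i i = 0 ∧ labE π i i = 0 ∧ labW π i i = 0 ∧ labS π i i = 0)
    · by_cases hA : ∀ i j : Fin n,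
          LAdm k (labN π i j) (labE π i j) (labW π i j) (labS π i j)
      · rw [if_pos ⟨⟨hB, hA⟩, hD⟩]
      · rw [if_neg fun h => hA h.1.2]
        push Not at hA
        obtain ⟨i, j, hij⟩ := hA
        exact Finset.prod_eq_zero (Finset.mem_univ i)
          (Finset.prod_eq_zero (Finset.mem_univ j) (Lwt_eq_zero_of_not_LAdm _ hij))
    · rw [if_neg fun h => hD h.2]
      push Not at hD
      obtain ⟨i, hi⟩ := hD
      exact stateWt_eq_zero π i hi
  · rw [if_neg hB, if_neg fun h => hB h.1.1]

theorem southwest_tile {π : GridState n} (hπ : π ∈ PP n k u v w)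
    (hD : ∀ i : Fin n, ¬(labN π i i = 0 ∧ labE π i i = 0 ∧ labW π i i = 0 ∧ labS π i i = 0)) :
    (∀ i : Fin n,
      (labN π i i = 0 ∧ labW π i i = 0 ∧ 0 < labE π i i ∧ labE π i i = labS π i i) ∨
      (labE π i i = 0 ∧ labW π i i = 0 ∧ 0 < labN π i i ∧ labN π i i = labS π i i)) ∧
    (∀ i j : Fin n, (j : ℕ) < (i : ℕ) →
      labE π i j = 0 ∧ labW π i j = 0 ∧ 0 < labN π i j ∧ labN π i j = labS π i j) := by
  have tile {N E W S : ℕ} (h : LAdm k N E W S) (hW : W = 0) :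
      (N = 0 ∧ E = 0 ∧ W = 0 ∧ S = 0) ∨ (N = 0 ∧ W = 0 ∧ 0 < E ∧ E = S) ∨
        (E = 0 ∧ W = 0 ∧ 0 < N ∧ N = S) := by
    unfold LAdm at h
    omega
  have diag (i : Fin n) (hW : labW π i i = 0) :
      (labN π i i = 0 ∧ labW π i i = 0 ∧ 0 < labE π i i ∧ labE π i i = labS π i i) ∨
      (labE π i i = 0 ∧ labW π i i = 0 ∧ 0 < labN π i i ∧ labN π i i = labS π i i) :=
    (tile (hπ.2 i i) hW).resolve_left (hD i)
  have below (j : ℕ) (hj : j < n) (hW : ∀ i : Fin n, j ≤ i → labW π i ⟨j, hj⟩ = 0) :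
      ∀ (i : ℕ) (hi : i < n), j < i →
        labE π ⟨i, hi⟩ ⟨j, hj⟩ = 0 ∧ labW π ⟨i, hi⟩ ⟨j, hj⟩ = 0 ∧ 0 < labN π ⟨i, hi⟩ ⟨j, hj⟩ ∧
          labN π ⟨i, hi⟩ ⟨j, hj⟩ = labS π ⟨i, hi⟩ ⟨j, hj⟩ := by
    intro i
    induction i with
    | zero => intro _ h; omega
    | succ i ih =>
      intro hi hji
      have hS : 0 < labS π ⟨i, by omega⟩ ⟨j, hj⟩ := by
        rcases (Nat.lt_succ_iff.1 hji).eq_or_lt with rfl | h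
        · have := diag ⟨j, hj⟩ (hW ⟨j, hj⟩ le_rfl)
          omega
        · have := ih (by omega) h
          omega
      have hN : labN π ⟨i + 1, hi⟩ ⟨j, hj⟩ = labS π ⟨i, by omega⟩ ⟨j, hj⟩ := rfl
      have := tile (hπ.2 ⟨i + 1, hi⟩ ⟨j, hj⟩) (hW ⟨i + 1, hi⟩ hji.le)
      omega
  have west : ∀ (j : ℕ) (hj : j < n) (i : Fin n), j ≤ i → labW π i ⟨j, hj⟩ = 0 := by
    intro j
    induction j with
    | zero => exact fun hj i _ => hπ.1.1 i
    | succ j ih => exact fun hj i hi => (below j (by omega) (ih (by omega)) i i.2 hi).1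
  exact ⟨fun i => diag i (west i i.2 i le_rfl),
    fun i j hij => below j j.2 (west j j.2) i i.2 hij⟩

end

/-- recovering the Knutson–Zinn-Justin separated-descent puzzle
rule at `y = t`.  A pipe puzzle `π ∈ PP(u,v,w)` has `wt(π)|_{y=t} ≠ 0` only if it
has no empty tile on the main diagonal; any such `π` has each diagonal tile equal
to an elbow `⌐` or a vertical pipe, and every tile strictly southwest of the
diagonal equal to a vertical pipe; and
`c_{u,v}^w(t,t) = Σ wt(π)|_{y := t}`, summed over the pipe puzzles with no empty
tile on the diagonal. -/
theorem separated_descent_puzzle_rule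
    {K : Type*} [Field K] (β : K)
    (G : (ℕ → K) → Equiv.Perm ℕ → MvPolynomial ℕ K)
    (c : (ℕ → K) → (ℕ → K) → Equiv.Perm ℕ → Equiv.Perm ℕ → Equiv.Perm ℕ → K)
    (hG : GrothFamily β G) (hc : StructConsts β G c)
    (n k : ℕ) (hk : k ≤ n)
    (u v w : Equiv.Perm ℕ) (hu : InSn n u) (hv : InSn n v) (hw : InSn n w)
    (hsep : SepDesc k u v)
    (t : ℕ → K) (ht : ∀ j, 1 + β * t j ≠ 0)
    (hLI : LinearIndependent K fun σ : {σ : Equiv.Perm ℕ // FinPerm σ} => G t σ.1) :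
    (∀ π ∈ PP n k u v w, stateWt β k t t π ≠ 0 →
      ∀ i : Fin n,
        ¬(labN π i i = 0 ∧ labE π i i = 0 ∧ labW π i i = 0 ∧ labS π i i = 0)) ∧
    (∀ π ∈ PP n k u v w,
      (∀ i : Fin n,
        ¬(labN π i i = 0 ∧ labE π i i = 0 ∧ labW π i i = 0 ∧ labS π i i = 0)) →
      (∀ i : Fin n,
        (labN π i i = 0 ∧ labW π i i = 0 ∧ 0 < labE π i i ∧ labE π i i = labS π i i) ∨
        (labE π i i = 0 ∧ labW π i i = 0 ∧ 0 < labN π i i ∧ labN π i i = labS π i i)) ∧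
      (∀ i j : Fin n, (j : ℕ) < (i : ℕ) →
        labE π i j = 0 ∧ labW π i j = 0 ∧ 0 < labN π i j ∧ labN π i j = labS π i j)) ∧
    (c t t u v w =
      ∑ᶠ π ∈ {π ∈ PP n k u v w |
          ∀ i : Fin n,
            ¬(labN π i i = 0 ∧ labE π i i = 0 ∧ labW π i i = 0 ∧ labS π i i = 0)},
        stateWt β k t t π) := by
  exact ⟨fun π _ hwt i h => hwt (stateWt_eq_zero π i h), fun π hπ hD => southwest_tile hπ hD,
    structConst_self_eq_finsum hG hc ht hk hu hv hw hsep⟩
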